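/- arXiv:math/0106016 — 3 statements merged into one kernel-verified Lean document; each statement's English description precedes it below -/
import Mathlib

section
/- For any integers n, N > 1 there exists a constant c(n, N) > 0 such that for every prime l > c(n, N) and any two rings of integers 𝒪 and 𝒪' of finite extensions of ℚ_l, every abstract (not assumed continuous) group homomorphism φ: SL_n(𝒪') → GL_N(𝒪) is continuous with respect to the l-adic topologies, and moreover if φ is nontrivial then the kernel of φ is contained in the subgroup of scalar matrices of SL_n(𝒪'). -/
open Matrix

/-- Reduction of `GL (Fin N) O` modulo an ideal `I`, i.e. the homomorphism
`GL_N(O) → GL_N(O/I)` induced by the quotient map. -/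
noncomputable def glReduction {O : Type*} [CommRing O] (N : ℕ) (I : Ideal O) :
    GL (Fin N) O →* GL (Fin N) (O ⧸ I) :=
  Matrix.GeneralLinearGroup.map (Ideal.Quotient.mk I)

/-- The level-`i` principal congruence subgroup `G_i` of `GL_N(O)`: the kernel of the
reduction map `GL_N(O) → GL_N(O/λ^i)`. -/
noncomputable def glCongruence {O : Type*} [CommRing O] (N : ℕ) (I : Ideal O) (i : ℕ) :
    Subgroup (GL (Fin N) O) :=
  (glReduction N (I ^ i)).ker

/-- The level-`j` principal congruence subgroup of `SL_n(O)`: the kernel of the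
reduction map `SL_n(O) → SL_n(O/λ^j)`. -/
noncomputable def slCongruence {O : Type*} [CommRing O] (n : ℕ) (I : Ideal O) (j : ℕ) :
    Subgroup (Matrix.SpecialLinearGroup (Fin n) O) :=
  (Matrix.SpecialLinearGroup.map (Ideal.Quotient.mk (I ^ j))).ker

theorem aux_spec_pow {F : Type*} [Field F] [IsAlgClosed F] {N : ℕ} (M : Matrix (Fin N) (Fin N) F)
    (hM : IsUnit M) (P : (Matrix (Fin N) (Fin N) F)ˣ) (h : M ^ 4 = P * M * (P⁻¹ : (Matrix (Fin N) (Fin N) F)ˣ)) :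
    ∀ μ ∈ spectrum F M, μ ^ (4 ^ N.factorial - 1) = 1 := by
  classical
  have hs : (fun x => x ^ 4) '' spectrum F M = spectrum F M := by
    rw [← spectrum.map_pow_of_pos M (by norm_num : 0 < 4), h, spectrum.units_conjugate]
  have hfin : (spectrum F M).Finite := by
    apply (M.charpoly.roots.toFinset.finite_toSet).subset
    intro μ hμ
    rw [Matrix.mem_spectrum_iff_isRoot_charpoly] at hμ
    simpa [M.charpoly_monic.ne_zero] using hμ
  have hcard : (spectrum F M).ncard ≤ N := by
    have h1 : (spectrum F M).ncard ≤ M.charpoly.roots.toFinset.card := by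
      rw [← Set.ncard_coe_finset]
      apply Set.ncard_le_ncard _ (Finset.finite_toSet _)
      intro μ hμ
      rw [Matrix.mem_spectrum_iff_isRoot_charpoly] at hμ
      simpa [M.charpoly_monic.ne_zero] using hμ
    have h2 := Multiset.toFinset_card_le M.charpoly.roots
    have h3 := M.charpoly.card_roots'
    rw [M.charpoly_natDegree_eq_dim, Fintype.card_fin] at h3
    omega
  have : Finite (spectrum F M) := hfin
  have hmaps : Set.MapsTo (fun x : F => x ^ 4) (spectrum F M) (spectrum F M) := by
    intro x hx; rw [← hs]; exact ⟨x, hx, rfl⟩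
  let f : spectrum F M → spectrum F M := hmaps.restrict
  have hf : Function.Surjective f := by
    rintro ⟨y, hy⟩
    rw [← hs] at hy
    obtain ⟨x, hx, rfl⟩ := hy
    exact ⟨⟨x, hx⟩, rfl⟩
  have hb : Function.Bijective f := Function.Surjective.bijective_of_finite hf
  let e : Equiv.Perm (spectrum F M) := Equiv.ofBijective f hb
  have he : e ^ N.factorial = 1 := by
    have h1 : e ^ Nat.card (Equiv.Perm (spectrum F M)) = 1 := pow_card_eq_one'
    rw [Nat.card_perm] at h1
    have h2 : (Nat.card (spectrum F M)).factorial ∣ N.factorial := Nat.factorial_dvd_factorial hcard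
    obtain ⟨k, hk⟩ := h2
    rw [hk, pow_mul, h1, one_pow]
  have hek : ∀ k : ℕ, ∀ x : spectrum F M, ((e ^ k) x : F) = (x : F) ^ (4 ^ k) := by
    intro k
    induction k with
    | zero => intro x; simp
    | succ k ih =>
      intro x
      rw [pow_succ', Equiv.Perm.mul_apply]
      change ((e ^ k) x : F) ^ 4 = _
      rw [ih, ← pow_mul, pow_succ]
  intro μ hμ
  have h1 := hek N.factorial ⟨μ, hμ⟩
  rw [he] at h1
  simp only [Equiv.Perm.coe_one, id_eq] at h1
  have hμ0 : μ ≠ 0 := by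
    rintro rfl
    exact (spectrum.zero_notMem_iff F).2 hM hμ
  have h4 : 0 < 4 ^ N.factorial := by positivity
  have : μ * μ ^ (4 ^ N.factorial - 1) = μ * 1 := by
    rw [← pow_succ', Nat.sub_add_cancel h4, mul_one]; exact h1.symm
  exact mul_left_cancel₀ hμ0 this

theorem aux_unip {F : Type*} [Field F] [IsAlgClosed F] {N : ℕ} (M : Matrix (Fin N) (Fin N) F)
    (h : ∀ μ ∈ spectrum F M, μ = 1) : (M - 1) ^ N = 0 := by
  have hsp := IsAlgClosed.splits M.charpoly
  have h0 : M.charpoly.roots = Multiset.replicate N 1 := by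
    rw [Multiset.eq_replicate]
    constructor
    · rw [← hsp.natDegree_eq_card_roots, M.charpoly_natDegree_eq_dim, Fintype.card_fin]
    · intro b hb
      apply h
      rw [Matrix.mem_spectrum_iff_isRoot_charpoly]
      exact Polynomial.isRoot_of_mem_roots hb
  have h1 : M.charpoly = (Polynomial.X - Polynomial.C 1) ^ N := by
    rw [hsp.eq_prod_roots_of_monic M.charpoly_monic, h0]
    simp
  have := M.aeval_self_charpoly
  rw [h1] at this
  simpa using this

theorem aux_unip' {O : Type*} [CommRing O] [IsDomain O] {N : ℕ} (M M' P : GL (Fin N) O)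
    (h1 : M = M' ^ (4 ^ N.factorial - 1)) (hm : 0 < 4 ^ N.factorial - 1) (h2 : M' ^ 4 = P * M' * P⁻¹) :
    ((M : Matrix (Fin N) (Fin N) O) - 1) ^ N = 0 := by
  let F := AlgebraicClosure (FractionRing O)
  let j : O →+* F := (algebraMap (FractionRing O) F).comp (algebraMap O (FractionRing O))
  have hj : Function.Injective j :=
    (algebraMap (FractionRing O) F).injective.comp (IsFractionRing.injective O (FractionRing O))
  let J : Matrix (Fin N) (Fin N) O →+* Matrix (Fin N) (Fin N) F := j.mapMatrix
  have hJ : Function.Injective J := Matrix.map_injective hj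
  apply hJ
  rw [map_pow, map_sub, map_one, map_zero]
  apply aux_unip
  have h3 := aux_spec_pow (J M') (M'.isUnit.map J) (Units.map (J : _ →* _) P) (by
    have := congrArg (fun x : GL (Fin N) O => J x) h2
    simpa using this)
  intro μ hμ
  have h4 : J M = J M' ^ (4 ^ N.factorial - 1) := by rw [h1]; simp
  rw [h4, spectrum.map_pow_of_pos _ hm] at hμ
  obtain ⟨ν, hν, rfl⟩ := hμ
  exact h3 ν hν

theorem aux_unip_pow {O : Type*} [CommRing O] [IsDomain O] [CharZero O] {N : ℕ}
    (M : Matrix (Fin N) (Fin N) O)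
    (h : (M - 1) ^ N = 0) (m : ℕ) (hm : 0 < m) (h1 : M ^ m = 1) : M = 1 := by
  let F := FractionRing O
  have hj : Function.Injective (algebraMap O F) := IsFractionRing.injective O F
  have : CharZero F := charZero_of_injective_algebraMap hj
  let J : Matrix (Fin N) (Fin N) O →+* Matrix (Fin N) (Fin N) F := (algebraMap O F).mapMatrix
  have hJ : Function.Injective J := Matrix.map_injective hj
  apply hJ
  have hn : (J M - 1) ^ N = 0 := by rw [← map_one J, ← map_sub, ← map_pow, h, map_zero]
  have hp : J M ^ m = 1 := by rw [← map_pow, h1, map_one]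
  rw [map_one]
  generalize J M = A at hn hp
  have hg := geom_sum_mul A m
  rw [hp, sub_self] at hg
  obtain ⟨B, hB, hB'⟩ : ∃ B, Commute B (A - 1) ∧ ∑ i ∈ Finset.range m, A ^ i = (m : Matrix (Fin N) (Fin N) F) + B * (A - 1) := by
    refine ⟨∑ i ∈ Finset.range m, ∑ k ∈ Finset.range i, A ^ k, ?_, ?_⟩
    · apply Commute.sum_left; intro i _; apply Commute.sum_left; intro k _
      exact ((Commute.refl A).pow_left k).sub_right (Commute.one_right _)
    · rw [Finset.sum_mul]
      simp_rw [geom_sum_mul]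
      simp
  have hu : IsUnit (∑ i ∈ Finset.range m, A ^ i) := by
    rw [hB']
    apply IsNilpotent.isUnit_add_left_of_commute
    · refine ⟨N, ?_⟩
      rw [hB.mul_pow, hn, mul_zero]
    · have : IsUnit ((algebraMap F (Matrix (Fin N) (Fin N) F)) (m : F)) :=
        (IsUnit.mk0 (m : F) (by exact_mod_cast hm.ne')).map _
      rwa [map_natCast] at this
    · exact (Nat.cast_commute m _).symm
  have := hu.mul_right_eq_zero.1 hg
  exact sub_eq_zero.1 this

theorem aux_unip_cong {O : Type*} [CommRing O] {N : ℕ}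
    (M : Matrix (Fin N) (Fin N) O) (l : ℕ) (hl : l.Prime) (hN : N < l)
    (h : (M - 1) ^ N = 0) (i : ℕ) : ∃ B, M ^ (l ^ i) = 1 + (l ^ i : ℕ) • B := by
  have hM : M = (M - 1) + 1 := by abel
  have hd : ∀ m, m ≠ 0 → m < l → l ^ i ∣ (l ^ i).choose m := by
    intro m hm0 hml
    have h2 := Nat.add_one_mul_choose_eq (l^i-1) (m-1)
    rw [Nat.sub_add_cancel (Nat.one_le_iff_ne_zero.2 hm0), Nat.sub_add_cancel (Nat.pos_of_ne_zero (pow_ne_zero _ hl.ne_zero))] at h2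
    have h3 : l ^ i ∣ (l^i).choose m * m := ⟨_, h2.symm⟩
    refine Nat.Coprime.dvd_of_dvd_mul_right ?_ h3
    apply Nat.Coprime.pow_left
    exact (Nat.coprime_of_lt_prime hm0 hml hl)
  have hterm : ∀ m : ℕ, ∃ B : Matrix (Fin N) (Fin N) O,
      (M - 1) ^ (m + 1) * 1 ^ (l ^ i - (m + 1)) * ((l ^ i).choose (m + 1) : Matrix (Fin N) (Fin N) O)
        = (l ^ i : ℕ) • B := by
    intro m
    by_cases hm : m + 1 < l
    · obtain ⟨k, hk⟩ := hd (m + 1) (by omega) hm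
      refine ⟨(M - 1) ^ (m + 1) * (k : Matrix (Fin N) (Fin N) O), ?_⟩
      rw [hk, one_pow, mul_one, Nat.cast_mul, nsmul_eq_mul, ← mul_assoc, ← mul_assoc,
        (Nat.cast_commute (l ^ i) ((M - 1) ^ (m + 1))).eq]
    · refine ⟨0, ?_⟩
      have : (M - 1) ^ (m + 1) = 0 := pow_eq_zero_of_le (by omega) h
      rw [this]; simp
  choose B hB using hterm
  refine ⟨∑ m ∈ Finset.range (l ^ i), B m, ?_⟩
  conv_lhs => rw [hM]
  rw [(Commute.one_right (M - 1)).add_pow, Finset.sum_range_succ', Finset.smul_sum]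
  simp_rw [hB]
  simp [add_comm]

section elim
variable {R : Type*} [CommRing R] {n : ℕ}

theorem aux_col_mem (c : R) (S : Submonoid (Matrix (Fin n) (Fin n) R))
    (hS : ∀ i j, i ≠ j → ∀ t, Matrix.transvection i j (c * t) ∈ S) (K : Fin n) (v : Fin n → R)
    (hK : v K = 0) (hv : ∀ i, c ∣ v i) : 1 + vecMulVec v (Pi.single K 1) ∈ S := by
  have key : ∀ s : Finset (Fin n),
      1 + vecMulVec (∑ i ∈ s, Pi.single i (v i)) (Pi.single K (1 : R)) ∈ S := by
    intro s
    induction s using Finset.induction_on with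
    | empty => simp
    | insert a s ha ih =>
      rw [Finset.sum_insert ha]
      by_cases h : a = K
      · subst h; simpa [hK] using ih
      obtain ⟨t, ht⟩ := hv a
      have := S.mul_mem (hS a K h t) ih
      convert this using 1
      have e : Matrix.transvection a K (c * t)
          = 1 + vecMulVec (Pi.single a (v a)) (Pi.single K (1 : R)) := by
        rw [Matrix.transvection, ht]
        congr 1
        ext x y
        simp only [Matrix.single_apply, vecMulVec_apply, Pi.single_apply]
        grind
      have hz : (Pi.single K (1 : R)) ⬝ᵥ (∑ i ∈ s, Pi.single i (v i)) = 0 := by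
        simp [Finset.sum_apply, Pi.single_apply, hK]
      rw [e, add_mul, mul_add, mul_add, vecMulVec_mul_vecMulVec, hz, Matrix.add_vecMulVec]
      simp; abel
  have := key Finset.univ
  rwa [Finset.univ_sum_single] at this

theorem aux_row_mem (c : R) (S : Submonoid (Matrix (Fin n) (Fin n) R))
    (hS : ∀ i j, i ≠ j → ∀ t, Matrix.transvection i j (c * t) ∈ S) (K : Fin n) (v : Fin n → R)
    (hK : v K = 0) (hv : ∀ i, c ∣ v i) : 1 + vecMulVec (Pi.single K 1) v ∈ S := by
  have key : ∀ s : Finset (Fin n),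
      1 + vecMulVec (Pi.single K (1 : R)) (∑ i ∈ s, Pi.single i (v i)) ∈ S := by
    intro s
    induction s using Finset.induction_on with
    | empty => simp
    | insert a s ha ih =>
      rw [Finset.sum_insert ha]
      by_cases h : a = K
      · subst h; simpa [hK] using ih
      obtain ⟨t, ht⟩ := hv a
      have := S.mul_mem ih (hS K a (Ne.symm h) t)
      convert this using 1
      have e : Matrix.transvection K a (c * t)
          = 1 + vecMulVec (Pi.single K (1 : R)) (Pi.single a (v a)) := by
        rw [Matrix.transvection, ht]
        congr 1
        ext x y
        simp only [Matrix.single_apply, vecMulVec_apply, Pi.single_apply]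
        grind
      have hz : (∑ i ∈ s, Pi.single i (v i)) ⬝ᵥ (Pi.single K (1 : R)) = 0 := by
        simp [Finset.sum_apply, Pi.single_apply, hK]
      rw [e, add_mul, mul_add, mul_add, vecMulVec_mul_vecMulVec, hz, Matrix.vecMulVec_add]
      simp; abel
  have := key Finset.univ
  rwa [Finset.univ_sum_single] at this

theorem aux_clear (c : R) (S : Submonoid (Matrix (Fin n) (Fin n) R))
    (hS : ∀ i j, i ≠ j → ∀ t, Matrix.transvection i j (c * t) ∈ S) (K : Fin n)
    (IH : ∀ M : Matrix (Fin n) (Fin n) R, M.det = 1 → (∀ i j, c ^ 2 ∣ (M - 1) i j) →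
      (∀ i j, i ≤ K ∨ j ≤ K → M i j = (1 : Matrix (Fin n) (Fin n) R) i j) → M ∈ S)
    (M : Matrix (Fin n) (Fin n) R) (hdet : M.det = 1)
    (hcl : ∀ i j, i < K ∨ j < K → M i j = (1 : Matrix (Fin n) (Fin n) R) i j)
    (hKK : M K K = 1) (hcol : ∀ i, i ≠ K → c ∣ M i K) (hrow : ∀ i, i ≠ K → c ∣ M K i)
    (hM : ∀ i j, i ≠ K → j ≠ K → c ^ 2 ∣ (M - 1) i j - M i K * M K j) : M ∈ S := by
  set v : Fin n → R := fun i => if i = K then 0 else M i K with hv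
  set w : Fin n → R := fun i => if i = K then 0 else M K i with hw
  have hvK : v K = 0 := by simp [hv]
  have hwK : w K = 0 := by simp [hw]
  have hvc : ∀ i, c ∣ v i := by
    intro i; by_cases h : i = K
    · simp [hv, h]
    · simpa [hv, h] using hcol i h
  have hwc : ∀ i, c ∣ w i := by
    intro i; by_cases h : i = K
    · simp [hw, h]
    · simpa [hw, h] using hrow i h
  set e : Fin n → R := Pi.single K 1 with he
  have hev : e ⬝ᵥ v = 0 := by simp [he, hvK]
  have hwe : w ⬝ᵥ e = 0 := by simp [he, hwK]
  have hA := aux_col_mem c S hS K v hvK hvc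
  have hB := aux_row_mem c S hS K w hwK hwc
  set M' := (1 - vecMulVec v e) * M * (1 - vecMulVec e w) with hM'
  have hAA : (1 + vecMulVec v e) * (1 - vecMulVec v e) = 1 := by
    rw [add_mul, mul_sub, mul_sub, vecMulVec_mul_vecMulVec, hev]; simp
  have hBB : (1 - vecMulVec e w) * (1 + vecMulVec e w) = 1 := by
    rw [sub_mul, mul_add, mul_add, vecMulVec_mul_vecMulVec, hwe]; simp
  have hMM : M = (1 + vecMulVec v e) * M' * (1 + vecMulVec e w) := by
    calc M = ((1 + vecMulVec v e) * (1 - vecMulVec v e)) * M * ((1 - vecMulVec e w) * (1 + vecMulVec e w)) := by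
          rw [hAA, hBB]; simp
      _ = _ := by rw [hM']; simp only [mul_assoc]
  have hdA : (1 - vecMulVec v e).det = 1 := by
    have : (1 - vecMulVec v e) = 1 + vecMulVec (-v) e := by rw [neg_vecMulVec]; abel
    rw [this, Matrix.vecMulVec_eq Unit, Matrix.det_one_add_replicateCol_mul_replicateRow]
    simp [hev]
  have hdB : (1 - vecMulVec e w).det = 1 := by
    have : (1 - vecMulVec e w) = 1 + vecMulVec e (-w) := by rw [vecMulVec_neg]; abel
    rw [this, Matrix.vecMulVec_eq Unit, Matrix.det_one_add_replicateCol_mul_replicateRow]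
    simp [hwe]
  have hent : ∀ i j, M' i j = M i j - v i * M K j - (M i K - v i * M K K) * w j := by
    intro i j
    simp only [hM', sub_mul, one_mul, mul_sub, mul_one, Matrix.sub_apply, vecMulVec_mul, mul_vecMulVec, he]
    simp [vecMulVec_apply]
  rw [hMM]
  refine S.mul_mem (S.mul_mem hA (IH M' ?_ ?_ ?_)) hB
  · rw [hM', det_mul, det_mul, hdA, hdB, hdet]; simp
  · intro i j
    rw [Matrix.sub_apply, hent, hKK]
    by_cases hi : i = K
    · subst hi
      by_cases hj : j = i
      · subst hj; simp [hvK, hwK, hKK]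
      · simp [hvK, hw, hj, hKK, Ne.symm hj]
    · by_cases hj : j = K
      · subst hj
        simp [hv, hi, hwK, hKK]
      · have := hM i j hi hj
        simp only [hv, hw, hi, hj, if_false]
        convert this using 1
        rw [Matrix.sub_apply]; ring
  · intro i j hij
    rw [hent, hKK]
    by_cases hi : i = K
    · subst hi
      by_cases hj : j = i
      · subst hj; simp [hvK, hwK, hKK]
      · simp [hvK, hw, hj, hKK, Ne.symm hj]
    · by_cases hj : j = K
      · subst hj
        simp [hv, hi, hwK, hKK]
      · have hij' : i < K ∨ j < K := by
          rcases hij with h | h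
          · exact Or.inl (lt_of_le_of_ne h hi)
          · exact Or.inr (lt_of_le_of_ne h hj)
        simp only [hv, hw, hi, hj, if_false]
        rw [hcl i j hij']
        rcases hij' with h | h
        · rw [hcl i K (Or.inl h)]; simp [hi]
        · rw [hcl K j (Or.inr h)]; simp [Ne.symm hj]

/-- If `transvection * M ∈ S` then `M ∈ S`. -/
theorem aux_transv (c : R) (S : Submonoid (Matrix (Fin n) (Fin n) R))
    (hS : ∀ i j, i ≠ j → ∀ t, Matrix.transvection i j (c * t) ∈ S) {i j : Fin n} (hij : i ≠ j) (t : R)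
    (M : Matrix (Fin n) (Fin n) R) (h : Matrix.transvection i j (c * t) * M ∈ S) : M ∈ S := by
  have := S.mul_mem (hS i j hij (-t)) h
  rw [← mul_assoc, Matrix.transvection_mul_transvection_same _ _ hij] at this
  simpa using this

theorem aux_elim [IsLocalRing R] (c : R) (S : Submonoid (Matrix (Fin n) (Fin n) R))
    (hS : ∀ i j, i ≠ j → ∀ t, Matrix.transvection i j (c * t) ∈ S) : ∀ d k : ℕ, k + d + 1 = n →
    ∀ M : Matrix (Fin n) (Fin n) R, M.det = 1 → (∀ i j, c ^ 2 ∣ (M - 1) i j) →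
      (∀ i j : Fin n, i.val < k ∨ j.val < k → M i j = (1 : Matrix (Fin n) (Fin n) R) i j) → M ∈ S := by
  intro d
  induction d with
  | zero =>
    intro k hk M hdet _ hcl
    have hkn : k < n := by omega
    have hoff : ∀ i j : Fin n, i ≠ j → M i j = 0 := by
      intro i j hij
      rw [hcl i j (by have := i.isLt; have := j.isLt; have : i.val ≠ j.val := fun h => hij (Fin.ext h); omega)]
      simp [hij]
    have hD : M = diagonal (fun i => M i i) := by
      ext i j
      by_cases h : i = j
      · subst h; simp
      · simp [h, hoff i j h]
    have hkk : M ⟨k, hkn⟩ ⟨k, hkn⟩ = 1 := by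
      rw [hD, det_diagonal, Finset.prod_eq_single ⟨k, hkn⟩] at hdet
      · exact hdet
      · intro b _ hb
        rw [hcl b b (Or.inl (by have : b.val ≠ k := fun h => hb (Fin.ext h); have := b.isLt; omega))]
        simp
      · simp
    have : M = 1 := by
      ext i j
      by_cases h : i = j
      · subst h
        by_cases h2 : i = ⟨k, hkn⟩
        · subst h2; simpa using hkk
        · exact hcl i i (Or.inl (by have : i.val ≠ k := fun h => h2 (Fin.ext h); have := i.isLt; omega))
      · simp [h, hoff i j h]
    rw [this]; exact S.one_mem
  | succ d ih =>
    intro k hk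
    have hkn : k < n := by omega
    have hkn1 : k + 1 < n := by omega
    set K : Fin n := ⟨k, hkn⟩ with hKdef
    set J : Fin n := ⟨k + 1, hkn1⟩ with hJdef
    have hKJ : K < J := by simp [hKdef, hJdef]
    have hJK : J ≠ K := ne_of_gt hKJ
    -- stage 3
    have st3 := aux_clear c S hS K (fun M h1 h2 h3 => ih (k + 1) (by omega) M h1 h2 (by
      intro i j hij
      apply h3
      simp only [Fin.le_def, hKdef]
      omega))
    -- stage 2
    have st2 : ∀ M : Matrix (Fin n) (Fin n) R, M.det = 1 →
        (∀ i j, ¬ (i = J ∧ j = K) → c ^ 2 ∣ (M - 1) i j) → M J K = c →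
        (∀ i j : Fin n, i < K ∨ j < K → M i j = (1 : Matrix (Fin n) (Fin n) R) i j) → M ∈ S := by
      intro M hdet hM hJKc hcl
      obtain ⟨s, hs⟩ := hM K K (by simp [Ne.symm hJK])
      have hKKs : M K K = 1 + c ^ 2 * s := by
        rw [Matrix.sub_apply, one_apply_eq] at hs; rw [← hs]; ring
      apply aux_transv c S hS (Ne.symm hJK) (-s)
      have hrowK : ∀ j, (Matrix.transvection K J (c * -s) * M) K j = M K j + (c * -s) * M J j := by
        intro j; simp
      have hrowne : ∀ i j, i ≠ K → (Matrix.transvection K J (c * -s) * M) i j = M i j := by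
        intro i j hi; simp [hi]
      apply st3
      · rw [det_mul, det_transvection_of_ne _ _ (Ne.symm hJK), hdet, one_mul]
      · intro i j hij
        by_cases hi : i = K
        · subst hi
          have hj : j < K := by simpa using hij
          rw [hrowK, hcl K j hij, hcl J j (Or.inr hj), one_apply_ne (ne_of_gt (hj.trans hKJ))]
          simp
        · rw [hrowne i j hi]; exact hcl i j hij
      · rw [hrowK, hJKc, hKKs]; ring
      · intro i hi
        rw [hrowne i K hi]
        by_cases hiJ : i = J
        · rw [hiJ, hJKc]
        · have := hM i K (by simp [hiJ])
          rw [Matrix.sub_apply, one_apply_ne hi, sub_zero] at this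
          exact (dvd_pow_self c two_ne_zero).trans this
      · intro i hi
        rw [hrowK]
        apply dvd_add
        · have := hM K i (by simp [Ne.symm hJK])
          rw [Matrix.sub_apply, one_apply_ne (Ne.symm hi), sub_zero] at this
          exact (dvd_pow_self c two_ne_zero).trans this
        · exact Dvd.intro (-s * M J i) (by ring)
      · intro i j hi hj
        rw [Matrix.sub_apply, hrowne i j hi, hrowne i K hi, hrowK, ← Matrix.sub_apply]
        apply dvd_sub (hM i j (by simp [hj]))
        have h1 : c ^ 2 ∣ M K j := by
          have := hM K j (by simp [hj])
          rwa [Matrix.sub_apply, one_apply_ne (Ne.symm hj), sub_zero] at this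
        by_cases hiJ : i = J
        · rw [hiJ, hJKc, mul_add]
          apply dvd_add (h1.mul_left _)
          exact Dvd.intro (-s * M J j) (by ring)
        · have := hM i K (by simp [hiJ])
          rw [Matrix.sub_apply, one_apply_ne hi, sub_zero] at this
          exact this.mul_right _
    -- stage 1
    have st1 : ∀ M : Matrix (Fin n) (Fin n) R, M.det = 1 →
        (∀ i j, c ^ 2 ∣ (M - 1) i j) → IsUnit (M K K) →
        (∀ i j : Fin n, i < K ∨ j < K → M i j = (1 : Matrix (Fin n) (Fin n) R) i j) → M ∈ S := by
      intro M hdet hM hu hcl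
      obtain ⟨r, hr⟩ := hM J K
      rw [Matrix.sub_apply, one_apply_ne hJK, sub_zero] at hr
      obtain ⟨b, hb⟩ := hu.exists_left_inv
      apply aux_transv c S hS hJK (b * (1 - c * r))
      have hrowJ : ∀ j, (Matrix.transvection J K (c * (b * (1 - c * r))) * M) J j
          = M J j + (c * (b * (1 - c * r))) * M K j := by
        intro j; simp
      have hrowne : ∀ i j, i ≠ J →
          (Matrix.transvection J K (c * (b * (1 - c * r))) * M) i j = M i j := by
        intro i j hi; simp [hi]
      apply st2
      · rw [det_mul, det_transvection_of_ne _ _ hJK, hdet, one_mul]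
      · intro i j hij
        rw [Matrix.sub_apply]
        by_cases hi : i = J
        · subst hi
          have hj : j ≠ K := fun h => hij ⟨rfl, h⟩
          rw [hrowJ, add_sub_right_comm, ← Matrix.sub_apply]
          apply dvd_add (hM _ _)
          have := hM K j
          rw [Matrix.sub_apply, one_apply_ne (Ne.symm hj), sub_zero] at this
          exact this.mul_left _
        · rw [hrowne i j hi, ← Matrix.sub_apply]; exact hM i j
      · rw [hrowJ, hr]
        linear_combination (c * (1 - c * r)) * hb
      · intro i j hij
        by_cases hi : i = J
        · subst hi
          have hj : j < K := by
            rcases hij with h | h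
            · exact absurd h (not_lt_of_gt hKJ)
            · exact h
          rw [hrowJ, hcl J j (Or.inr hj), hcl K j (Or.inr hj), one_apply_ne (ne_of_gt hj)]
          simp
        · rw [hrowne i j hi]; exact hcl i j hij
    -- stage 0
    intro M hdet hM hcl'
    have hcl : ∀ i j : Fin n, i < K ∨ j < K → M i j = (1 : Matrix (Fin n) (Fin n) R) i j := by
      intro i j hij; apply hcl'; simpa [Fin.lt_def, hKdef] using hij
    by_cases hu : IsUnit (M K K)
    · exact st1 M hdet hM hu hcl
    have hc : IsUnit c := by
      by_contra hc
      apply hu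
      obtain ⟨s, hs⟩ := hM K K
      rw [Matrix.sub_apply, one_apply_eq] at hs
      have : M K K = 1 - (-(c ^ 2 * s)) := by rw [← hs]; ring
      rw [this]
      apply IsLocalRing.isUnit_one_sub_self_of_mem_nonunits
      have hc : c ∈ IsLocalRing.maximalIdeal R := hc
      rw [← IsLocalRing.mem_maximalIdeal]
      rw [neg_mem_iff]
      exact Ideal.mul_mem_right _ _ (Ideal.pow_mem_of_mem _ hc 2 (by norm_num))
    obtain ⟨i, hi⟩ : ∃ i, IsUnit (M i K) := by
      by_contra! hno
      have hmem : ∀ i, M i K ∈ IsLocalRing.maximalIdeal R := hno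
      have : M.det ∈ IsLocalRing.maximalIdeal R := by
        rw [Matrix.det_eq_sum_mul_adjugate_col M K]
        exact Ideal.sum_mem _ (fun i _ => Ideal.mul_mem_right _ _ (hmem i))
      rw [hdet] at this
      exact (Ideal.ne_top_iff_one _).1 (IsLocalRing.maximalIdeal.isMaximal R).ne_top this
    have hiK : i ≠ K := by rintro rfl; exact hu hi
    have hKi : K < i := by
      rcases lt_or_gt_of_ne hiK with h | h
      · exfalso
        rw [hcl i K (Or.inl h), one_apply_ne hiK] at hi
        exact not_isUnit_zero hi
      · exact h
    obtain ⟨t, ht⟩ := hc.exists_right_inv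
    apply aux_transv c S hS (Ne.symm hiK) t
    rw [ht]
    apply st1
    · rw [det_mul, det_transvection_of_ne _ _ (Ne.symm hiK), hdet, one_mul]
    · intro a b
      exact (hc.pow 2).dvd
    · rw [Matrix.transvection_mul_apply_same, one_mul]
      by_contra hne
      have h1 : M K K ∈ IsLocalRing.maximalIdeal R := hu
      have h2 : M K K + M i K ∈ IsLocalRing.maximalIdeal R := hne
      have h3 : M i K ∈ IsLocalRing.maximalIdeal R := by
        have := Ideal.sub_mem _ h2 h1; simpa using this
      exact h3 hi
    · intro a b hab
      by_cases ha : a = K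
      · subst ha
        have hb : b < K := by simpa using hab
        rw [Matrix.transvection_mul_apply_same, hcl K b hab, hcl i b (Or.inr hb), one_apply_ne (ne_of_gt (hb.trans hKi))]
        simp
      · rw [Matrix.transvection_mul_apply_of_ne _ _ _ _ ha]; exact hcl a b hab

theorem aux_elim' [IsLocalRing R] (c : R) (S : Submonoid (Matrix (Fin n) (Fin n) R))
    (hS : ∀ i j, i ≠ j → ∀ t, Matrix.transvection i j (c * t) ∈ S)
    (M : Matrix (Fin n) (Fin n) R) (hdet : M.det = 1) (hM : ∀ i j, c ^ 2 ∣ (M - 1) i j) : M ∈ S := by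
  rcases Nat.eq_zero_or_pos n with h | h
  · subst h
    rw [Subsingleton.elim M 1]; exact S.one_mem
  · exact aux_elim c S hS (n - 1) 0 (by omega) M hdet hM (by intro i j h; omega)
end elim

section normal
variable {R : Type*} [CommRing R] {n : ℕ}


theorem aux_torus {i j : Fin n} (hij : i ≠ j) (u : Rˣ) :
    ∃ d : (Matrix.SpecialLinearGroup (Fin n) R), ∀ t : R, d * SpecialLinearGroup.transvection hij t * d⁻¹
      = SpecialLinearGroup.transvection hij ((u : R) ^ 2 * t) := by
  let f : Fin n → R := fun k => (if k = i then (u : R) else 1) * (if k = j then ((u⁻¹ : Rˣ) : R) else 1)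
  have hf : (diagonal f).det = 1 := by
    rw [det_diagonal, Finset.prod_mul_distrib]
    simp
  obtain ⟨d, hd⟩ : ∃ d : (Matrix.SpecialLinearGroup (Fin n) R), (d : Matrix (Fin n) (Fin n) R) = diagonal f := ⟨⟨diagonal f, hf⟩, rfl⟩
  refine ⟨d, fun t => ?_⟩
  rw [mul_inv_eq_iff_eq_mul]
  apply Subtype.ext
  change (d : Matrix (Fin n) (Fin n) R) * (1 + Matrix.single i j t)
    = (1 + Matrix.single i j ((u : R) ^ 2 * t)) * (d : Matrix (Fin n) (Fin n) R)
  rw [hd]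
  ext a b
  simp only [Matrix.add_apply, diagonal_mul, mul_diagonal, Matrix.single_apply]
  by_cases h : i = a ∧ j = b
  · obtain ⟨rfl, rfl⟩ := h
    have : (u : R) * ((u⁻¹ : Rˣ) : R) = 1 := by simp
    simp [f, hij, Ne.symm hij]
    linear_combination (-(u : R) * t) * this
  · by_cases hab : a = b
    · subst hab; simp [h, mul_comm]
    · simp [h, hab]

theorem aux_coe_add {i j : Fin n} (hij : i ≠ j) (s t : R) :
    (SpecialLinearGroup.transvection hij s : (Matrix.SpecialLinearGroup (Fin n) R)) * SpecialLinearGroup.transvection hij t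
      = SpecialLinearGroup.transvection hij (s + t) := by
  apply Subtype.ext
  exact Matrix.transvection_mul_transvection_same _ _ hij s t

theorem aux_coe_inv {i j : Fin n} (hij : i ≠ j) (s : R) :
    (SpecialLinearGroup.transvection hij s : (Matrix.SpecialLinearGroup (Fin n) R))⁻¹ = SpecialLinearGroup.transvection hij (-s) := by
  rw [inv_eq_iff_mul_eq_one, aux_coe_add, add_neg_cancel, SpecialLinearGroup.transvection_coeff_zero]

theorem aux_coe_pow {i j : Fin n} (hij : i ≠ j) (s : R) (m : ℕ) :
    (SpecialLinearGroup.transvection hij s : (Matrix.SpecialLinearGroup (Fin n) R)) ^ m = SpecialLinearGroup.transvection hij (m * s) := by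
  induction m with
  | zero => simp
  | succ m ih => rw [pow_succ, ih, aux_coe_add]; congr 1; push_cast; ring

theorem aux_single (i j : Fin n) (t : R) :
    Matrix.single i j t = t • vecMulVec (Pi.single i (1 : R)) (Pi.single j 1) := by
  ext x y
  simp only [Matrix.single_apply, vecMulVec_apply, Pi.single_apply, Matrix.smul_apply, smul_eq_mul]
  grind

theorem aux_offdiag (H : Subgroup (Matrix.SpecialLinearGroup (Fin n) R)) [H.Normal] (g : (Matrix.SpecialLinearGroup (Fin n) R)) (hg : g ∈ H)
    (hns : ¬ ∃ a, (g : Matrix (Fin n) (Fin n) R) = Matrix.scalar (Fin n) a) (h0 : 0 < n) :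
    ∃ g ∈ H, ∃ p q : Fin n, q ≠ p ∧ (g : Matrix (Fin n) (Fin n) R) q p ≠ 0 := by
  by_cases h : ∃ p q : Fin n, q ≠ p ∧ (g : Matrix (Fin n) (Fin n) R) q p ≠ 0
  · exact ⟨g, hg, h⟩
  push Not at h
  obtain ⟨i, j, hij⟩ : ∃ i j : Fin n, (g : Matrix (Fin n) (Fin n) R) i i ≠ (g : Matrix (Fin n) (Fin n) R) j j := by
    by_contra! hc
    apply hns
    refine ⟨(g : Matrix (Fin n) (Fin n) R) ⟨0, h0⟩ ⟨0, h0⟩, ?_⟩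
    ext a b
    by_cases hab : a = b
    · subst hab; simp [hc a ⟨0, h0⟩]
    · rw [h b a hab]; simp [hab]
  have hne : i ≠ j := by rintro rfl; exact hij rfl
  refine ⟨SpecialLinearGroup.transvection hne 1 * g * (SpecialLinearGroup.transvection hne 1)⁻¹,
    Subgroup.Normal.conj_mem ‹_› g hg _, j, i, hne, ?_⟩
  rw [aux_coe_inv]
  have : ((SpecialLinearGroup.transvection hne 1 * g * (SpecialLinearGroup.transvection hne (-1) : (Matrix.SpecialLinearGroup (Fin n) R)) : (Matrix.SpecialLinearGroup (Fin n) R))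
      : Matrix (Fin n) (Fin n) R) i j
      = (g : Matrix (Fin n) (Fin n) R) j j - (g : Matrix (Fin n) (Fin n) R) i i := by
    change (Matrix.transvection i j 1 * (g : Matrix (Fin n) (Fin n) R) * Matrix.transvection i j (-1) : Matrix (Fin n) (Fin n) R) i j = _
    rw [Matrix.mul_transvection_apply_same, Matrix.transvection_mul_apply_same,
      Matrix.transvection_mul_apply_same, h j i hne, h i j (Ne.symm hne)]
    ring
  rw [this]
  exact sub_ne_zero.2 (Ne.symm hij)

theorem aux_parabolic (g : (Matrix.SpecialLinearGroup (Fin n) R)) (p q : Fin n) (hqp : q ≠ p) (u : Rˣ)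
    (hu : (g : Matrix (Fin n) (Fin n) R) q p ∣ (u : R) ^ n - 1) :
    ∃ h : (Matrix.SpecialLinearGroup (Fin n) R), ((g⁻¹ * (h * g * h⁻¹) : (Matrix.SpecialLinearGroup (Fin n) R)) : Matrix (Fin n) (Fin n) R) *ᵥ (Pi.single p 1)
      = (((u⁻¹ : Rˣ) : R) ^ n) • (Pi.single p (1 : R)) := by
  obtain ⟨r0, hr0⟩ := hu
  set G := (g : Matrix (Fin n) (Fin n) R) with hG
  set ui : R := ((u⁻¹ : Rˣ) : R) with hui
  have huu : (u : R) * ui = 1 := by simp [hui]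
  have hn : n = (n - 1) + 1 := by have := p.isLt; omega
  let f : Fin n → R := fun k => if k = p then (u : R) ^ (n - 1) else ui
  have hf : (diagonal f).det = 1 := by
    rw [det_diagonal]
    simp only [f]
    rw [Finset.prod_ite]
    simp [Finset.filter_eq', Finset.filter_ne', ← mul_pow, huu]
  set r : R := - ui ^ n * r0 * G p p with hr
  let h : (Matrix.SpecialLinearGroup (Fin n) R) := ⟨diagonal f, hf⟩ * SpecialLinearGroup.transvection hqp.symm r
  have hh : ∀ (x : Fin n → R) (k : Fin n), ((h : Matrix (Fin n) (Fin n) R) *ᵥ x) k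
      = f k * (x k + (if k = p then r * x q else 0)) := by
    intro x k
    have : (h : Matrix (Fin n) (Fin n) R) = diagonal f * (1 + Matrix.single p q r) := rfl
    rw [this, ← mulVec_mulVec, mulVec_diagonal, add_mulVec, one_mulVec, aux_single, smul_mulVec, vecMulVec_mulVec]
    simp [Pi.single_apply]
  have h1 : (h : Matrix (Fin n) (Fin n) R) *ᵥ (Pi.single p 1) = ((u : R) ^ (n - 1)) • (Pi.single p (1 : R)) := by
    ext k
    rw [hh]
    by_cases hk : k = p
    · subst hk; simp [f, hqp]
    · simp [f, hk]
  have h2 : (h : Matrix (Fin n) (Fin n) R) *ᵥ (G *ᵥ Pi.single p 1) = ui • (G *ᵥ (Pi.single p (1 : R))) := by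
    ext k
    rw [hh]
    by_cases hk : k = p
    · subst hk
      simp [f, hr]
      have e1 : (u : R) ^ (n - 1) * ui ^ (n - 1) = 1 := by rw [← mul_pow, huu, one_pow]
      have e2 : ui ^ n = ui ^ (n - 1) * ui := by conv_lhs => rw [hn, pow_succ]
      have e3 : (u : R) ^ n = (u : R) ^ (n - 1) * u := by conv_lhs => rw [hn, pow_succ]
      rw [e3] at hr0
      rw [e2]
      linear_combination (-(ui * r0 * G k k * G q k)) * e1 + (ui * G k k) * hr0 - (u : R) ^ (n-1) * G k k * huu
    · simp [f, hk]
  refine ⟨h, ?_⟩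
  set b : (Matrix.SpecialLinearGroup (Fin n) R) := g⁻¹ * (h * g * h⁻¹) with hb
  have hbh : b * h = g⁻¹ * (h * g) := by rw [hb]; group
  have h3 : (b : Matrix (Fin n) (Fin n) R) *ᵥ ((h : Matrix (Fin n) (Fin n) R) *ᵥ (Pi.single p 1))
      = ui • (Pi.single p (1 : R)) := by
    have e : (b : Matrix (Fin n) (Fin n) R) * (h : Matrix (Fin n) (Fin n) R)
        = ((g⁻¹ : (Matrix.SpecialLinearGroup (Fin n) R)) : Matrix (Fin n) (Fin n) R) * ((h : Matrix (Fin n) (Fin n) R) * G) := by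
      exact congrArg (fun x : (Matrix.SpecialLinearGroup (Fin n) R) => (x : Matrix (Fin n) (Fin n) R)) hbh
    have e' : ((g⁻¹ : (Matrix.SpecialLinearGroup (Fin n) R)) : Matrix (Fin n) (Fin n) R) * G = 1 := by
      exact congrArg (fun x : (Matrix.SpecialLinearGroup (Fin n) R) => (x : Matrix (Fin n) (Fin n) R)) (inv_mul_cancel g)
    rw [mulVec_mulVec, e, ← mulVec_mulVec, ← mulVec_mulVec, h2, mulVec_smul, mulVec_mulVec, e', one_mulVec]
  rw [h1, mulVec_smul] at h3
  have h4 := congrArg (fun x => ui ^ (n - 1) • x) h3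
  simp only [smul_smul, ← mul_pow] at h4
  rw [mul_comm ui, huu, one_pow, one_smul, ← pow_succ, ← hn] at h4
  exact h4

theorem aux_transl (H : Subgroup (Matrix.SpecialLinearGroup (Fin n) R)) [H.Normal] (b : (Matrix.SpecialLinearGroup (Fin n) R)) (hb : b ∈ H) (p : Fin n) (u : Rˣ)
    (hbp : (b : Matrix (Fin n) (Fin n) R) *ᵥ (Pi.single p 1)
      = (((u⁻¹ : Rˣ) : R) ^ n) • (Pi.single p (1 : R))) (hun : (u : R) ^ (n * n) ≠ 1) :
    ∃ z ∈ H, ∃ w : Fin n → R, w p = 0 ∧ w ≠ 0 ∧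
      (z : Matrix (Fin n) (Fin n) R) = 1 + vecMulVec (Pi.single p 1) w := by
  set B := (b : Matrix (Fin n) (Fin n) R) with hB
  set ui : R := ((u⁻¹ : Rˣ) : R) with hui
  have huu : (u : R) * ui = 1 := by simp [hui]
  have huun : (u : R) ^ n * ui ^ n = 1 := by rw [← mul_pow, huu, one_pow]
  have hbc : ∀ k, B k p = ui ^ n * (Pi.single p (1 : R) : Fin n → R) k := by
    intro k
    have := congrFun hbp k
    simpa using this
  obtain ⟨k, hkp, hk⟩ : ∃ k, k ≠ p ∧ (u : R) ^ n • B k - Pi.single k 1 ≠ 0 := by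
    by_contra! hc
    apply hun
    have hBe : B = ui ^ n • (1 + vecMulVec (Pi.single p 1) ((u : R) ^ n • B p - Pi.single p 1)) := by
      ext i j
      simp only [Matrix.smul_apply, Matrix.add_apply, vecMulVec_apply, Pi.sub_apply, Pi.smul_apply, smul_eq_mul]
      by_cases hi : i = p
      · subst hi
        simp only [Pi.single_eq_same, one_mul, Matrix.one_apply, Pi.single_apply, eq_comm (a := j)]
        linear_combination (- B i j) * huun
      · have := congrFun (hc i hi) j
        simp only [Pi.sub_apply, Pi.smul_apply, smul_eq_mul, Pi.zero_apply, Pi.single_apply, eq_comm (a := j)] at this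
        simp only [Pi.single_apply, hi, if_false, zero_mul, add_zero, Matrix.one_apply]
        linear_combination ui ^ n * this - B i j * huun
    have hd : B.det = 1 := b.2
    rw [hBe, det_smul, Matrix.vecMulVec_eq Unit, Matrix.det_one_add_replicateCol_mul_replicateRow] at hd
    have e0 : ((u : R) ^ n • B p - Pi.single p 1) ⬝ᵥ Pi.single p 1 = 0 := by
      simp [hbc, huun]
    rw [e0, Fintype.card_fin, add_zero, mul_one] at hd
    calc (u : R) ^ (n * n) = (u : R) ^ (n * n) * (ui ^ n) ^ n := by rw [hd, mul_one]
      _ = ((u : R) ^ n * ui ^ n) ^ n := by rw [mul_pow, ← pow_mul, ← pow_mul]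
      _ = 1 := by rw [huun, one_pow]
  set w : Fin n → R := (u : R) ^ n • B k - Pi.single k 1 with hw
  have hwp : w p = 0 := by simp [hw, hbc, hkp, Ne.symm hkp]
  have hwe : w ⬝ᵥ Pi.single p 1 = 0 := by simp [hwp]
  have hdz : (1 + vecMulVec (Pi.single p 1) w).det = 1 := by
    rw [Matrix.vecMulVec_eq Unit, Matrix.det_one_add_replicateCol_mul_replicateRow, hwe, add_zero]
  let z : (Matrix.SpecialLinearGroup (Fin n) R) := ⟨1 + vecMulVec (Pi.single p 1) w, hdz⟩
  refine ⟨z, ?_, w, hwp, hk, rfl⟩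
  set y : (Matrix.SpecialLinearGroup (Fin n) R) := SpecialLinearGroup.transvection hkp.symm 1 with hy
  have hzz : z = b⁻¹ * (y * b * y⁻¹) := by
    have : b * z * y = y * b := by
      apply Subtype.ext
      change B * (1 + vecMulVec (Pi.single p 1) w) * (1 + Matrix.single p k 1) = (1 + Matrix.single p k 1) * B
      have e5 : vecMulVec (ui ^ n • Pi.single p (1 : R)) w
        = vecMulVec (Pi.single p 1) (B k) - vecMulVec (ui ^ n • Pi.single p (1 : R)) (Pi.single k 1) := by
        rw [hw]
        ext i j
        simp only [vecMulVec_apply, Matrix.sub_apply, Pi.sub_apply, Pi.smul_apply, smul_eq_mul]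
        linear_combination (Pi.single p (1 : R) : Fin n → R) i * B k j * huun
      have e6 : B * vecMulVec (Pi.single p 1) w = vecMulVec (Pi.single p 1) (B k)
          - vecMulVec (ui ^ n • Pi.single p (1 : R)) (Pi.single k 1) := by
        rw [mul_vecMulVec, hbp, e5]
      have e7 : B * vecMulVec (Pi.single p 1) (Pi.single k 1)
          = vecMulVec (ui ^ n • Pi.single p (1 : R)) (Pi.single k 1) := by
        rw [mul_vecMulVec, hbp]
      have e8 : vecMulVec (Pi.single p 1) (Pi.single k 1) * B = vecMulVec (Pi.single p 1) (B k) := by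
        rw [vecMulVec_mul, single_one_vecMul]; rfl
      have e9 : vecMulVec (Pi.single p 1) w * vecMulVec (Pi.single p 1) (Pi.single k 1) = 0 := by
        rw [vecMulVec_mul_vecMulVec, hwe]; simp
      rw [aux_single, one_smul]
      simp only [mul_add, add_mul, mul_one, one_mul, e7, e8, mul_assoc, e9, mul_zero]
      rw [e6]
      abel
    rw [eq_inv_mul_iff_mul_eq, eq_mul_inv_iff_mul_eq, this]
  rw [hzz]
  exact H.mul_mem (H.inv_mem hb) (Subgroup.Normal.conj_mem ‹_› b hb y)

theorem aux_root (H : Subgroup (Matrix.SpecialLinearGroup (Fin n) R)) [H.Normal] (z : (Matrix.SpecialLinearGroup (Fin n) R)) (hz : z ∈ H) (p : Fin n) (w : Fin n → R)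
    (hwp : w p = 0) (hw : w ≠ 0) (hzw : (z : Matrix (Fin n) (Fin n) R) = 1 + vecMulVec (Pi.single p 1) w) :
    ∃ (k : Fin n) (hpk : p ≠ k) (s : R), s ≠ 0 ∧ SpecialLinearGroup.transvection hpk s ∈ H := by
  obtain ⟨m, hm⟩ := Function.ne_iff.1 hw
  simp only [Pi.zero_apply] at hm
  have hpm : p ≠ m := by rintro rfl; exact hm hwp
  by_cases h : ∃ k, k ≠ p ∧ k ≠ m
  · obtain ⟨k, hkp, hkm⟩ := h
    refine ⟨k, hkp.symm, w m, hm, ?_⟩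
    set X : (Matrix.SpecialLinearGroup (Fin n) R) := SpecialLinearGroup.transvection hkm.symm 1 with hX
    have hh : SpecialLinearGroup.transvection hkp.symm (w m) = z * (X * z⁻¹ * X⁻¹) := by
      have : SpecialLinearGroup.transvection hkp.symm (w m) * X * z = z * X := by
        apply Subtype.ext
        change (1 + Matrix.single p k (w m)) * (1 + Matrix.single m k 1) * (z : Matrix (Fin n) (Fin n) R)
          = (z : Matrix (Fin n) (Fin n) R) * (1 + Matrix.single m k 1)
        set E := vecMulVec (Pi.single p (1 : R)) w with hE
        have f1 : Matrix.single p k (w m) * E = 0 := by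
          rw [hE, aux_single, smul_mul_assoc, vecMulVec_mul_vecMulVec]
          simp [hkp]
        have f2 : Matrix.single m k (1 : R) * E = 0 := by
          rw [hE, aux_single, smul_mul_assoc, vecMulVec_mul_vecMulVec]
          simp [hkp]
        have f3 : Matrix.single p k (w m) * Matrix.single m k 1 = 0 := by
          simp [hkm]
        have f4 : E * Matrix.single m k 1 = Matrix.single p k (w m) := by
          rw [hE, aux_single, one_smul, vecMulVec_mul_vecMulVec, aux_single]
          simp [vecMulVec_smul]
        rw [hzw]
        simp only [mul_add, add_mul, mul_one, one_mul, f1, f2, f3, f4, zero_mul]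
        abel
      rw [← mul_assoc, ← mul_assoc, eq_mul_inv_iff_mul_eq, eq_mul_inv_iff_mul_eq, this]
    rw [hh]
    exact H.mul_mem hz (Subgroup.Normal.conj_mem ‹_› _ (H.inv_mem hz) X)
  · push Not at h
    refine ⟨m, hpm, w m, hm, ?_⟩
    have : SpecialLinearGroup.transvection hpm (w m) = z := by
      apply Subtype.ext
      rw [hzw]
      change 1 + Matrix.single p m (w m) = _
      congr 1
      ext i j
      simp only [Matrix.single_apply, vecMulVec_apply, Pi.single_apply]
      have := h j
      grind
    rw [this]; exact hz

theorem aux_ideal (H : Subgroup (Matrix.SpecialLinearGroup (Fin n) R)) [H.Normal] (l : ℕ) (hl0 : 0 < l)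
    (hl : ∀ x : R, IsUnit (1 + (l : R) * x))
    (hdiv : ∀ z : R, z ≠ 0 → ∃ (k : ℕ) (r : R), z * r = (l : R) ^ k)
    {i j : Fin n} (hij : i ≠ j)
    (hsat : ∀ (m : ℕ), 0 < m → ∀ s : R, SpecialLinearGroup.transvection hij ((m : R) * s) ∈ H →
      SpecialLinearGroup.transvection hij s ∈ H)
    (z : R) (hz0 : z ≠ 0) (hz : SpecialLinearGroup.transvection hij z ∈ H) (t : R) :
    SpecialLinearGroup.transvection hij t ∈ H := by
  have hsq : ∀ x : R, SpecialLinearGroup.transvection hij ((1 + (l : R) * x) ^ 2 * z) ∈ H := by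
    intro x
    obtain ⟨u, hu⟩ := hl x
    obtain ⟨d, hd⟩ := aux_torus hij u
    rw [← hu, ← hd z]
    exact Subgroup.Normal.conj_mem ‹_› _ hz d
  have hmul : ∀ x : R, SpecialLinearGroup.transvection hij (x * z) ∈ H := by
    intro x
    apply hsat (4 * l) (by omega)
    have h1 := H.mul_mem (hsq x) (H.inv_mem (hsq (-x)))
    rw [aux_coe_inv, aux_coe_add] at h1
    convert h1 using 2
    push_cast; ring
  obtain ⟨k, r, hr⟩ := hdiv z hz0
  apply hsat (l ^ k) (by positivity)
  have := hmul (r * t)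
  convert this using 2
  push_cast
  rw [← hr]; ring

theorem aux_all (H : Subgroup (Matrix.SpecialLinearGroup (Fin n) R)) [H.Normal]
    {i j : Fin n} (hij : i ≠ j) (h : ∀ t : R, SpecialLinearGroup.transvection hij t ∈ H) :
    ∀ (p q : Fin n) (hpq : p ≠ q) (t : R), SpecialLinearGroup.transvection hpq t ∈ H := by
  have comm : ∀ (a b c : Fin n) (hab : a ≠ b) (hbc : b ≠ c) (hac : a ≠ c) (s t : R),
      (SpecialLinearGroup.transvection hac (s * t) : (Matrix.SpecialLinearGroup (Fin n) R)) =
        SpecialLinearGroup.transvection hab s * SpecialLinearGroup.transvection hbc t *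
        (SpecialLinearGroup.transvection hab s)⁻¹ * (SpecialLinearGroup.transvection hbc t)⁻¹ := by
    intro a b c hab hbc hac s t
    rw [eq_mul_inv_iff_mul_eq, eq_mul_inv_iff_mul_eq]
    apply Subtype.ext
    change (1 + Matrix.single a c (s * t)) * (1 + Matrix.single b c t) * (1 + Matrix.single a b s)
      = (1 + Matrix.single a b s) * (1 + Matrix.single b c t)
    simp [mul_add, add_mul, hab, hbc, hac, Ne.symm hab, Ne.symm hbc, Ne.symm hac]
    abel
  have R1 : ∀ (a b : Fin n) (hab : a ≠ b), (∀ t : R, SpecialLinearGroup.transvection hab t ∈ H) →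
      ∀ (c : Fin n) (hac : a ≠ c) (t : R), SpecialLinearGroup.transvection hac t ∈ H := by
    intro a b hab hH c hac t
    by_cases hbc : b = c
    · subst hbc; exact hH t
    · have := comm a b c hab hbc hac t 1
      rw [mul_one] at this
      rw [this, mul_assoc, mul_assoc]
      refine H.mul_mem (hH t) ?_
      rw [← mul_assoc]
      exact Subgroup.Normal.conj_mem ‹_› _ (H.inv_mem (hH t)) _
  have R2 : ∀ (a b : Fin n) (hab : a ≠ b), (∀ t : R, SpecialLinearGroup.transvection hab t ∈ H) →
      ∀ (c : Fin n) (hcb : c ≠ b) (t : R), SpecialLinearGroup.transvection hcb t ∈ H := by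
    intro a b hab hH c hcb t
    by_cases hca : c = a
    · subst hca; exact hH t
    · have := comm c a b hca hab hcb 1 t
      rw [one_mul] at this
      rw [this]
      exact H.mul_mem (Subgroup.Normal.conj_mem ‹_› _ (hH t) _) (H.inv_mem (hH t))
  have R3 : ∀ (a b : Fin n) (hab : a ≠ b), (∀ t : R, SpecialLinearGroup.transvection hab t ∈ H) →
      ∀ (hba : b ≠ a) (t : R), SpecialLinearGroup.transvection hba t ∈ H := by
    intro a b hab hH hba t
    let w : (Matrix.SpecialLinearGroup (Fin n) R) := SpecialLinearGroup.transvection hab 1 * SpecialLinearGroup.transvection hba (-1) *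
      SpecialLinearGroup.transvection hab 1
    have : SpecialLinearGroup.transvection hba t = w * SpecialLinearGroup.transvection hab (-t) * w⁻¹ := by
      rw [eq_mul_inv_iff_mul_eq]
      apply Subtype.ext
      change (1 + Matrix.single b a t) * ((1 + Matrix.single a b 1) * (1 + Matrix.single b a (-1)) *
        (1 + Matrix.single a b 1)) = ((1 + Matrix.single a b 1) * (1 + Matrix.single b a (-1)) *
        (1 + Matrix.single a b 1)) * (1 + Matrix.single a b (-t))
      simp [mul_add, add_mul, hab, hba, ← Matrix.single_neg]
      abel
    rw [this]
    exact Subgroup.Normal.conj_mem ‹_› _ (hH _) _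
  intro p q hpq
  by_cases hpj : p = j
  · subst hpj
    exact R1 p i hij.symm (R3 i p hij h _) q hpq
  · exact R1 p j hpj (R2 i j hij h p hpj) q hpq

theorem aux_normal [IsLocalRing R] [IsDomain R] (H : Subgroup (Matrix.SpecialLinearGroup (Fin n) R)) [H.Normal] (l : ℕ) (hl0 : 0 < l)
    (h0 : 0 < n)
    (hl : ∀ x : R, IsUnit (1 + (l : R) * x))
    (hdiv : ∀ z : R, z ≠ 0 → ∃ (k : ℕ) (r : R), z * r = (l : R) ^ k)
    (hroot : ∀ z : R, z ≠ 0 → (1 + (l : R) * z) ^ (n * n) ≠ 1)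
    (hsat : ∀ (i j : Fin n) (hij : i ≠ j) (m : ℕ), 0 < m → ∀ s : R,
      SpecialLinearGroup.transvection hij ((m : R) * s) ∈ H →
      SpecialLinearGroup.transvection hij s ∈ H)
    (g : (Matrix.SpecialLinearGroup (Fin n) R)) (hg : g ∈ H)
    (hns : ¬ ∃ a, (g : Matrix (Fin n) (Fin n) R) = Matrix.scalar (Fin n) a) :
    ∀ (p q : Fin n) (hpq : p ≠ q) (t : R), SpecialLinearGroup.transvection hpq t ∈ H := by
  obtain ⟨g, hg, p, q, hqp, hne⟩ := aux_offdiag H g hg hns h0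
  obtain ⟨u, hu⟩ := hl ((g : Matrix (Fin n) (Fin n) R) q p)
  obtain ⟨h, hh⟩ := aux_parabolic g p q hqp u (by
    rw [hu]
    have h1 := sub_dvd_pow_sub_pow (1 + (l : R) * (g : Matrix (Fin n) (Fin n) R) q p) 1 n
    rw [one_pow] at h1
    refine Dvd.dvd.trans ⟨(l : R), by ring⟩ h1)
  obtain ⟨z, hz, w, hwp, hw, hzw⟩ := aux_transl H _
    (H.mul_mem (H.inv_mem hg) (Subgroup.Normal.conj_mem ‹_› g hg h)) p u hh (by
      rw [hu]; exact hroot _ hne)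
  obtain ⟨k, hpk, s, hs0, hs⟩ := aux_root H z hz p w hwp hw hzw
  exact aux_all H hpk (aux_ideal H l hl0 hl hdiv hpk (hsat p k hpk) s hs0 hs)
end normal

section ringfacts

variable {l : ℕ} [Fact (Nat.Prime l)] {K : Type} [Field K] [Algebra ℚ_[l] K]
  [FiniteDimensional ℚ_[l] K] [Algebra ℤ_[l] K] [IsScalarTower ℤ_[l] ℚ_[l] K]

theorem aux_inj : Function.Injective (algebraMap ℤ_[l] K) := by
  rw [IsScalarTower.algebraMap_eq ℤ_[l] ℚ_[l] K]
  exact (algebraMap ℚ_[l] K).injective.comp (IsFractionRing.injective ℤ_[l] ℚ_[l])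

theorem aux_inj' : Function.Injective (algebraMap ℤ_[l] ↥(integralClosure ℤ_[l] K)) := by
  intro a b h
  apply aux_inj (K := K)
  exact congrArg (fun x : ↥(integralClosure ℤ_[l] K) => (x : K)) h

theorem aux_charZero : CharZero ↥(integralClosure ℤ_[l] K) :=
  charZero_of_injective_algebraMap (aux_inj' (K := K))

theorem aux_l_mem [IsLocalRing ↥(integralClosure ℤ_[l] K)] :
    (l : ↥(integralClosure ℤ_[l] K)) ∈ IsLocalRing.maximalIdeal ↥(integralClosure ℤ_[l] K) := by
  rw [IsLocalRing.mem_maximalIdeal]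
  intro h
  have hi : (algebraMap ℤ_[l] ↥(integralClosure ℤ_[l] K)).IsIntegral :=
    algebraMap_isIntegral_iff.mpr inferInstance
  have := hi.isLocalHom (aux_inj' (K := K))
  have h2 : IsUnit (algebraMap ℤ_[l] ↥(integralClosure ℤ_[l] K) (l : ℤ_[l])) := by
    simpa using h
  exact PadicInt.p_nonunit (isUnit_of_map_unit _ _ h2)

theorem aux_max_pow [IsLocalRing ↥(integralClosure ℤ_[l] K)]
    (c : ↥(integralClosure ℤ_[l] K)) (hc : c ≠ 0) :
    ∃ e : ℕ, IsLocalRing.maximalIdeal ↥(integralClosure ℤ_[l] K) ^ e ≤ Ideal.span {c} := by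
  have hD : IsDedekindDomain ↥(integralClosure ℤ_[l] K) :=
    integralClosure.isDedekindDomain ℤ_[l] ℚ_[l] K
  obtain ⟨e, he⟩ := Ideal.exists_radical_pow_le_of_fg (Ideal.span {c})
    (IsNoetherian.noetherian _)
  refine ⟨e, le_trans (Ideal.pow_right_mono ?_ e) he⟩
  rw [Ideal.radical_eq_sInf]
  refine le_sInf ?_
  rintro P ⟨hP, hPp⟩
  have hb : P ≠ ⊥ := by
    rintro rfl
    apply hc
    have := hP (Ideal.mem_span_singleton_self c)
    simpa using this
  have := hPp.isMaximal hb
  rw [IsLocalRing.eq_maximalIdeal this]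

end ringfacts

section generic

variable {R : Type*} [CommRing R] [IsLocalRing R]

theorem aux_nat_unit (l : ℕ) (hp : l.Prime) (hl : (l : R) ∈ IsLocalRing.maximalIdeal R) (m : ℕ)
    (hm : ¬ l ∣ m) : IsUnit (m : R) := by
  by_contra h
  have hco : IsCoprime (l : ℤ) (m : ℤ) :=
    Nat.isCoprime_iff_coprime.mpr ((Nat.Prime.coprime_iff_not_dvd hp).mpr hm)
  obtain ⟨a, b, hab⟩ := hco
  have h2 : (a : R) * l + b * m = 1 := by exact_mod_cast congrArg (Int.cast : ℤ → R) hab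
  have hm' : (m : R) ∈ IsLocalRing.maximalIdeal R := (IsLocalRing.mem_maximalIdeal _).mpr h
  have h3 : (1 : R) ∈ IsLocalRing.maximalIdeal R := by
    rw [← h2]
    exact Ideal.add_mem _ (Ideal.mul_mem_left _ _ hl) (Ideal.mul_mem_left _ _ hm')
  exact (IsLocalRing.mem_maximalIdeal _).mp h3 isUnit_one

theorem aux_unit_add (u x : R) (hu : IsUnit u) (hx : x ∈ IsLocalRing.maximalIdeal R) :
    IsUnit (u + x) := by
  by_contra h
  have h1 : u + x ∈ IsLocalRing.maximalIdeal R := (IsLocalRing.mem_maximalIdeal _).mpr h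
  have h2 : u ∈ IsLocalRing.maximalIdeal R := by
    have := Ideal.sub_mem _ h1 hx
    simpa using this
  exact (IsLocalRing.mem_maximalIdeal _).mp h2 hu

theorem aux_int_root [IsDomain R] [CharZero R] (l : ℕ) (hp : l.Prime)
    (hl : (l : R) ∈ IsLocalRing.maximalIdeal R) (m : ℕ)
    (hm : ¬ l ∣ m) (z : R) (hz : z ≠ 0) : (1 + (l : R) * z) ^ m ≠ 1 := by
  intro h
  set y := 1 + (l : R) * z with hy
  have hg : (∑ i ∈ Finset.range m, y ^ i) * (y - 1) = 0 := by
    rw [geom_sum_mul, h, sub_self]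
  have hs : ∃ x ∈ IsLocalRing.maximalIdeal R, ∑ i ∈ Finset.range m, y ^ i = (m : R) + x := by
    refine ⟨∑ i ∈ Finset.range m, (y ^ i - 1), ?_, ?_⟩
    · refine Ideal.sum_mem _ (fun i _ => ?_)
      have h1 : y - 1 ∣ y ^ i - 1 := sub_one_dvd_pow_sub_one y i
      refine Ideal.mem_of_dvd _ h1 ?_
      rw [hy, add_sub_cancel_left]
      exact Ideal.mul_mem_right _ _ hl
    · simp
  obtain ⟨x, hx, hs⟩ := hs
  have hu := aux_unit_add _ x (aux_nat_unit l hp hl m hm) hx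
  rw [← hs] at hu
  rcases mul_eq_zero.mp hg with h0 | h0
  · rw [h0] at hu
    exact not_isUnit_zero hu
  · rw [hy, add_sub_cancel_left] at h0
    rcases mul_eq_zero.mp h0 with h1 | h1
    · exact hp.ne_zero (by exact_mod_cast h1)
    · exact hz h1

end generic

section final

variable {R : Type*} [CommRing R] {n : ℕ}

theorem aux_sub (H : Subgroup (Matrix.SpecialLinearGroup (Fin n) R)) [IsLocalRing R] (c : R)
    (hH : ∀ i j (hij : i ≠ j), ∀ t, SpecialLinearGroup.transvection hij (c * t) ∈ H)
    (g : Matrix.SpecialLinearGroup (Fin n) R)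
    (hg : ∀ i j, c ^ 2 ∣ ((g : Matrix (Fin n) (Fin n) R) - 1) i j) : g ∈ H := by
  let S : Submonoid (Matrix (Fin n) (Fin n) R) :=
    { carrier := {M | ∃ h ∈ H, (h : Matrix (Fin n) (Fin n) R) = M}
      one_mem' := ⟨1, H.one_mem, rfl⟩
      mul_mem' := by
        rintro a b ⟨x, hx, rfl⟩ ⟨y, hy, rfl⟩
        exact ⟨x * y, H.mul_mem hx hy, rfl⟩ }
  have h : (g : Matrix (Fin n) (Fin n) R) ∈ S := by
    refine aux_elim' c S (fun i j hij t => ?_) _ g.2 hg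
    exact ⟨_, hH i j hij t, rfl⟩
  obtain ⟨h, hh, he⟩ := h
  have : h = g := Subtype.ext he
  exact this ▸ hh

theorem aux_mem_sl (I : Ideal R) (j : ℕ) (g : Matrix.SpecialLinearGroup (Fin n) R)
    (hg : g ∈ slCongruence n I j) (a b : Fin n) :
    ((g : Matrix (Fin n) (Fin n) R) - 1) a b ∈ I ^ j := by
  have h1 : Matrix.SpecialLinearGroup.map (Ideal.Quotient.mk (I ^ j)) g = 1 := hg
  have h2 : (g : Matrix (Fin n) (Fin n) R).map (Ideal.Quotient.mk (I ^ j)) = 1 :=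
    congrArg (fun x : Matrix.SpecialLinearGroup (Fin n) (R ⧸ I ^ j) =>
      (x : Matrix (Fin n) (Fin n) (R ⧸ I ^ j))) h1
  have h3 := congrFun (congrFun h2 a) b
  rw [Matrix.map_apply] at h3
  rw [Matrix.sub_apply, ← Ideal.Quotient.eq, h3]
  by_cases hab : a = b
  · subst hab; simp
  · simp [hab]

theorem aux_mem_gl {N : ℕ} (I : Ideal R) (i : ℕ) (g : GL (Fin N) R)
    (h : ∀ a b, ((g : Matrix (Fin N) (Fin N) R) - 1) a b ∈ I ^ i) :
    g ∈ glCongruence N I i := by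
  change Matrix.GeneralLinearGroup.map (Ideal.Quotient.mk (I ^ i)) g = 1
  apply Units.ext
  ext a b
  change Ideal.Quotient.mk (I ^ i) ((g : Matrix (Fin N) (Fin N) R) a b) =
    (1 : Matrix (Fin N) (Fin N) (R ⧸ I ^ i)) a b
  have h3 := h a b
  rw [Matrix.sub_apply, ← Ideal.Quotient.eq] at h3
  rw [h3]
  by_cases hab : a = b
  · subst hab; simp
  · simp [hab]

theorem aux_final {O : Type*} [CommRing O] [IsDomain O] [IsLocalRing O] [CharZero O]
    [IsDomain R] [IsLocalRing R] [CharZero R] (N : ℕ) (hn : 1 < n) (hN : 1 < N)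
    (l : ℕ) (hp : l.Prime) (hc : 4 ^ N.factorial + N + n + 2 < l)
    (hlO : (l : O) ∈ IsLocalRing.maximalIdeal O)
    (hlR : (l : R) ∈ IsLocalRing.maximalIdeal R)
    (hpow : ∀ c : R, c ≠ 0 → ∃ e : ℕ, IsLocalRing.maximalIdeal R ^ e ≤ Ideal.span {c})
    (φ : Matrix.SpecialLinearGroup (Fin n) R →* GL (Fin N) O) :
    (∀ i : ℕ, ∃ j : ℕ, ∀ g, g ∈ slCongruence n (IsLocalRing.maximalIdeal R) j →
      φ g ∈ glCongruence N (IsLocalRing.maximalIdeal O) i) ∧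
    (φ ≠ 1 → ∀ g ∈ φ.ker, ∃ a : R,
      (g : Matrix (Fin n) (Fin n) R) = Matrix.scalar (Fin n) a) := by
  have hl0 : (l : R) ≠ 0 := by exact_mod_cast hp.ne_zero
  have h4 : 4 ≤ 4 ^ N.factorial := by
    calc 4 = 4 ^ 1 := by norm_num
      _ ≤ 4 ^ N.factorial := Nat.pow_le_pow_right (by norm_num) N.factorial_pos
  have hm0 : 0 < 4 ^ N.factorial - 1 := by omega
  have hndvd : ∀ m, 0 < m → m < l → ¬ l ∣ m := fun m h1 h2 h3 =>
    absurd (Nat.le_of_dvd h1 h3) (by omega)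
  have hu2 : IsUnit ((2 : ℕ) : R) := aux_nat_unit l hp hlR 2 (hndvd 2 (by norm_num) (by omega))
  have hum : IsUnit ((4 ^ N.factorial - 1 : ℕ) : R) :=
    aux_nat_unit l hp hlR _ (hndvd _ hm0 (by omega))
  have hunip : ∀ i j (hij : i ≠ j) (t : R),
      ((φ (SpecialLinearGroup.transvection hij t) : Matrix (Fin N) (Fin N) O) - 1) ^ N = 0 := by
    intro i j hij t
    obtain ⟨u, hu⟩ := hu2
    obtain ⟨v, hv⟩ := hum
    obtain ⟨d, hd⟩ := aux_torus hij u
    refine aux_unip' (φ (SpecialLinearGroup.transvection hij t))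
      (φ (SpecialLinearGroup.transvection hij (((v⁻¹ : Rˣ) : R) * t))) (φ d) ?_ hm0 ?_
    · rw [← map_pow, aux_coe_pow, ← hv, Units.mul_inv_cancel_left]
    · rw [← map_pow, aux_coe_pow, ← map_inv, ← map_mul, ← map_mul, hd, hu]
      congr 2
      push_cast
      ring
  constructor
  · intro i
    have hcz : ((l : R) ^ i) ^ 2 ≠ 0 := pow_ne_zero _ (pow_ne_zero _ hl0)
    obtain ⟨j, hj⟩ := hpow _ hcz
    refine ⟨j, fun g hg => ?_⟩
    have hmem : g ∈ (glCongruence N (IsLocalRing.maximalIdeal O) i).comap φ := by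
      refine aux_sub _ ((l : R) ^ i) (fun a b hab t => ?_) g (fun a b => ?_)
      · rw [Subgroup.mem_comap]
        obtain ⟨B, hB⟩ := aux_unip_cong _ l hp (by omega) (hunip a b hab t) i
        have he : (SpecialLinearGroup.transvection hab ((l : R) ^ i * t))
            = SpecialLinearGroup.transvection hab t ^ (l ^ i) := by
          rw [aux_coe_pow]; push_cast; rfl
        rw [he, map_pow]
        refine aux_mem_gl _ _ _ (fun x y => ?_)
        rw [Units.val_pow_eq_pow_val, hB, add_sub_cancel_left, Matrix.smul_apply, nsmul_eq_mul,
          Nat.cast_pow]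
        exact Ideal.mul_mem_right _ _ (Ideal.pow_mem_pow hlO i)
      · exact Ideal.mem_span_singleton.mp (hj (aux_mem_sl _ _ _ hg a b))
    exact hmem
  · intro hφ g hg
    by_contra hns
    have hall := aux_normal φ.ker l hp.pos (by omega)
      (fun x => aux_unit_add 1 _ isUnit_one (Ideal.mul_mem_right _ _ hlR))
      (fun z hz => by
        obtain ⟨e, he⟩ := hpow z hz
        obtain ⟨r, hr⟩ := Ideal.mem_span_singleton.mp (he (Ideal.pow_mem_pow hlR e))
        exact ⟨e, r, hr.symm⟩)
      (fun z hz => aux_int_root l hp hlR (n * n) (fun h => by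
        rcases hp.dvd_mul.mp h with h | h <;> exact hndvd n (by omega) (by omega) h) z hz)
      (fun i j hij m hm s hs => by
        rw [MonoidHom.mem_ker] at hs ⊢
        rw [← aux_coe_pow, map_pow] at hs
        apply Units.ext
        refine aux_unip_pow _ (hunip i j hij s) m hm ?_
        rw [← Units.val_pow_eq_pow_val, hs, Units.val_one])
      g hg hns
    apply hφ
    ext1 x
    have hx : x ∈ φ.ker := aux_sub _ 1 (fun i j hij t => hall i j hij _) x (fun a b => by simp)
    exact hx

end final

/-- **Wong, Theorem 4(a) for `SL_n`.**  For integers `n, N > 1` there is a constant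
`c(n,N) > 0` such that for every prime `l > c(n,N)` and any rings of integers `𝒪, 𝒪'` of
finite extensions `K, K'` of `ℚ_l` (realized as the integral closure of `ℤ_l` in the
extension, which is a local ring), every abstract (not assumed continuous) group
homomorphism `φ : SL_n(𝒪') → GL_N(𝒪)` is continuous for the `l`-adic topologies — the
topologies in which the principal congruence subgroups form bases of neighbourhoods of the
identity, so that continuity of the group homomorphism `φ` means exactly that for every `i`
there is a `j` with `φ(G'_j) ⊆ G_i` — and moreover if `φ` is nontrivial then `ker φ` is
contained in the subgroup of scalar matrices. -/
theorem abstract_hom_SL_continuous (n N : ℕ) (hn : 1 < n) (hN : 1 < N) :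
    ∃ c : ℕ, 0 < c ∧
      ∀ (l : ℕ) [Fact (Nat.Prime l)], c < l →
      ∀ (K K' : Type) [Field K] [Field K']
        [Algebra ℚ_[l] K] [Algebra ℚ_[l] K']
        [FiniteDimensional ℚ_[l] K] [FiniteDimensional ℚ_[l] K']
        [Algebra ℤ_[l] K] [Algebra ℤ_[l] K']
        [IsScalarTower ℤ_[l] ℚ_[l] K] [IsScalarTower ℤ_[l] ℚ_[l] K']
        [IsLocalRing ↥(integralClosure ℤ_[l] K)] [IsLocalRing ↥(integralClosure ℤ_[l] K')],
      ∀ φ : Matrix.SpecialLinearGroup (Fin n) ↥(integralClosure ℤ_[l] K') →*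
              GL (Fin N) ↥(integralClosure ℤ_[l] K),
        -- `φ` is continuous:
        (∀ i : ℕ, ∃ j : ℕ,
          ∀ g, g ∈ slCongruence n (IsLocalRing.maximalIdeal ↥(integralClosure ℤ_[l] K')) j →
            φ g ∈ glCongruence N (IsLocalRing.maximalIdeal ↥(integralClosure ℤ_[l] K)) i) ∧
        -- if `φ` is nontrivial, `ker φ` consists of scalar matrices:
        (φ ≠ 1 → ∀ g ∈ φ.ker,
          ∃ a : ↥(integralClosure ℤ_[l] K'),
            (g : Matrix (Fin n) (Fin n) ↥(integralClosure ℤ_[l] K')) =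
              Matrix.scalar (Fin n) a) := by
  refine ⟨4 ^ N.factorial + N + n + 2, Nat.succ_pos _, ?_⟩
  intro l hl hc K K' _ _ _ _ _ _ _ _ _ _ _ _ φ
  have : CharZero ↥(integralClosure ℤ_[l] K) := aux_charZero
  have : CharZero ↥(integralClosure ℤ_[l] K') := aux_charZero
  have h1 := aux_l_mem (l := l) (K := K)
  have h2 := aux_l_mem (l := l) (K := K')
  have h3 := aux_max_pow (l := l) (K := K')
  have h4 := aux_final (O := ↥(integralClosure ℤ_[l] K)) (R := ↥(integralClosure ℤ_[l] K')) (n := n) N hn hN l hl.out hc h1 h2 h3 φ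
  exact h4
end

section
/- For any integers n, N > 1 with N < n there exists a constant c(n, N) > 0 such that for every prime l > c(n, N) and any two rings of integers 𝒪 and 𝒪' of finite extensions of ℚ_l, there is no nontrivial abstract (not assumed continuous) group homomorphism φ: SL_n(𝒪') → GL_N(𝒪). -/
open Matrix


lemma aux_single_eig {F V : Type*} [Field F] [AddCommGroup V] [Module F V]
    (s Y : Module.End F V) (μ κ : F) (hs : IsNilpotent (s - algebraMap F _ μ)) (hμ : μ ≠ 0)
    (hκ : κ ≠ 1) (h : s * Y = κ • (Y * s)) : Y = 0 := by
  set n := s - algebraMap F (Module.End F V) μ with hn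
  have e1 : n * Y = Y * (κ • s - algebraMap F _ μ) := by
    rw [hn, sub_mul, mul_sub, h, Algebra.commutes, mul_smul_comm]
  have e2 : ∀ j : ℕ, n ^ j * Y = Y * (κ • s - algebraMap F _ μ) ^ j := by
    intro j
    exact (SemiconjBy.pow_right (a := Y) (x := (κ • s - algebraMap F _ μ)) (y := n) e1.symm j).symm
  obtain ⟨j, hj⟩ := hs
  have e3 : κ • s - algebraMap F (Module.End F V) μ = κ • n + algebraMap F _ ((κ - 1) * μ) := by
    rw [hn, smul_sub]
    simp only [Algebra.algebraMap_eq_smul_one, smul_smul, sub_mul, sub_smul, one_mul]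
    abel
  have hu : IsUnit (κ • s - algebraMap F (Module.End F V) μ) := by
    rw [e3]
    have h1 : IsNilpotent (κ • n) := (show IsNilpotent n from ⟨j, hj⟩).smul κ
    have h2 : IsUnit (algebraMap F (Module.End F V) ((κ - 1) * μ)) :=
      (IsUnit.mk0 _ (mul_ne_zero (sub_ne_zero.2 hκ) hμ)).map _
    exact h1.isUnit_add_right_of_commute h2 (Algebra.commutes _ _).symm
  have := e2 j
  rw [hj, zero_mul] at this
  exact (hu.pow j).mul_left_eq_zero.1 this.symm

lemma aux_nilp {F V : Type*} [Field F] [CharZero F] [AddCommGroup V] [Module F V]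
    (s w : Module.End F V) (μ : F) (hs : IsNilpotent (s - algebraMap F _ μ)) (hμ : μ ≠ 0)
    (hw : IsNilpotent w) (k : ℕ) (hk : 2 ≤ k) (h : s * (1 + w) = (1 + w) ^ k * s) : w = 0 := by
  by_contra hw0
  set r := nilpotencyClass w - 1 with hr
  have hnt : Nontrivial (Module.End F V) := ⟨w, 0, hw0⟩
  have hpos : 0 < nilpotencyClass w := pos_nilpotencyClass_iff.2 hw
  have hne1 : nilpotencyClass w ≠ 1 := by
    intro h1; exact hw0 (nilpotencyClass_eq_one.1 h1)
  have hr1 : nilpotencyClass w = r + 1 := by omega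
  have hr0 : r ≠ 0 := by omega
  have hwr : w ^ r ≠ 0 := pow_pred_nilpotencyClass hw
  have hwr1 : w ^ r * w = 0 := by rw [← pow_succ, ← hr1]; exact pow_nilpotencyClass hw
  set q := ∑ i ∈ Finset.range k, (1 + w) ^ i with hq
  have hwq : (1 + w) ^ k - 1 = w * q := by
    rw [hq, ← mul_geom_sum (1 + w) k]; simp
  have hcomm : Commute w q := by
    rw [hq]; exact Commute.sum_right _ _ _ fun i _ =>
      (((Commute.one_right w).add_right (Commute.refl w)).pow_right i)
  have hw1 : ∀ i : ℕ, w ^ r * (1 + w) ^ i = w ^ r := by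
    intro i
    induction i with
    | zero => simp
    | succ i ih => rw [pow_succ, ← mul_assoc, ih, mul_add, hwr1, mul_one, add_zero]
  have hwq1 : w ^ r * q = (k : F) • w ^ r := by
    rw [hq, Finset.mul_sum, Finset.sum_congr rfl fun i _ => hw1 i]
    simp [Nat.cast_smul_eq_nsmul]
  have hwqj : ∀ j : ℕ, w ^ r * q ^ j = ((k : F) ^ j) • w ^ r := by
    intro j
    induction j with
    | zero => simp
    | succ j ih => rw [pow_succ, ← mul_assoc, ih, smul_mul_assoc, hwq1, smul_smul, pow_succ]
  have h2 : s * w = (w * q) * s := by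
    rw [← hwq, sub_mul, one_mul, ← h, mul_add, mul_one]; abel
  have h3 : s * w ^ r = (w * q) ^ r * s :=
    SemiconjBy.pow_right (a := s) (x := w) (y := w * q) h2 r
  rw [hcomm.mul_pow, hwqj, smul_mul_assoc] at h3
  refine hwr (aux_single_eig s (w ^ r) μ _ hs hμ ?_ h3)
  intro h1
  have : k ^ r = 1 := by exact_mod_cast h1
  rcases Nat.pow_eq_one.1 this with h | h <;> omega

lemma aux_main {F V : Type*} [Field F] [IsAlgClosed F] [CharZero F] [AddCommGroup V] [Module F V]
    [FiniteDimensional F V]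
    (s z : (Module.End F V)ˣ) (μ : F) (hs : IsNilpotent ((s : Module.End F V) - algebraMap F _ μ))
    (k d : ℕ) (hk : 2 ≤ k) (hd : Module.finrank F V ≤ d) (h : s * z = z ^ k * s) :
    z ^ (Nat.factorial (k ^ d)) = 1 := by
  rcases subsingleton_or_nontrivial (Module.End F V) with hst | hnt
  · exact Units.ext (Subsingleton.elim _ _)
  have hVnt : Nontrivial V := by
    by_contra hc
    rw [not_nontrivial_iff_subsingleton] at hc
    exact (not_subsingleton (Module.End F V)) inferInstance
  have hμ : μ ≠ 0 := by
    rintro rfl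
    simp only [map_zero, sub_zero] at hs
    exact s.isUnit.not_isNilpotent hs
  set M := Nat.factorial (k ^ d) with hM
  have hMpos : 0 < M := Nat.factorial_pos _
  have hspec : ∀ x ∈ spectrum F (z : Module.End F V), x ^ k ∈ spectrum F (z : Module.End F V) := by
    intro x hx
    have h1 : x ^ k ∈ spectrum F ((z : Module.End F V) ^ k) := spectrum.pow_mem_pow _ _ hx
    have h2 : (z : Module.End F V) ^ k = s * z * (s⁻¹ : (Module.End F V)ˣ) := by
      rw [← Units.val_mul, h]; simp
    rwa [h2, spectrum.units_conjugate] at h1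
  have hspec2 : ∀ x ∈ spectrum F (z : Module.End F V), ∀ i : ℕ,
      x ^ (k ^ i) ∈ spectrum F (z : Module.End F V) := by
    intro x hx i
    induction i with
    | zero => simpa using hx
    | succ i ih => rw [pow_succ, pow_mul]; exact hspec _ ih
  have hx1 : ∀ x ∈ spectrum F (z : Module.End F V), x ^ M = 1 := by
    intro x hx
    have hx0 : x ≠ 0 := by
      rintro rfl
      exact spectrum.zero_notMem F z.isUnit hx
    classical
    let S := (z : Module.End F V).charpoly.roots.toFinset
    have hS : S.card ≤ d := by
      refine (Multiset.toFinset_card_le _).trans ((Polynomial.card_roots' _).trans ?_)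
      rw [LinearMap.charpoly_natDegree]; exact hd
    have hSm : ∀ y ∈ spectrum F (z : Module.End F V), y ∈ S := by
      intro y hy
      rw [Module.End.mem_spectrum_iff_isRoot_charpoly] at hy
      simp only [S, Multiset.mem_toFinset]
      exact (Polynomial.mem_roots (LinearMap.charpoly_monic _).ne_zero).2 hy
    obtain ⟨i, hi, j, hj, hij, he⟩ := Finset.exists_ne_map_eq_of_card_lt_of_maps_to
      (s := Finset.range (d + 1)) (t := S) (f := fun i => x ^ (k ^ i)) (by simpa using by omega)
      (fun i _ => hSm _ (hspec2 x hx i))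
    have key : ∀ i j : ℕ, i < j → j ≤ d → x ^ (k ^ i) = x ^ (k ^ j) → x ^ M = 1 := by
      intro i j hij hj he
      have hlt : k ^ i < k ^ j := Nat.pow_lt_pow_right (by omega) hij
      have hle : k ^ j ≤ k ^ d := Nat.pow_le_pow_right (by omega) hj
      have h1 : x ^ (k ^ j - k ^ i) = 1 := by
        have : x ^ (k ^ i) * x ^ (k ^ j - k ^ i) = x ^ (k ^ i) * 1 := by
          rw [← pow_add, Nat.add_sub_cancel' hlt.le, mul_one, he]
        exact mul_left_cancel₀ (pow_ne_zero _ hx0) this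
      obtain ⟨t, ht⟩ := Nat.dvd_factorial (m := k ^ j - k ^ i) (n := k ^ d) (by omega) (by omega)
      rw [hM, ht, pow_mul, h1, one_pow]
    simp only [Finset.mem_range] at hi hj
    rcases lt_or_gt_of_ne hij with hl | hl
    · exact key i j hl (by omega) he
    · exact key j i hl (by omega) he.symm
  set w : Module.End F V := (z : Module.End F V) ^ M - 1 with hw
  have hnil : IsNilpotent w := by
    have hev : ∀ ν : F, ν ≠ 0 → Module.End.maxGenEigenspace w ν = ⊥ := by
      intro ν hν
      by_contra hb
      have hb' : Module.End.HasEigenvalue w ν := by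
        rw [Module.End.maxGenEigenspace_eq_genEigenspace_finrank] at hb
        exact Module.End.HasUnifEigenvalue.lt zero_lt_one hb
      have h1 := hb'.mem_spectrum
      have h2 : ν + 1 ∈ spectrum F ((z : Module.End F V) ^ M) := by
        have h3 : (z : Module.End F V) ^ M = w + algebraMap F _ 1 := by simp [hw]
        rw [h3]
        rw [add_comm w]
        exact spectrum.add_mem_add_iff.2 h1
      rw [spectrum.map_pow_of_pos _ hMpos] at h2
      obtain ⟨x, hx, he⟩ := h2
      have h4 := hx1 x hx
      simp only at he
      rw [h4] at he
      exact hν (by linear_combination -he)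
    have htop := Module.End.iSup_maxGenEigenspace_eq_top w
    have h0 : Module.End.maxGenEigenspace w 0 = ⊤ := by
      rw [eq_top_iff, ← htop]
      refine iSup_le fun ν => ?_
      by_cases hν : ν = 0
      · rw [hν]
      · rw [hev ν hν]; exact bot_le
    refine ⟨Module.finrank F V, ?_⟩
    rw [Module.End.maxGenEigenspace_eq_genEigenspace_finrank] at h0
    ext v
    have : v ∈ Module.End.genEigenspace w 0 (Module.finrank F V) := by rw [h0]; trivial
    rw [Module.End.mem_genEigenspace_nat] at this
    simpa using this
  have hw0 : w = 0 := by
    refine aux_nilp s w μ hs hμ hnil k hk ?_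
    have h1 : (1 : Module.End F V) + w = ((z ^ M : (Module.End F V)ˣ) : Module.End F V) := by
      simp [hw]
    rw [h1, ← Units.val_mul, ← Units.val_pow_eq_pow_val, ← Units.val_mul]
    congr 1
    rw [← pow_mul, mul_comm M k, pow_mul]
    exact SemiconjBy.pow_right (a := s) (x := z) (y := z ^ k) h M
  apply Units.ext
  rw [hw, sub_eq_zero] at hw0
  simpa using hw0

section SLblocks
variable {ι R : Type*} [Fintype ι] [DecidableEq ι] [CommRing R]

/-- Upper block unipotent. -/
def slU (b : Matrix ι Unit R) : SpecialLinearGroup (ι ⊕ Unit) R :=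
  ⟨fromBlocks 1 b 0 1, by simp⟩

/-- Lower block unipotent. -/
def slL (c : Matrix Unit ι R) : SpecialLinearGroup (ι ⊕ Unit) R :=
  ⟨fromBlocks 1 0 c 1, by simp⟩

/-- Block embedding. -/
def slEmb : SpecialLinearGroup ι R →* SpecialLinearGroup (ι ⊕ Unit) R where
  toFun A := ⟨fromBlocks (A : Matrix ι ι R) 0 0 1, by simp⟩
  map_one' := Subtype.ext (by simp)
  map_mul' A B := Subtype.ext (by
    change fromBlocks ((A : Matrix ι ι R) * (B : Matrix ι ι R)) 0 0 1 =
      fromBlocks (A : Matrix ι ι R) 0 0 1 * fromBlocks (B : Matrix ι ι R) 0 0 1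
    simp [fromBlocks_multiply])

/-- Central-type diagonal element. -/
def slD (a : Rˣ) : SpecialLinearGroup (ι ⊕ Unit) R :=
  ⟨fromBlocks ((a : R) • (1 : Matrix ι ι R)) 0 0
    ((((a⁻¹ : Rˣ) : R) ^ Fintype.card ι) • (1 : Matrix Unit Unit R)), by
      simp [det_smul, ← mul_pow]⟩

@[simp] lemma coe_slU (b : Matrix ι Unit R) :
    ((slU b : SpecialLinearGroup (ι ⊕ Unit) R) : Matrix (ι ⊕ Unit) (ι ⊕ Unit) R)
      = fromBlocks 1 b 0 1 := rfl
@[simp] lemma coe_slL (c : Matrix Unit ι R) :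
    ((slL c : SpecialLinearGroup (ι ⊕ Unit) R) : Matrix (ι ⊕ Unit) (ι ⊕ Unit) R)
      = fromBlocks 1 0 c 1 := rfl
@[simp] lemma coe_slEmb (A : SpecialLinearGroup ι R) :
    ((slEmb A : SpecialLinearGroup (ι ⊕ Unit) R) : Matrix (ι ⊕ Unit) (ι ⊕ Unit) R)
      = fromBlocks (A : Matrix ι ι R) 0 0 1 := rfl
@[simp] lemma coe_slD (a : Rˣ) :
    ((slD a : SpecialLinearGroup (ι ⊕ Unit) R) : Matrix (ι ⊕ Unit) (ι ⊕ Unit) R)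
      = fromBlocks ((a : R) • (1 : Matrix ι ι R)) 0 0
    ((((a⁻¹ : Rˣ) : R) ^ Fintype.card ι) • (1 : Matrix Unit Unit R)) := rfl

lemma slU_add (b b' : Matrix ι Unit R) : slU (b + b') = slU b * slU b' :=
  Subtype.ext (by simp [fromBlocks_multiply, add_comm])
lemma slL_add (b b' : Matrix Unit ι R) : slL (b + b') = slL b * slL b' :=
  Subtype.ext (by simp [fromBlocks_multiply])
lemma slU_zero : slU (0 : Matrix ι Unit R) = 1 := Subtype.ext (by simp)
lemma slL_zero : slL (0 : Matrix Unit ι R) = 1 := Subtype.ext (by simp)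
lemma slU_pow (b : Matrix ι Unit R) (k : ℕ) : slU b ^ k = slU ((k : R) • b) := by
  induction k with
  | zero => simp [slU_zero]
  | succ k ih => rw [pow_succ, ih, ← slU_add]; congr 1; push_cast; rw [add_smul, one_smul]
lemma slL_pow (b : Matrix Unit ι R) (k : ℕ) : slL b ^ k = slL ((k : R) • b) := by
  induction k with
  | zero => simp [slL_zero]
  | succ k ih => rw [pow_succ, ih, ← slL_add]; congr 1; push_cast; rw [add_smul, one_smul]

lemma slD_slU (a : Rˣ) (k : ℕ) (hk : (k : R) = a ^ (Fintype.card ι + 1)) (b : Matrix ι Unit R) :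
    slD a * slU b = slU b ^ k * slD a := by
  rw [slU_pow, hk]
  refine Subtype.ext ?_
  simp only [Matrix.SpecialLinearGroup.coe_mul, coe_slD, coe_slU, fromBlocks_multiply]
  simp only [mul_one, add_zero, zero_add, smul_zero, smul_smul, Matrix.mul_one, Matrix.mul_zero, Matrix.one_mul, Matrix.zero_mul,
    Matrix.smul_mul, Matrix.mul_smul]
  congr 2
  rw [pow_succ, ← mul_assoc, ← mul_pow]; simp

lemma slD_slL (a : Rˣ) (k : ℕ) (hk : (k : R) = a ^ (Fintype.card ι + 1)) (c : Matrix Unit ι R) :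
    (slD a)⁻¹ * slL c = slL c ^ k * (slD a)⁻¹ := by
  rw [inv_mul_eq_iff_eq_mul, ← mul_assoc, eq_mul_inv_iff_mul_eq, slL_pow, hk]
  refine Subtype.ext ?_
  simp only [Matrix.SpecialLinearGroup.coe_mul, coe_slD, coe_slL, fromBlocks_multiply]
  simp only [mul_one, add_zero, zero_add, smul_zero, smul_smul, Matrix.mul_one, Matrix.mul_zero, Matrix.one_mul, Matrix.zero_mul,
    Matrix.smul_mul, Matrix.mul_smul]
  congr 2
  rw [pow_succ, mul_right_comm, ← mul_pow]; simp

lemma slD_slEmb (a : Rˣ) (A : SpecialLinearGroup ι R) : slD a * slEmb A = slEmb A * slD a := by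
  refine Subtype.ext ?_
  simp [fromBlocks_multiply]

lemma slEmb_slU (A : SpecialLinearGroup ι R) (b : Matrix ι Unit R) :
    slEmb A * slU b = slU ((A : Matrix ι ι R) * b) * slEmb A := by
  refine Subtype.ext ?_
  simp [fromBlocks_multiply]

lemma slL_slEmb (A : SpecialLinearGroup ι R) (c : Matrix Unit ι R) :
    slL c * slEmb A = slEmb A * slL (c * (A : Matrix ι ι R)) := by
  refine Subtype.ext ?_
  simp [fromBlocks_multiply]

lemma sl_comm (b : Matrix ι Unit R) (c : Matrix Unit ι R) (h : c * b = 0)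
    (A : SpecialLinearGroup ι R) (hA : (A : Matrix ι ι R) = 1 + b * c) :
    slEmb A = slU b * slL c * slU (-b) * slL (-c) := by
  refine Subtype.ext ?_
  have h1 : b * c * b = 0 := by rw [Matrix.mul_assoc, h, Matrix.mul_zero]
  have h2 : b * c * (b * c) = 0 := by rw [← Matrix.mul_assoc, h1, Matrix.zero_mul]
  have h3 : c * (b * c) = 0 := by rw [← Matrix.mul_assoc, h, Matrix.zero_mul]
  simp [fromBlocks_multiply, hA, h, h1, h2, h3, Matrix.add_mul, Matrix.mul_add]

lemma slU_mem (H : Subgroup (SpecialLinearGroup (ι ⊕ Unit) R))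
    (h : ∀ i x, slU (single i () x) ∈ H) (b : Matrix ι Unit R) : slU b ∈ H := by
  induction b using Matrix.induction_on' with
  | h_zero => rw [slU_zero]; exact H.one_mem
  | h_add p q hp hq => rw [slU_add]; exact H.mul_mem hp hq
  | h_std_basis i j x => exact h i x

lemma slL_mem (H : Subgroup (SpecialLinearGroup (ι ⊕ Unit) R))
    (h : ∀ i x, slL (single () i x) ∈ H) (b : Matrix Unit ι R) : slL b ∈ H := by
  induction b using Matrix.induction_on' with
  | h_zero => rw [slL_zero]; exact H.one_mem
  | h_add p q hp hq => rw [slL_add]; exact H.mul_mem hp hq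
  | h_std_basis i j x => exact h j x

lemma sl_top_of_blocks [IsLocalRing R] (H : Subgroup (SpecialLinearGroup (ι ⊕ Unit) R))
    (hU : ∀ b, slU b ∈ H) (hL : ∀ c, slL c ∈ H) (hE : ∀ A, slEmb A ∈ H) : H = ⊤ := by
  rw [eq_top_iff]
  rintro A -
  have c1 : ∀ A : SpecialLinearGroup (ι ⊕ Unit) R, A (.inr ()) (.inr ()) = 1 → A ∈ H := by
    intro A hA
    obtain ⟨P, b, c, d, hP⟩ : ∃ P b c d, (A : Matrix (ι ⊕ Unit) (ι ⊕ Unit) R) =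
      fromBlocks P b c d := ⟨_, _, _, _, (fromBlocks_toBlocks _).symm⟩
    have hd : d = 1 := by
      ext i j
      have : (A : Matrix (ι ⊕ Unit) (ι ⊕ Unit) R) (.inr i) (.inr j) = 1 := hA
      rw [hP] at this
      simpa using this
    subst hd
    have hdet : (P - b * c).det = 1 := by
      have := A.det_coe
      rwa [hP, det_fromBlocks_one₂₂] at this
    obtain ⟨A', hA'⟩ : ∃ A' : SpecialLinearGroup ι R, (A' : Matrix ι ι R) = P - b * c :=
      ⟨⟨P - b * c, hdet⟩, rfl⟩
    have : A = slU b * slEmb A' * slL c := by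
      refine Subtype.ext ?_
      rw [hP, Matrix.SpecialLinearGroup.coe_mul, Matrix.SpecialLinearGroup.coe_mul, coe_slEmb, hA']
      simp [fromBlocks_multiply]
    rw [this]
    exact H.mul_mem (H.mul_mem (hU _) (hE _)) (hL _)
  have c2 : ∀ A : SpecialLinearGroup (ι ⊕ Unit) R, ∀ i : ι, IsUnit (A (.inl i) (.inr ())) →
      A ∈ H := by
    intro A i hA
    obtain ⟨u, hu⟩ := hA
    have : slL (single () i ((1 - A (.inr ()) (.inr ())) * (u⁻¹ : Rˣ))) * A ∈ H := by
      apply c1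
      simp only [Matrix.SpecialLinearGroup.coe_mul, coe_slL, Matrix.mul_apply, Fintype.sum_sum_type]
      simp [single_apply, ← hu]
    exact (H.mul_mem_cancel_left (hL _)).1 this
  by_cases hex : ∃ i : ι, IsUnit (A (.inl i) (.inr ()))
  · obtain ⟨i, hi⟩ := hex
    exact c2 A i hi
  push Not at hex
  rcases isEmpty_or_nonempty ι with he | ⟨⟨i⟩⟩
  · have : A = 1 := @Subsingleton.elim _ (@Matrix.SpecialLinearGroup.subsingleton_of_subsingleton _ _ _ _ _ ⟨by
      rintro (a | a) (b | b)
      · exact he.elim a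
      · exact he.elim a
      · exact he.elim b
      · rfl⟩) _ _
    rw [this]; exact H.one_mem
  have hll : IsUnit (A (.inr ()) (.inr ())) := by
    by_contra hll
    have h1 : (A⁻¹ * A) (.inr ()) (.inr ()) = 1 := by simp
    have h2 : (A⁻¹ * A) (.inr ()) (.inr ()) ∈ IsLocalRing.maximalIdeal R := by
      rw [Matrix.SpecialLinearGroup.coe_mul, Matrix.mul_apply]
      refine Ideal.sum_mem _ fun j _ => Ideal.mul_mem_left _ _ ?_
      rw [IsLocalRing.mem_maximalIdeal, mem_nonunits_iff]
      rcases j with j | j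
      · exact hex j
      · exact hll
    rw [h1] at h2
    exact (Ideal.ne_top_iff_one _).1 (IsLocalRing.maximalIdeal.isMaximal R).ne_top h2
  obtain ⟨u, hu⟩ := hll
  have : slU (single i () ((1 - A (.inl i) (.inr ())) * (u⁻¹ : Rˣ))) * A ∈ H := by
    apply c2 _ i
    have : (slU (single i () ((1 - A (.inl i) (.inr ())) * (u⁻¹ : Rˣ))) * A) (.inl i) (.inr ())
        = 1 := by
      simp only [Matrix.SpecialLinearGroup.coe_mul, coe_slU, Matrix.mul_apply, Fintype.sum_sum_type]
      simp [single_apply, ← hu, Matrix.one_apply]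
    rw [this]; exact isUnit_one
  exact (H.mul_mem_cancel_left (hU _)).1 this

/-- Reindexing. -/
def slReindex {α β : Type*} [Fintype α] [DecidableEq α] [Fintype β] [DecidableEq β] (e : α ≃ β) :
    SpecialLinearGroup α R →* SpecialLinearGroup β R where
  toFun A := ⟨(A : Matrix α α R).submatrix e.symm e.symm, by simp⟩
  map_one' := Subtype.ext (by simp)
  map_mul' A B := Subtype.ext (by
    change ((A : Matrix α α R) * (B : Matrix α α R)).submatrix e.symm e.symm =
      (A : Matrix α α R).submatrix e.symm e.symm * (B : Matrix α α R).submatrix e.symm e.symm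
    simp [submatrix_mul_equiv])

@[simp] lemma coe_slReindex {α β : Type*} [Fintype α] [DecidableEq α] [Fintype β] [DecidableEq β]
    (e : α ≃ β) (A : SpecialLinearGroup α R) :
    ((slReindex e A : SpecialLinearGroup β R) : Matrix β β R) =
      (A : Matrix α α R).submatrix e.symm e.symm := rfl

lemma slReindex_surj {α β : Type*} [Fintype α] [DecidableEq α] [Fintype β] [DecidableEq β]
    (e : α ≃ β) (A : SpecialLinearGroup β R) : slReindex e (slReindex e.symm A) = A :=
  Subtype.ext (by simp)

end SLblocks

lemma sl_gen {R : Type*} [CommRing R] [IsLocalRing R] (m : ℕ) :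
    ∀ (ι : Type) [Fintype ι] [DecidableEq ι], Fintype.card ι = m →
    ∀ H : Subgroup (SpecialLinearGroup ι R),
      (∀ (i j : ι) (hij : i ≠ j) (x : R), SpecialLinearGroup.transvection hij x ∈ H) → H = ⊤ := by
  induction m with
  | zero =>
    intro ι _ _ hc H _
    have := Fintype.card_eq_zero_iff.1 hc
    exact Subsingleton.elim _ _
  | succ m ih =>
    intro ι _ _ hc H hH
    have e : (Fin m ⊕ Unit) ≃ ι := Fintype.equivOfCardEq (by simp [hc])
    have key : H.comap (slReindex e) = ⊤ := by
      have hT : ∀ (i j : Fin m ⊕ Unit) (hij : i ≠ j) (x : R),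
          SpecialLinearGroup.transvection hij x ∈ H.comap (slReindex e) := by
        intro i j hij x
        have : slReindex e (SpecialLinearGroup.transvection hij x) =
            SpecialLinearGroup.transvection (e.injective.ne hij) x := by
          ext a b
          simp [SpecialLinearGroup.transvection_coe, Matrix.single_apply,
            Matrix.one_apply, Equiv.eq_symm_apply]
        rw [Subgroup.mem_comap, this]
        exact hH _ _ _ _
      refine sl_top_of_blocks _ (slU_mem _ fun i x => ?_) (slL_mem _ fun i x => ?_) fun A => ?_
      · have := hT (.inl i) (.inr ()) (by simp) x
        convert this using 1
        ext a b
        rcases a with a | a <;> rcases b with b | b <;>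
          simp [SpecialLinearGroup.transvection_coe, Matrix.single_apply, Matrix.one_apply]
      · have := hT (.inr ()) (.inl i) (by simp) x
        convert this using 1
        ext a b
        rcases a with a | a <;> rcases b with b | b <;>
          simp [SpecialLinearGroup.transvection_coe, Matrix.single_apply, Matrix.one_apply]
      · have := ih (Fin m) (by simp) ((H.comap (slReindex e)).comap slEmb) (by
          intro i j hij x
          have := hT (.inl i) (.inl j) (by simpa using hij) x
          rw [Subgroup.mem_comap]
          convert this using 1
          ext a b
          rcases a with a | a <;> rcases b with b | b <;>
            simp [SpecialLinearGroup.transvection_coe, Matrix.single_apply, Matrix.one_apply])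
        have hA : A ∈ (H.comap (slReindex e)).comap slEmb := by rw [this]; trivial
        exact hA
    rw [eq_top_iff]
    rintro A -
    have : slReindex e.symm A ∈ H.comap (slReindex e) := by rw [key]; trivial
    rwa [Subgroup.mem_comap, slReindex_surj] at this

lemma sl_top_of_UL {ι : Type} {R : Type*} [Fintype ι] [DecidableEq ι] [CommRing R] [IsLocalRing R]
    (H : Subgroup (SpecialLinearGroup (ι ⊕ Unit) R))
    (hU : ∀ b, slU b ∈ H) (hL : ∀ c, slL c ∈ H) : H = ⊤ := by
  refine sl_top_of_blocks H hU hL fun A => ?_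
  have := sl_gen _ ι rfl (H.comap slEmb) (by
    intro i j hij x
    rw [Subgroup.mem_comap, sl_comm (single i () x) (single () j (1 : R))
      (by simp [hij.symm]) _ (by simp [SpecialLinearGroup.transvection_coe])]
    exact H.mul_mem (H.mul_mem (H.mul_mem (hU _) (hL _)) (hU _)) (hL _))
  have hA : A ∈ H.comap slEmb := by rw [this]; trivial
  exact hA

lemma sl_top_of_emb {ι : Type} {R : Type*} [Fintype ι] [DecidableEq ι] [CommRing R] [IsLocalRing R]
    (H : Subgroup (SpecialLinearGroup (ι ⊕ Unit) R)) [H.Normal] (hc : 2 ≤ Fintype.card ι)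
    (hE : ∀ A, slEmb A ∈ H) : H = ⊤ := by
  have : Nontrivial ι := Fintype.one_lt_card_iff_nontrivial.1 hc
  refine sl_top_of_blocks H (slU_mem _ fun i x => ?_) (slL_mem _ fun i x => ?_) hE
  · obtain ⟨j, hj⟩ := exists_ne i
    have h1 := slEmb_slU (SpecialLinearGroup.transvection hj.symm (1 : R)) (single j () x)
    have h2 : ((SpecialLinearGroup.transvection hj.symm (1 : R) : SpecialLinearGroup ι R) :
        Matrix ι ι R) * single j () x = single i () x + single j () x := by
      simp [SpecialLinearGroup.transvection_coe, Matrix.add_mul, add_comm]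
    rw [h2, slU_add, mul_assoc] at h1
    have h3 : slU (single i () x) = slEmb (SpecialLinearGroup.transvection hj.symm (1 : R)) *
      (slU (single j () x) * (slEmb (SpecialLinearGroup.transvection hj.symm (1 : R)))⁻¹ *
        (slU (single j () x))⁻¹) := by
      rw [← mul_assoc, ← mul_assoc, h1]; group
    rw [h3]
    exact H.mul_mem (hE _) (Subgroup.Normal.conj_mem inferInstance _ (H.inv_mem (hE _)) _)
  · obtain ⟨j, hj⟩ := exists_ne i
    have h1 := slL_slEmb (SpecialLinearGroup.transvection hj (1 : R)) (single () j x)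
    have h2 : single () j x * ((SpecialLinearGroup.transvection hj (1 : R) :
        SpecialLinearGroup ι R) : Matrix ι ι R) = single () j x + single () i x := by
      simp [SpecialLinearGroup.transvection_coe, Matrix.mul_add]
    rw [h2, slL_add] at h1
    have h3 : slL (single () i x) = ((slL (single () j x))⁻¹ *
      (slEmb (SpecialLinearGroup.transvection hj (1 : R)))⁻¹ * slL (single () j x)) *
       slEmb (SpecialLinearGroup.transvection hj (1 : R)) := by
      rw [mul_assoc, h1]; group
    rw [h3]
    refine H.mul_mem ?_ (hE _)
    have := Subgroup.Normal.conj_mem (H := H) inferInstance _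
      (H.inv_mem (hE (SpecialLinearGroup.transvection hj (1 : R)))) (slL (single () j x))⁻¹
    rwa [inv_inv] at this

lemma rep_trivial {R F : Type} [CommRing R] [IsLocalRing R] [Field F] [IsAlgClosed F] [CharZero F]
    (m : ℕ) : ∀ (ι : Type) [Fintype ι] [DecidableEq ι], Fintype.card ι = m →
    (∀ q : ℕ, 0 < q → q ≤ (2 ^ m) ^ m → IsUnit (q : R)) →
    ∀ (V : Type) [AddCommGroup V] [Module F V] [FiniteDimensional F V], Module.finrank F V < m →
    ∀ ρ : SpecialLinearGroup ι R →* Module.End F V, ∀ g, ρ g = 1 := by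
  induction m with
  | zero => intro ι _ _ _ _ V _ _ _ h; omega
  | succ m ih =>
    intro ι _ _ hc hR V _ _ _ hV ρ₀
    have e : (Fin m ⊕ Unit) ≃ ι := Fintype.equivOfCardEq (by simp [hc])
    obtain ⟨ρ, hρ⟩ : ∃ ρ : SpecialLinearGroup (Fin m ⊕ Unit) R →* Module.End F V,
      ρ = ρ₀.comp (slReindex e) := ⟨_, rfl⟩
    suffices hker : ρ.toHomUnits.ker = ⊤ by
      intro g
      have h1 : slReindex e.symm g ∈ ρ.toHomUnits.ker := by rw [hker]; trivial
      rw [MonoidHom.mem_ker] at h1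
      have h2 : ρ (slReindex e.symm g) = 1 := by
        have := congrArg Units.val h1
        simpa using this
      rw [hρ, MonoidHom.comp_apply, slReindex_surj] at h2
      exact h2
    have h2u : IsUnit ((2 : ℕ) : R) := by
      apply hR 2 (by norm_num)
      rw [← pow_mul]
      calc 2 = 2 ^ 1 := by norm_num
        _ ≤ _ := Nat.pow_le_pow_right (by norm_num) (by nlinarith)
    obtain ⟨a, ha⟩ := h2u
    have hk : (((2 ^ (m + 1) : ℕ)) : R) = (a : R) ^ (Fintype.card (Fin m) + 1) := by
      rw [ha]; simp
    have hk2 : 2 ≤ 2 ^ (m + 1) := by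
      calc 2 = 2 ^ 1 := by norm_num
        _ ≤ _ := Nat.pow_le_pow_right (by norm_num) (by omega)
    set k := 2 ^ (m + 1) with hkdef
    set s := slD (ι := Fin m) a with hs
    by_cases hsingle : ∃ μ : F, Module.End.maxGenEigenspace (ρ s) μ = ⊤
    · obtain ⟨μ, hμ⟩ := hsingle
      have hMu : IsUnit ((Nat.factorial (k ^ m) : ℕ) : R) := by
        have : ∀ t : ℕ, t ≤ k ^ (m + 1) → IsUnit ((Nat.factorial t : ℕ) : R) := by
          intro t
          induction t with
          | zero => intro _; simp
          | succ t iht =>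
            intro ht
            rw [Nat.factorial_succ, Nat.cast_mul]
            exact (hR _ (by omega) ht).mul (iht (by omega))
        exact this _ (Nat.pow_le_pow_right (by omega) (by omega))
      obtain ⟨M, hM⟩ := hMu
      have hnil : IsNilpotent (ρ s - algebraMap F (Module.End F V) μ) := by
        refine ⟨Module.finrank F V, ?_⟩
        rw [Module.End.maxGenEigenspace_eq_genEigenspace_finrank] at hμ
        ext v
        have : v ∈ Module.End.genEigenspace (ρ s) μ (Module.finrank F V) := by rw [hμ]; trivial
        rw [Module.End.mem_genEigenspace_nat] at this
        simpa [Algebra.algebraMap_eq_smul_one] using this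
      refine sl_top_of_UL _ (fun b => ?_) (fun c => ?_)
      · have h1 := aux_main (ρ.toHomUnits s) (ρ.toHomUnits (slU ((M⁻¹ : Rˣ) • b))) μ
          (by simpa using hnil) k m hk2 (by omega)
          (by rw [← map_mul, ← map_pow, ← map_mul, hs, slD_slU a k hk])
        rw [← map_pow, slU_pow, ← hM] at h1
        rw [MonoidHom.mem_ker]
        rw [← h1]
        congr 2
        change b = M • (M⁻¹ • b)
        simp
      · have hnil' : IsNilpotent (ρ s⁻¹ - algebraMap F (Module.End F V) μ⁻¹) := by
          have hi1 : ρ s⁻¹ * ρ s = 1 := by rw [← map_mul]; simp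
          have hi2 : ρ s * ρ s⁻¹ = 1 := by rw [← map_mul]; simp
          by_cases hμ0 : μ = 0
          · rw [hμ0, map_zero, sub_zero] at hnil
            obtain ⟨j, hj⟩ := hnil
            have h10 : (1 : Module.End F V) = 0 := by
              have : ρ s⁻¹ ^ j * ρ s ^ j = 1 := by
                rw [← map_pow, ← map_pow, ← map_mul]; simp
              rw [← this, hj, mul_zero]
            exact ⟨1, by rw [pow_one]; exact eq_zero_of_zero_eq_one h10.symm _⟩
          have : ρ s⁻¹ - algebraMap F (Module.End F V) μ⁻¹ =
              (-(μ⁻¹) • ρ s⁻¹) * (ρ s - algebraMap F (Module.End F V) μ) := by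
            rw [mul_sub, smul_mul_assoc, hi1]
            simp only [Algebra.algebraMap_eq_smul_one, mul_smul_comm, mul_one, smul_smul, neg_smul]
            rw [smul_neg, smul_smul, mul_inv_cancel₀ hμ0, one_smul]
            abel
          rw [this]
          apply Commute.isNilpotent_mul_left _ hnil
          apply Commute.smul_left
          apply Commute.sub_right
          · exact hi1.trans hi2.symm
          · exact (Algebra.commutes _ _).symm
        have h1 := aux_main (ρ.toHomUnits s⁻¹) (ρ.toHomUnits (slL ((M⁻¹ : Rˣ) • c))) μ⁻¹
          (by rw [MonoidHom.coe_toHomUnits]; exact hnil') k m hk2 (by omega)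
          (by rw [← map_mul, ← map_pow, ← map_mul, hs, slD_slL a k hk])
        rw [← map_pow, slL_pow, ← hM] at h1
        rw [MonoidHom.mem_ker]
        rw [← h1]
        congr 2
        change c = M • (M⁻¹ • c)
        simp
    · push Not at hsingle
      have hlt : ∀ μ, Module.finrank F (Module.End.maxGenEigenspace (ρ s) μ) <
          Module.finrank F V := fun μ => Submodule.finrank_lt (hsingle μ)
      have hcomm : ∀ A, Commute (ρ s) (ρ (slEmb A)) := by
        intro A
        change _ * _ = _ * _
        rw [← map_mul, ← map_mul, hs, slD_slEmb]
      have htop := Module.End.iSup_maxGenEigenspace_eq_top (ρ s)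
      have hdim2 : 2 ≤ m := by
        by_contra hm
        have hle : Module.finrank F V ≤ 1 := by omega
        have : (⨆ μ, Module.End.maxGenEigenspace (ρ s) μ) = ⊥ := by
          rw [iSup_eq_bot]
          intro μ
          have := hlt μ
          exact Submodule.finrank_eq_zero.1 (by omega)
        have h0 := hlt 0
        rw [htop] at this
        have h00 : Module.finrank F V = 0 := by
          rw [← finrank_top F V, this]; simp
        omega
      refine sl_top_of_emb _ (by simpa using hdim2) fun A => ?_
      rw [MonoidHom.mem_ker]
      apply Units.ext
      rw [MonoidHom.coe_toHomUnits, Units.val_one]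
      have hW : ∀ μ, ∀ v ∈ Module.End.maxGenEigenspace (ρ s) μ, ρ (slEmb A) v = v := by
        intro μ v hv
        have hmap : ∀ B, Set.MapsTo (ρ (slEmb B)) (Module.End.maxGenEigenspace (ρ s) μ)
            (Module.End.maxGenEigenspace (ρ s) μ) := fun B =>
          Module.End.mapsTo_maxGenEigenspace_of_comm (hcomm B) μ
        let ρW : SpecialLinearGroup (Fin m) R →*
            Module.End F (Module.End.maxGenEigenspace (ρ s) μ) :=
          { toFun := fun B => (ρ (slEmb B)).restrict (hmap B)
            map_one' := by ext w; simp [LinearMap.restrict_apply]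
            map_mul' := by intro B C; ext w
                           change (ρ (slEmb (B * C))) (w : V) =
                             (ρ (slEmb B)) ((ρ (slEmb C)) (w : V))
                           rw [map_mul, map_mul]; rfl }
        have h1 := ih (Fin m) (by simp) (fun q hq hqm => hR q hq (hqm.trans (by
            rw [← pow_mul, ← pow_mul]
            exact Nat.pow_le_pow_right (by norm_num) (by nlinarith))))
          (Module.End.maxGenEigenspace (ρ s) μ) (by have := hlt μ; omega) ρW A
        have h2 := congrArg (fun f => ((f ⟨v, hv⟩ : Module.End.maxGenEigenspace (ρ s) μ) : V)) h1
        exact h2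
      have hle : (⊤ : Submodule F V) ≤ LinearMap.eqLocus (ρ (slEmb A)) (1 : Module.End F V) := by
        rw [← htop]
        refine iSup_le fun μ v hv => ?_
        rw [LinearMap.mem_eqLocus]
        simpa using hW μ v hv
      ext v
      exact LinearMap.mem_eqLocus.1 (hle (Submodule.mem_top (x := v)))

lemma intClosure_iff {l : ℕ} [Fact (Nat.Prime l)] {K : Type} [Field K] [Algebra ℚ_[l] K]
    [FiniteDimensional ℚ_[l] K] [Algebra ℤ_[l] K] [IsScalarTower ℤ_[l] ℚ_[l] K] (x : K) :
    IsIntegral ℤ_[l] x ↔ spectralNorm ℚ_[l] K x ≤ 1 := by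
  have hxi : IsIntegral ℚ_[l] x := Algebra.IsIntegral.isIntegral x
  rw [spectralNorm, spectralValue_le_one_iff (minpoly.monic hxi)]
  constructor
  · intro h n
    rw [minpoly.isIntegrallyClosed_eq_field_fractions' ℚ_[l] h, Polynomial.coeff_map]
    exact PadicInt.norm_le_one _
  · intro h
    have hl : minpoly ℚ_[l] x ∈ Polynomial.lifts (algebraMap ℤ_[l] ℚ_[l]) := by
      rw [Polynomial.lifts_iff_coeff_lifts]
      intro n
      exact ⟨⟨_, h n⟩, rfl⟩
    obtain ⟨p, hp, -, hpm⟩ := Polynomial.lifts_and_natDegree_eq_and_monic hl (minpoly.monic hxi)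
    refine ⟨p, hpm, ?_⟩
    have := minpoly.aeval ℚ_[l] x
    rw [← hp, Polynomial.aeval_map_algebraMap] at this
    exact this

lemma intClosure_local {l : ℕ} [Fact (Nat.Prime l)] {K : Type} [Field K] [Algebra ℚ_[l] K]
    [FiniteDimensional ℚ_[l] K] [Algebra ℤ_[l] K] [IsScalarTower ℤ_[l] ℚ_[l] K] :
    IsLocalRing (integralClosure ℤ_[l] K) := by
  have hmul : ∀ x y : K, spectralNorm ℚ_[l] K (x * y) =
      spectralNorm ℚ_[l] K x * spectralNorm ℚ_[l] K y := fun x y =>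
    map_mul (spectralMulAlgNorm ℚ_[l] K) x y
  have hunit : ∀ x : integralClosure ℤ_[l] K, spectralNorm ℚ_[l] K (x : K) = 1 → IsUnit x := by
    intro x hx
    have hx0 : (x : K) ≠ 0 := by
      intro h; rw [h, spectralNorm_zero] at hx; exact zero_ne_one hx
    have h1 : spectralNorm ℚ_[l] K (x : K)⁻¹ = 1 := by
      have := hmul (x : K) (x : K)⁻¹
      rw [mul_inv_cancel₀ hx0, spectralNorm_one, hx, one_mul] at this
      exact this.symm
    exact IsUnit.of_mul_eq_one ⟨(x : K)⁻¹, (intClosure_iff _).2 h1.le⟩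
      (Subtype.ext (mul_inv_cancel₀ hx0))
  refine IsLocalRing.of_isUnit_or_isUnit_of_isUnit_add ?_
  intro x y hxy
  by_contra hc
  push Not at hc
  have hlt : ∀ z : integralClosure ℤ_[l] K, ¬ IsUnit z → spectralNorm ℚ_[l] K (z : K) < 1 :=
    fun z hz => lt_of_le_of_ne ((intClosure_iff _).1 z.2) fun h => hz (hunit z h)
  have h1 : spectralNorm ℚ_[l] K ((x : K) + y) < 1 :=
    lt_of_le_of_lt (isNonarchimedean_spectralNorm (x : K) (y : K))
      (max_lt (hlt x hc.1) (hlt y hc.2))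
  obtain ⟨w, hw⟩ := hxy.exists_right_inv
  have h2 : ((x : K) + y) * w = 1 := congrArg Subtype.val hw
  have h3 := hmul ((x : K) + y) w
  rw [h2, spectralNorm_one] at h3
  have h4 : spectralNorm ℚ_[l] K (w : K) ≤ 1 := (intClosure_iff _).1 w.2
  have h5 := spectralNorm_nonneg (K := ℚ_[l]) ((x : K) + y)
  have h6 := spectralNorm_nonneg (K := ℚ_[l]) (w : K)
  nlinarith

lemma no_hom_aux (n N l : ℕ) (hNn : N < n) [Fact (Nat.Prime l)] (hl : (2 ^ n) ^ n < l)
    (K K' : Type) [Field K] [Field K']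
        [Algebra ℚ_[l] K] [Algebra ℚ_[l] K']
        [FiniteDimensional ℚ_[l] K] [FiniteDimensional ℚ_[l] K']
        [Algebra ℤ_[l] K] [Algebra ℤ_[l] K']
        [IsScalarTower ℤ_[l] ℚ_[l] K] [IsScalarTower ℤ_[l] ℚ_[l] K']
      (φ : Matrix.SpecialLinearGroup (Fin n) ↥(integralClosure ℤ_[l] K') →*
              GL (Fin N) ↥(integralClosure ℤ_[l] K)) : φ = 1 := by
  have hloc : IsLocalRing (integralClosure ℤ_[l] K') := intClosure_local
  have hchar : CharZero K := charZero_of_injective_algebraMap (algebraMap ℚ_[l] K).injective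
  let F := AlgebraicClosure K
  have hcharF : CharZero F := charZero_of_injective_algebraMap (algebraMap K F).injective
  let f : integralClosure ℤ_[l] K →+* F :=
    (algebraMap K F).comp (integralClosure ℤ_[l] K).val.toRingHom
  have hf : Function.Injective f := (algebraMap K F).injective.comp Subtype.val_injective
  let ρ : Matrix.SpecialLinearGroup (Fin n) (integralClosure ℤ_[l] K') →*
      Module.End F (Fin N → F) :=
    ((Matrix.toLinAlgEquiv' (R := F) (n := Fin N)).toMulEquiv.toMonoidHom.comp
      (f.mapMatrix (m := Fin N)).toMonoidHom).comp ((Units.coeHom _).comp φ)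
  have h := rep_trivial (R := integralClosure ℤ_[l] K') (F := F) n (Fin n) (by simp) (by
    intro q hq hqn
    have h1 : IsUnit ((q : ℕ) : ℤ_[l]) := by
      rw [PadicInt.isUnit_iff]
      refine le_antisymm (PadicInt.norm_le_one _) (not_lt.1 fun hlt => ?_)
      have h2 := (PadicInt.norm_int_lt_one_iff_dvd (p := l) (q : ℤ)).1 (by simpa using hlt)
      have h3 : l ∣ q := by exact_mod_cast h2
      have := Nat.le_of_dvd hq h3
      omega
    simpa using h1.map (algebraMap ℤ_[l] (integralClosure ℤ_[l] K')))
    (Fin N → F) (by simpa using hNn) ρ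
  ext g : 1
  apply Units.ext
  have hg := h g
  have hg2 : (Matrix.toLinAlgEquiv' (R := F) (n := Fin N))
      (f.mapMatrix ((φ g : GL (Fin N) _) : Matrix (Fin N) (Fin N) (integralClosure ℤ_[l] K))) =
      (Matrix.toLinAlgEquiv' (R := F) (n := Fin N)) 1 := by
    rw [map_one]; exact hg
  have hg3 := (Matrix.toLinAlgEquiv' (R := F) (n := Fin N)).injective hg2
  rw [← map_one f.mapMatrix] at hg3
  exact Matrix.map_injective hf hg3

/-- **Wong, Theorem 4(b) for `SL_n`.**  For integers `n, N > 1` with `N < n` there is a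
constant `c(n,N) > 0` such that for every prime `l > c(n,N)` and any rings of integers
`𝒪, 𝒪'` of finite extensions `K, K'` of `ℚ_l` (realized as the integral closure of `ℤ_l`
in the extension), there is no nontrivial abstract (not assumed continuous) group
homomorphism `φ : SL_n(𝒪') → GL_N(𝒪)`. -/
theorem no_abstract_hom_SL (n N : ℕ) (hn : 1 < n) (hN : 1 < N) (hNn : N < n) :
    ∃ c : ℕ, 0 < c ∧
      ∀ (l : ℕ) [Fact (Nat.Prime l)], c < l →
      ∀ (K K' : Type) [Field K] [Field K']
        [Algebra ℚ_[l] K] [Algebra ℚ_[l] K']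
        [FiniteDimensional ℚ_[l] K] [FiniteDimensional ℚ_[l] K']
        [Algebra ℤ_[l] K] [Algebra ℤ_[l] K']
        [IsScalarTower ℤ_[l] ℚ_[l] K] [IsScalarTower ℤ_[l] ℚ_[l] K'],
      ∀ φ : Matrix.SpecialLinearGroup (Fin n) ↥(integralClosure ℤ_[l] K') →*
              GL (Fin N) ↥(integralClosure ℤ_[l] K),
        φ = 1 := by
  refine ⟨(2 ^ n) ^ n, by positivity, ?_⟩
  intro l _ hl K K' _ _ _ _ _ _ _ _ _ _ φ
  exact no_hom_aux n N l hNn hl K K' φ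
end

section
/- For any integers n, N > 1 there exists a constant c(n, N) > 0 such that for every prime l > c(n, N) and any two rings of integers 𝒪 and 𝒪' of finite extensions of ℚ_l, every abstract (not assumed continuous) group homomorphism φ: Sp_{2n}(𝒪') → GL_N(𝒪) is continuous with respect to the l-adic topologies, and moreover if φ is nontrivial then the kernel of φ is contained in the subgroup of scalar matrices of Sp_{2n}(𝒪'). -/
open Matrix

/-- The level-`j` principal congruence subgroup of `Sp_{2n}(O)`: the kernel of the reduction
map `Sp_{2n}(O) → Sp_{2n}(O/λ^j)`, i.e. the symplectic matrices that reduce to the identity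
matrix modulo `λ^j`. -/
noncomputable def spCongruence {O : Type*} [CommRing O] (n : ℕ) (I : Ideal O) (j : ℕ) :
    Subgroup (Matrix.symplecticGroup (Fin n) O) where
  carrier := {g | ((g : Matrix (Fin n ⊕ Fin n) (Fin n ⊕ Fin n) O)).map
      (Ideal.Quotient.mk (I ^ j)) = 1}
  one_mem' := by
    exact Matrix.map_one (Ideal.Quotient.mk (I ^ j) : _ → _) (map_zero _) (map_one _)
  mul_mem' := by
    intro a b ha hb
    simp only [Set.mem_setOf_eq, Submonoid.coe_mul] at *
    rw [Matrix.map_mul, ha, hb, one_mul]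
  inv_mem' := by
    intro a ha
    simp only [Set.mem_setOf_eq] at *
    have h := congrArg (fun M : Matrix.symplecticGroup (Fin n) O =>
      ((M : Matrix (Fin n ⊕ Fin n) (Fin n ⊕ Fin n) O)).map (Ideal.Quotient.mk (I ^ j)))
      (inv_mul_cancel a)
    simp only [Submonoid.coe_mul, OneMemClass.coe_one, Matrix.map_mul,
      Matrix.map_one _ (map_zero _) (map_one _), ha, mul_one] at h
    exact h

set_option linter.unusedSectionVars false

namespace SpAux

section BigCell

open Matrix SymplecticGroup

variable {l R : Type*} [DecidableEq l] [Fintype l] [CommRing R]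

/-- Given square matrices `A` and `C` over a field, if the only vector annihilated by both of
them is 0, and `Aᵀ * C = Cᵀ * A`, then one can construct a symmetric matrix `X` such that
`A + X * C` is invertible.

This lemma, together with the one after, is used to turn the upper-left block into invertible
matrix in the main proof, so that we can use the previous lemma to calculate the determinant. -/
lemma exists_symmetric_X_invertible_add_mul_of_ker_inter_eq_bot {R : Type*} [Field R]
    {A C : Matrix l l R} (hker : ∀ (x : l → R), (A • x = 0) → (C • x = 0) → x = 0)
    (hsymm : Aᵀ * C = Cᵀ * A) :
    ∃ (X : Matrix l l R), X.IsSymm ∧ IsUnit (A + X * C) := by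
  -- `C` is transformed into `P = fromBlocks 1 0 0 0` by invertible matrices `V` and `U`.
  rcases exists_rank_normal_form C with ⟨V, U, s, hV, hU, heq⟩
  set P := V * C * U with P_def; set Q := Vᵀ⁻¹ * A * U with Q_def
  set f := fun (x : Matrix l l R) ↦ x.submatrix s.symm s.symm
  have hf (x) : f x = x.submatrix s.symm s.symm := rfl
  have f_unit {x} : IsUnit x → IsUnit (f x) := (isUnit_submatrix_equiv ..).2
  have f_mul (x y) : f (x * y) = f x * f y := submatrix_mul _ _ _ _ _ s.symm.bijective
  have _ : Invertible V := hV.invertible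
  have _ : Invertible U := hU.invertible
  have _ : Invertible (f Vᵀ) := (f_unit (V.isUnit_transpose.2 hV)).invertible
  -- The hypothesis that the only vector annihilated by both matrices is 0, holds for `P` and `Q`.
  have con1 (x : Fin C.rank ⊕ Fin (Fintype.card l - C.rank) → R)
      (heq1 : (f Q) • x = 0) (heq2 : (f P) • x = 0) : x = 0 := by
    refine (f_unit hU).smul_left_cancel.1 ?_
    rw [f_mul, f_mul, mul_assoc, mul_smul, IsUnit.smul_eq_zero, mul_smul, hf,
      smul_eq_mulVec, submatrix_mulVec_equiv, Equiv.symm_symm] at heq1 heq2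
    · rw [Equiv.comp_symm_eq, Pi.zero_comp] at heq1 heq2
      exact s.surjective.injective_comp_right <| by simpa using hker _ heq1 heq2
    · exact f_unit hV
    · exact f_unit <| isUnit_nonsing_inv_iff.2 <| V.isUnit_transpose.2 hV
  -- The symmetry relation also holds for `P` and `Q`.
  have con2 : Qᵀ * P = Pᵀ * Q := by
    simp only [P_def, mul_assoc, transpose_mul, transpose_nonsing_inv, transpose_transpose, Q_def,
      inv_mul_cancel_left_of_invertible, mul_inv_cancel_left_of_invertible]
    rw [← mul_assoc Aᵀ, hsymm, mul_assoc]
  replace con2 : (f Q).toBlocks₁₁ᵀ = (f Q).toBlocks₁₁ ∧ (f Q).toBlocks₁₂ = 0 := by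
    apply_fun reindex s s at con2
    rw [reindex_apply, reindex_apply, ← hf, ← hf, f_mul, f_mul Pᵀ, heq, hf,
      ← transpose_submatrix, ← hf Q, ← (f Q).fromBlocks_toBlocks, hf (_)ᵀ, hf
      ((fromBlocks 1 0 0 0).submatrix _ _)] at con2
    simp [fromBlocks_transpose, fromBlocks_multiply] at con2; tauto
  -- The lower-right block of `Q` is invertible.
  have con3 : IsUnit (f Q).toBlocks₂₂ := by
    refine mulVec_injective_iff_isUnit.1 ?_
    rw [← coe_mulVecLin, ← LinearMap.ker_eq_bot]
    refine ker_mulVecLin_eq_bot_iff.2 fun x hx ↦ Sum.elim_injective' <|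
      (con1 _ ?_ ?_).trans Sum.elim_zero_zero.symm
    · rw [← (f Q).fromBlocks_toBlocks]; simp [hx, con2.2, fromBlocks_mulVec]
    · simp [hf, heq, fromBlocks_mulVec]
  set Y : Matrix (Fin C.rank ⊕ Fin (Fintype.card l - C.rank)) (Fin C.rank ⊕
    Fin (Fintype.card l - C.rank)) R := fromBlocks (1 - (f Q).toBlocks₁₁) 0 0 0 with Y_def
  have hY_symm : Y.IsSymm := by
    rw [Y_def, isSymm_fromBlocks_iff]
    exact ⟨IsSymm.sub isSymm_one con2.1, by simp⟩
  -- We now take `X = Vᵀ * Y * V` and this gives the desired matrix `X.submatrix s s`.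
  set X := (f Vᵀ) * Y * (f V) with X_def
  refine ⟨X.submatrix s s, IsSymm.submatrix ?_ s, (isUnit_submatrix_equiv s.symm s.symm).1 ?_⟩
  · simp_rw [X_def, Matrix.IsSymm, transpose_mul, hY_symm.eq, hf, transpose_submatrix,
      transpose_transpose, mul_assoc]
  · have heq' : f (A + X.submatrix s s * C) = (f Vᵀ) * (f Q + Y * (f P)) * f (U⁻¹) := by
      simp_rw [hf, submatrix_add, Pi.add_apply, Q_def, P_def, ← hf, f_mul, hf, mul_add, ← mul_assoc,
        ← inv_submatrix_equiv, add_mul, mul_assoc _ (U.submatrix _ _), mul_inv_of_invertible]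
      simp [X_def]; rfl
    rw [← hf, heq', IsUnit.mul_iff, IsUnit.mul_iff]
    refine ⟨⟨isUnit_of_invertible _, ?_⟩, ?_⟩
    · nth_rw 1 [Y_def, heq, ← (f Q).fromBlocks_toBlocks, con2.2]
      simpa [hf, fromBlocks_multiply, fromBlocks_add]
    · exact f_unit <| isUnit_nonsing_inv_iff.2 hU

/-- For any symplectic matrix `fromBlocks A B C D` over a local ring `R`, we can construct
a symmetric `X` s.t. `A + X * C` is invertible.

Introducing local ring hypothesis enables us to transport the construction of `X`
(from the previous lemma, which works only over fields) back to `R` while keeping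
`A + X * C` invertible. -/
lemma exists_symmetric_X_isUnit_det_add_mul_of_symplectic [IsLocalRing R]
    {A B C D : Matrix l l R}
    (hA : fromBlocks A B C D ∈ symplecticGroup l R) :
    ∃ (X : Matrix l l R), X.IsSymm ∧ IsUnit (A + X * C).det := by
  -- We utilize the previous result on field by mapping the symplectic matrix to residue field.
  set k := IsLocalRing.ResidueField R; set f := IsLocalRing.residue R
  set A' := f.mapMatrix A; set C' := f.mapMatrix C
  set F' := fromBlocks A' (f.mapMatrix B) C' (f.mapMatrix D) with F'_def
  have hF' : IsUnit F' := by
    refine F'.isUnit_iff_isUnit_det.2 ?_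
    convert (symplectic_det hA).map f
    rw [RingHom.map_det, RingHom.mapMatrix_apply, Matrix.fromBlocks_map]; rfl
  have hker (x : l → k) (hx1 : A' *ᵥ x = 0) (hx2 : C' *ᵥ x = 0) : x = 0 := by
    have hv0 : F' *ᵥ (Sum.elim x 0) = F' *ᵥ (Sum.elim 0 0) := by
      simp [fromBlocks_mulVec, hx1, hx2, F'_def]
    exact (Sum.elim_eq_iff.1 (mulVec_injective_iff_isUnit.2 hF' hv0)).1
  -- Now we have a symmetric matrix `Y` over the residue field s.t. `A' + Y * C'` is invertible
  -- where `A'` and `C'` are images of `A` and `C` under quotient map from `R` to its residue field.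
  obtain ⟨Y, hY_symm, hY_det⟩ :=
    exists_symmetric_X_invertible_add_mul_of_ker_inter_eq_bot hker <| by
      change f.mapMatrix Aᵀ * f.mapMatrix C = f.mapMatrix Cᵀ * f.mapMatrix A
      rw [← map_mul, (fromBlocks_mem_iff.1 hA).1, map_mul]
  -- Lift `Y` back to the ring `R` and we have the `X` we need.
  obtain ⟨X, hX_symm, hXY⟩ : ∃ X : Matrix l l R, X.IsSymm ∧ X.map f = Y := by
    choose s hs using @IsLocalRing.residue_surjective R _ _
    exact ⟨Y.map s, hY_symm.map s, Matrix.ext fun i j ↦ hs (Y i j)⟩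
  refine ⟨X, hX_symm, (IsLocalRing.residue_ne_zero_iff_isUnit _).1 ?_⟩
  -- Ensure `A + X * C` is still invertible in `R`.
  rw [RingHom.map_det, map_add, map_mul, RingHom.mapMatrix_apply _ X, hXY]
  exact ((isUnit_iff_isUnit_det _).1 hY_det).ne_zero

end BigCell


section Elem

open Matrix SymplecticGroup

variable {ι R : Type*} [DecidableEq ι] [Fintype ι] [CommRing R]

/-- Upper unipotent element. -/
def Uu (X : Matrix ι ι R) (hX : X.IsSymm) : symplecticGroup ι R :=
  ⟨fromBlocks 1 X 0 1, by rw [fromBlocks_mem_iff]; simp [hX.eq]⟩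

/-- Lower unipotent element. -/
def Ll (X : Matrix ι ι R) (hX : X.IsSymm) : symplecticGroup ι R :=
  ⟨fromBlocks 1 0 X 1, by rw [fromBlocks_mem_iff]; simp [hX.eq]⟩

/-- Levi element. -/
def Dd (E F : Matrix ι ι R) (h : E * F = 1) : symplecticGroup ι R :=
  ⟨fromBlocks E 0 0 Fᵀ, by
    rw [fromBlocks_mem_iff]; simp [← transpose_mul, mul_eq_one_comm.1 h]⟩

lemma Uu_congr {X Y : Matrix ι ι R} (h : X = Y) (hX : X.IsSymm) (hY : Y.IsSymm) :
    Uu X hX = Uu Y hY := by subst h; rfl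

lemma Ll_congr {X Y : Matrix ι ι R} (h : X = Y) (hX : X.IsSymm) (hY : Y.IsSymm) :
    Ll X hX = Ll Y hY := by subst h; rfl

lemma Dd_congr {E F E' F' : Matrix ι ι R} (h : E = E') (h1 : E * F = 1) (h2 : E' * F' = 1) :
    Dd E F h1 = Dd E' F' h2 := by
  subst h
  have : F = F' := by
    have h3 := mul_eq_one_comm.1 h1
    calc F = F * (E * F') := by rw [h2, mul_one]
      _ = F' := by rw [← mul_assoc, h3, one_mul]
  subst this; rfl

lemma Uu_mul (X Y : Matrix ι ι R) (hX : X.IsSymm) (hY : Y.IsSymm) :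
    Uu X hX * Uu Y hY = Uu (X + Y) (hX.add hY) := by
  apply Subtype.ext
  simp [Uu, fromBlocks_multiply, add_comm]

lemma Ll_mul (X Y : Matrix ι ι R) (hX : X.IsSymm) (hY : Y.IsSymm) :
    Ll X hX * Ll Y hY = Ll (X + Y) (hX.add hY) := by
  apply Subtype.ext
  simp [Ll, fromBlocks_multiply]

lemma Dd_mul (E F E' F' : Matrix ι ι R) (h : E * F = 1) (h' : E' * F' = 1) :
    Dd E F h * Dd E' F' h' = Dd (E * E') (F' * F)
      (by rw [mul_assoc, ← mul_assoc E', h', one_mul, h]) := by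
  apply Subtype.ext
  simp [Dd, fromBlocks_multiply]

lemma Uu_zero (h : (0 : Matrix ι ι R).IsSymm) : Uu (0 : Matrix ι ι R) h = 1 := by
  apply Subtype.ext; simp [Uu]

lemma Ll_zero (h : (0 : Matrix ι ι R).IsSymm) : Ll (0 : Matrix ι ι R) h = 1 := by
  apply Subtype.ext; simp [Ll]

lemma Dd_one (h : (1 : Matrix ι ι R) * 1 = 1) : Dd (1 : Matrix ι ι R) 1 h = 1 := by
  apply Subtype.ext; simp [Dd]

lemma Uu_neg (X : Matrix ι ι R) (hX : X.IsSymm) (hX' : (-X).IsSymm) : Uu (-X) hX' = (Uu X hX)⁻¹ := by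
  rw [eq_inv_iff_mul_eq_one, Uu_mul, ← Uu_zero (by simp)]
  exact Uu_congr (by simp) _ _

lemma Ll_neg (X : Matrix ι ι R) (hX : X.IsSymm) (hX' : (-X).IsSymm) : Ll (-X) hX' = (Ll X hX)⁻¹ := by
  rw [eq_inv_iff_mul_eq_one, Ll_mul, ← Ll_zero (by simp)]
  exact Ll_congr (by simp) _ _

lemma smul_symm (r : R) {X : Matrix ι ι R} (hX : X.IsSymm) : (r • X).IsSymm := hX.smul r

lemma Uu_pow (X : Matrix ι ι R) (hX : X.IsSymm) (m : ℕ) :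
    Uu X hX ^ m = Uu ((m : R) • X) (smul_symm _ hX) := by
  induction m with
  | zero => rw [pow_zero, ← Uu_zero (by simp)]; exact Uu_congr (by simp) _ _
  | succ k ih => rw [pow_succ, ih, Uu_mul]; exact Uu_congr (by simp [add_smul]) _ _

lemma Ll_pow (X : Matrix ι ι R) (hX : X.IsSymm) (m : ℕ) :
    Ll X hX ^ m = Ll ((m : R) • X) (smul_symm _ hX) := by
  induction m with
  | zero => rw [pow_zero, ← Ll_zero (by simp)]; exact Ll_congr (by simp) _ _
  | succ k ih => rw [pow_succ, ih, Ll_mul]; exact Ll_congr (by simp [add_smul]) _ _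

lemma conj_symm (E : Matrix ι ι R) {X : Matrix ι ι R} (hX : X.IsSymm) : (E * X * Eᵀ).IsSymm := by
  simp [Matrix.IsSymm, transpose_mul, hX.eq, mul_assoc]

lemma conj_symm' (E : Matrix ι ι R) {X : Matrix ι ι R} (hX : X.IsSymm) : (Eᵀ * X * E).IsSymm := by
  simp [Matrix.IsSymm, transpose_mul, hX.eq, mul_assoc]

lemma Dd_Uu (E F : Matrix ι ι R) (h : E * F = 1) (X : Matrix ι ι R) (hX : X.IsSymm) :
    Dd E F h * Uu X hX = Uu (E * X * Eᵀ) (conj_symm E hX) * Dd E F h := by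
  apply Subtype.ext
  have : Eᵀ * Fᵀ = 1 := by rw [← transpose_mul, mul_eq_one_comm.1 h, transpose_one]
  simp [Dd, Uu, fromBlocks_multiply, mul_assoc, this]

lemma Dd_Ll (E F : Matrix ι ι R) (h : E * F = 1) (X : Matrix ι ι R) (hX : X.IsSymm) :
    Dd E F h * Ll X hX = Ll (Fᵀ * X * F) (conj_symm' F hX) * Dd E F h := by
  apply Subtype.ext
  simp [Dd, Ll, fromBlocks_multiply, mul_assoc, mul_eq_one_comm.1 h]

lemma J_Uu (X : Matrix ι ι R) (hX : X.IsSymm) :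
    symJ ι R * Uu X hX = Ll (-X) hX.neg * symJ ι R := by
  apply Subtype.ext
  simp [Uu, Ll, J, fromBlocks_multiply]

/-- The `LDU` decomposition. -/
lemma ldu (g : symplecticGroup ι R) (A B C D F : Matrix ι ι R) (hg : g.1 = fromBlocks A B C D)
    (hF : A * F = 1) : ∃ (hY : (C * F).IsSymm) (hZ : (F * B).IsSymm),
      g = Ll (C * F) hY * Dd A F hF * Uu (F * B) hZ := by
  have hF' := mul_eq_one_comm.1 hF
  have h1 : fromBlocks A B C D ∈ symplecticGroup ι R := hg ▸ g.2
  have h2 := transpose_mem h1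
  rw [fromBlocks_transpose, fromBlocks_mem_iff] at h2
  obtain ⟨h2, -, -⟩ := h2
  obtain ⟨h3, -, h4⟩ := fromBlocks_mem_iff.1 h1
  have hFt : Fᵀ * Aᵀ = 1 := by rw [← transpose_mul, hF, transpose_one]
  have hAt : Aᵀ * Fᵀ = 1 := by rw [← transpose_mul, hF', transpose_one]
  simp only [transpose_transpose] at h2
  have hY : (C * F).IsSymm := by
    have : Fᵀ * (Aᵀ * C) * F = Fᵀ * (Cᵀ * A) * F := by rw [h3]
    rw [← mul_assoc, hFt, one_mul, mul_assoc, mul_assoc, hF, mul_one] at this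
    rw [Matrix.IsSymm, transpose_mul, this]
  have hZ : (F * B).IsSymm := by
    have : F * (A * Bᵀ) * Fᵀ = F * (B * Aᵀ) * Fᵀ := by rw [h2]
    rw [← mul_assoc, hF', one_mul, mul_assoc, mul_assoc, hAt, mul_one] at this
    rw [Matrix.IsSymm, transpose_mul, this]
  refine ⟨hY, hZ, Subtype.ext ?_⟩
  rw [hg]
  have e1 : C * (F * A) = C := by rw [hF', mul_one]
  have e2 : A * (F * B) = B := by rw [← mul_assoc, hF, one_mul]
  have e3 : D = C * (F * B) + Fᵀ := by
    have h5 : Fᵀ * (Aᵀ * D - Cᵀ * B) = Fᵀ := by rw [h4, mul_one]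
    rw [mul_sub, ← mul_assoc, hFt, one_mul, ← mul_assoc Fᵀ, ← transpose_mul, hY.eq, mul_assoc] at h5
    rw [← h5]; abel
  simp only [Ll, Dd, Uu, Submonoid.coe_mul, fromBlocks_multiply]
  simp [mul_assoc, e2, ← e3, hF']

variable {G : Type*} [Group G] (ψ : symplecticGroup ι R →* G)

lemma psi_Ll_of (X : Matrix ι ι R) (hX : X.IsSymm) (h : ψ (Uu X hX) = 1) : ψ (Ll X hX) = 1 := by
  have h1 := congrArg ψ (J_Uu X hX)
  rw [map_mul, map_mul, h, mul_one, right_eq_mul, Ll_neg X hX, map_inv, inv_eq_one] at h1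
  exact h1

lemma psi_Uu_of (X : Matrix ι ι R) (hX : X.IsSymm) (h : ψ (Ll X hX) = 1) : ψ (Uu X hX) = 1 := by
  have h1 := congrArg ψ (J_Uu X hX)
  rw [map_mul, map_mul, Ll_neg X hX, map_inv, h, inv_one, one_mul, mul_eq_left] at h1
  exact h1

lemma ent_mul_left {I : Ideal R} (A B : Matrix ι ι R) (h : ∀ i j, B i j ∈ I) (i j : ι) :
    (A * B) i j ∈ I := by
  rw [Matrix.mul_apply]; exact I.sum_mem fun k _ => I.mul_mem_left _ (h _ _)

lemma ent_mul_right {I : Ideal R} (A B : Matrix ι ι R) (h : ∀ i j, A i j ∈ I) (i j : ι) :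
    (A * B) i j ∈ I := by
  rw [Matrix.mul_apply]; exact I.sum_mem fun k _ => I.mul_mem_right _ (h _ _)

lemma psi_Dd_XY (I : Ideal R)
    (hU : ∀ X (hX : X.IsSymm), (∀ i j, X i j ∈ I) → ψ (Uu X hX) = 1)
    (X Y E F : Matrix ι ι R) (hX : X.IsSymm) (hY : Y.IsSymm) (hXI : ∀ i j, X i j ∈ I)
    (hE : E = 1 + X * Y) (hF : E * F = 1) : ψ (Dd E F hF) = 1 := by
  obtain ⟨h1, h2, h3⟩ := ldu (Uu X hX * Ll Y hY) E X Y 1 F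
    (by simp [Uu, Ll, fromBlocks_multiply, hE]) hF
  have h4 : Y * F - Y = - (Y * (X * (Y * F))) := by
    have : F = 1 - X * (Y * F) := by
      rw [← hF, hE]; noncomm_ring
    nth_rewrite 1 [this]; noncomm_ring
  have h5 : ψ (Ll (Y * F) h1) = ψ (Ll Y hY) := by
    have hs : (Y * F - Y).IsSymm := h1.sub hY
    have : Ll (Y * F) h1 = Ll Y hY * Ll (Y * F - Y) hs := by
      rw [Ll_mul]; exact Ll_congr (by simp) _ _
    rw [this, map_mul, psi_Ll_of ψ _ hs, mul_one]
    apply hU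
    rw [h4]
    intro i j
    rw [Matrix.neg_apply]
    exact I.neg_mem (ent_mul_left _ _ (ent_mul_right _ _ hXI) i j)
  have h6 := congrArg ψ h3
  rw [map_mul, map_mul, map_mul, h5, hU X hX hXI,
    hU (F * X) h2 (ent_mul_left _ _ hXI), one_mul, mul_one, left_eq_mul] at h6
  exact h6

/-- Gaussian elimination for the congruence subgroup. -/
lemma psi_Dd_cong [IsLocalRing R] (I : Ideal R)
    (hU : ∀ X (hX : X.IsSymm), (∀ i j, X i j ∈ I) → ψ (Uu X hX) = 1)
    (I' : Ideal R) (hI' : I' ≤ I) (hm : I' ≤ IsLocalRing.maximalIdeal R) (s : Finset ι) :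
    ∀ (A F : Matrix ι ι R) (hF : A * F = 1), (∀ i j, (A - 1) i j ∈ I') →
      (∀ j, j ∉ s → ∀ i, A i j = (1 : Matrix ι ι R) i j) → ψ (Dd A F hF) = 1 := by
  induction s using Finset.induction_on with
  | empty =>
    intro A F hF hA hj
    have : A = 1 := by ext i j; exact hj j (by simp) i
    rw [Dd_congr this hF (one_mul 1), Dd_one, map_one]
  | insert k s hk ih =>
    intro A F hF hA hj
    set w : ι → R := fun i => (A - 1) i k with hw
    have hwI : ∀ i, w i ∈ I' := fun i => hA i k
    set X : Matrix ι ι R := Matrix.of fun i j =>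
      if j = k then w i else if i = k then w j else 0 with hXdef
    have hX : X.IsSymm := by
      ext i j; simp only [hXdef, transpose_apply, of_apply]; split_ifs <;> simp_all
    have hXI : ∀ i j, X i j ∈ I := by
      intro i j; simp only [hXdef, of_apply]; split_ifs
      · exact hI' (hwI _)
      · exact hI' (hwI _)
      · exact I.zero_mem
    set Y : Matrix ι ι R := Matrix.single k k 1 with hYdef
    have hY : Y.IsSymm := by simp [Matrix.IsSymm, hYdef]
    set E := 1 + X * Y with hE
    have hXY : ∀ i j, (X * Y) i j = if j = k then w i else 0 := by
      intro i j
      by_cases h : j = k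
      · subst h; simp [hYdef, hXdef]
      · simp [hYdef, h, Matrix.mul_apply, Matrix.single_apply, Ne.symm h]
    have hu : IsUnit (1 + w k) := by
      by_contra hc
      have h1 : 1 + w k ∈ IsLocalRing.maximalIdeal R := hc
      have h2 := Ideal.sub_mem _ h1 (hm (hwI k))
      simp at h2
    obtain ⟨v, hv⟩ := hu.exists_left_inv
    set F' : Matrix ι ι R := 1 - v • (X * Y) with hF'
    have hsq : (X * Y) * (X * Y) = w k • (X * Y) := by
      ext i j
      rw [Matrix.mul_apply]
      simp [hXY, mul_comm]
    have hEF : E * F' = 1 := by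
      have h0 : E * F' = 1 + (1 - v * (1 + w k)) • (X * Y) := by
        rw [hE, hF', mul_sub, mul_one, mul_smul_comm, add_mul, one_mul, hsq]
        module
      rw [h0, hv]; simp
    have hFE := mul_eq_one_comm.1 hEF
    have hA' : (F' * A) * (F * E) = 1 := by
      rw [mul_assoc, ← mul_assoc A, hF, one_mul, hFE]
    have key : ψ (Dd (F' * A) (F * E) hA') = 1 := by
      apply ih
      · intro i j
        have : F' * A - 1 = F' * ((A - 1) - X * Y) := by
          rw [mul_sub, mul_sub, ← sub_eq_zero]
          have : F' * (X * Y) = F' * E - F' := by rw [hE]; noncomm_ring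
          rw [this, hFE]; noncomm_ring
        rw [this]
        refine ent_mul_left _ _ (fun i j => ?_) i j
        rw [Matrix.sub_apply, hXY]
        refine I'.sub_mem (hA i j) ?_
        split_ifs
        · exact hwI i
        · exact I'.zero_mem
      · intro j hjs i
        rw [← hFE, Matrix.mul_apply, Matrix.mul_apply]
        refine Finset.sum_congr rfl fun t _ => ?_
        congr 1
        rw [hE, Matrix.add_apply, hXY]
        by_cases h : j = k
        · subst h; simp [hw]
        · rw [if_neg h, add_zero]; exact hj j (by simp [h, hjs]) t
    have : Dd A F hF = Dd E F' hEF * Dd (F' * A) (F * E) hA' := by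
      rw [Dd_mul]; exact Dd_congr (by rw [← mul_assoc, hEF, one_mul]) _ _
    rw [this, map_mul, key, mul_one]
    exact psi_Dd_XY ψ I hU X Y E F' hX hY hXI hE hEF

/-- `ψ` kills the congruence subgroup once it kills the unipotent parts. -/
lemma psi_cong [IsLocalRing R] (I : Ideal R)
    (hU : ∀ X (hX : X.IsSymm), (∀ i j, X i j ∈ I) → ψ (Uu X hX) = 1)
    (I' : Ideal R) (hI' : I' ≤ I) (hm : I' ≤ IsLocalRing.maximalIdeal R)
    (g : symplecticGroup ι R) (hg : ∀ i j, (g.1 - 1) i j ∈ I') : ψ g = 1 := by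
  obtain ⟨A, B, C, D, hgb⟩ : ∃ A B C D, g.1 = fromBlocks A B C D :=
    ⟨_, _, _, _, (fromBlocks_toBlocks g.1).symm⟩
  rw [hgb] at hg
  have hA : ∀ i j, (A - 1) i j ∈ I' := fun i j => by
    have := hg (.inl i) (.inl j)
    simpa [Matrix.one_apply] using this
  have hB : ∀ i j, B i j ∈ I' := fun i j => by
    simpa [Matrix.one_apply] using hg (.inl i) (.inr j)
  have hC : ∀ i j, C i j ∈ I' := fun i j => by
    simpa [Matrix.one_apply] using hg (.inr i) (.inl j)
  have hdet : IsUnit A.det := by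
    rw [← IsLocalRing.residue_ne_zero_iff_isUnit, RingHom.map_det]
    have : (IsLocalRing.residue R).mapMatrix A = 1 := by
      ext i j
      have h := (IsLocalRing.residue_eq_zero_iff _).2 (hm (hA i j))
      rw [Matrix.sub_apply, map_sub, sub_eq_zero] at h
      rw [RingHom.mapMatrix_apply, Matrix.map_apply, h, Matrix.one_apply, Matrix.one_apply]
      split_ifs <;> simp
    rw [this]; simp
  obtain ⟨h1, h2, h3⟩ := ldu g A B C D A⁻¹ hgb (mul_nonsing_inv _ hdet)
  rw [h3, map_mul, map_mul, psi_Dd_cong ψ I hU I' hI' hm Finset.univ _ _ _ hA (by simp),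
    psi_Ll_of ψ _ _ (hU _ h1 fun i j => hI' (ent_mul_right _ _ hC i j)),
    hU _ h2 fun i j => hI' (ent_mul_left _ _ hB i j)]
  simp


lemma psi_Dd_all [IsLocalRing R] (hU : ∀ X (hX : X.IsSymm), ψ (Uu X hX) = 1)
    (A F : Matrix ι ι R) (hF : A * F = 1) : ψ (Dd A F hF) = 1 := by
  set f := IsLocalRing.residue R with hf
  have hUtop : ∀ X (hX : X.IsSymm), (∀ i j, X i j ∈ (⊤ : Ideal R)) → ψ (Uu X hX) = 1 :=
    fun X hX _ => hU X hX
  have hfs := @IsLocalRing.residue_surjective R _ _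
  have key : ∃ (A' F' : Matrix ι ι R) (h : A' * F' = 1),
      f.mapMatrix A' = f.mapMatrix A ∧ ψ (Dd A' F' h) = 1 := by
    have hdet : (f.mapMatrix A).det ≠ 0 := by
      intro h0
      have h1 : (f.mapMatrix A) * (f.mapMatrix F) = 1 := by rw [← map_mul, hF, map_one]
      have h2 := congrArg Matrix.det h1
      rw [det_mul, h0, zero_mul, det_one] at h2
      exact zero_ne_one h2
    refine diagonal_transvection_induction_of_det_ne_zero
      (fun M => ∃ (A' F' : Matrix ι ι R) (h : A' * F' = 1),
        f.mapMatrix A' = M ∧ ψ (Dd A' F' h) = 1) _ hdet ?_ ?_ ?_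
    · intro d hd
      choose e he using fun i => hfs (d i)
      have hu : ∀ i, IsUnit (e i) := by
        intro i
        rw [← IsLocalRing.residue_ne_zero_iff_isUnit, he]
        rw [det_diagonal] at hd
        exact Finset.prod_ne_zero_iff.1 hd i (Finset.mem_univ i)
      choose v hv using fun i => (hu i).exists_right_inv
      have h1 : (diagonal e : Matrix ι ι R) * diagonal v = 1 := by
        rw [diagonal_mul_diagonal]; simp [hv]
      refine ⟨diagonal e, diagonal v, h1, ?_, ?_⟩
      · rw [RingHom.mapMatrix_apply, diagonal_map (map_zero f)]
        congr 1; funext i; exact he i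
      · refine psi_Dd_XY ψ ⊤ hUtop (diagonal fun i => e i - 1) 1 _ _
          (by simp [Matrix.IsSymm]) (by simp [Matrix.IsSymm]) (by simp) ?_ h1
        rw [mul_one, ← diagonal_one, diagonal_add]
        congr 1; funext i; simp
    · intro t
      obtain ⟨c, hc⟩ := hfs t.c
      have h1 : transvection t.i t.j c * transvection t.i t.j (-c) = 1 := by
        rw [transvection_mul_transvection_same _ _ t.hij]; simp
      refine ⟨transvection t.i t.j c, transvection t.i t.j (-c), h1, ?_, ?_⟩
      · rw [TransvectionStruct.toMatrix, transvection, transvection, map_add, map_one, ← hc]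
        congr 1
        ext i j
        simp only [RingHom.mapMatrix_apply, Matrix.map_apply, Matrix.single_apply, hf]
        split_ifs <;> simp
      · refine psi_Dd_XY ψ ⊤ hUtop (Matrix.single t.i t.j 1 + Matrix.single t.j t.i 1)
          (Matrix.single t.j t.j c) _ _ ?_ ?_ (by simp) ?_ h1
        · simp [Matrix.IsSymm, add_comm]
        · simp [Matrix.IsSymm]
        · rw [transvection, add_mul, single_mul_single_same, single_mul_single_of_ne (h := t.hij),
            add_zero, one_mul]
    · rintro M N - - ⟨A1, F1, h1, rfl, e1⟩ ⟨A2, F2, h2, rfl, e2⟩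
      refine ⟨A1 * A2, F2 * F1, ?_, map_mul _ _ _, ?_⟩
      · rw [mul_assoc, ← mul_assoc A2, h2, one_mul, h1]
      · rw [← Dd_mul _ _ _ _ h1 h2, map_mul, e1, e2, one_mul]
  obtain ⟨A', F', h, hA, hψ⟩ := key
  have h' := mul_eq_one_comm.1 h
  have hFA : (F' * A) * (F * A') = 1 := by
    rw [mul_assoc, ← mul_assoc A, hF, one_mul, h']
  have : Dd A F hF = Dd A' F' h * Dd (F' * A) (F * A') hFA := by
    rw [Dd_mul]; exact Dd_congr (by rw [← mul_assoc, h, one_mul]) _ _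
  rw [this, map_mul, hψ, one_mul]
  refine psi_Dd_cong ψ ⊤ hUtop (IsLocalRing.maximalIdeal R) le_top le_rfl Finset.univ _ _ _ ?_
    (by simp)
  intro i j
  rw [← IsLocalRing.residue_eq_zero_iff, ← hf]
  have h2 : f.mapMatrix (F' * A - 1) = 0 := by
    rw [map_sub, map_mul, ← hA, ← map_mul, h', sub_self]
  exact congrFun (congrFun h2 i) j

lemma exists_ldu [IsLocalRing R] (g : symplecticGroup ι R) :
    ∃ (X : Matrix ι ι R) (hX : X.IsSymm) (A B C D F : Matrix ι ι R) (_ : A * F = 1),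
      (Uu X hX * g).1 = fromBlocks A B C D := by
  have hg := (fromBlocks_toBlocks g.1)
  obtain ⟨X, hX, hu⟩ := exists_symmetric_X_isUnit_det_add_mul_of_symplectic (hg ▸ g.2)
  refine ⟨X, hX, _, g.1.toBlocks₁₂ + X * g.1.toBlocks₂₂, g.1.toBlocks₂₁, g.1.toBlocks₂₂, _,
    mul_nonsing_inv _ hu, ?_⟩
  rw [Submonoid.coe_mul, Uu]
  nth_rewrite 1 [← hg]
  rw [fromBlocks_multiply]
  simp only [one_mul, zero_mul, zero_add]

lemma psi_gen [IsLocalRing R] (hU : ∀ X (hX : X.IsSymm), ψ (Uu X hX) = 1) : ψ = 1 := by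
  ext g
  obtain ⟨X, hX, A, B, C, D, F, hF, h⟩ := exists_ldu g
  obtain ⟨h1, h2, h3⟩ := ldu _ A B C D F h hF
  have h4 := congrArg ψ h3
  rw [map_mul, map_mul, map_mul, hU, hU, psi_Ll_of ψ _ _ (hU _ h1), psi_Dd_all ψ hU] at h4
  simpa using h4

/-- Conjugation by the scalar torus element `2`. -/
lemma exists_t (v : R) (hv : 2 * v = 1) : ∃ t : symplecticGroup ι R,
    (∀ (X : Matrix ι ι R) (hX : X.IsSymm), t * Uu X hX = Uu ((4 : R) • X) (smul_symm _ hX) * t) ∧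
    (∀ (X : Matrix ι ι R) (hX : X.IsSymm), t * Ll X hX = Ll ((v * v) • X) (smul_symm _ hX) * t) ∧
    (∀ (E F : Matrix ι ι R) (h : E * F = 1), t * Dd E F h = Dd E F h * t) := by
  have h2 : ((2 : R) • (1 : Matrix ι ι R)) * (v • 1) = 1 := by simp [smul_smul, mul_comm v, hv]
  refine ⟨Dd ((2 : R) • 1) (v • 1) h2, ?_, ?_, ?_⟩
  · intro X hX
    rw [Dd_Uu]; congr 1
    refine Uu_congr ?_ _ _
    simp only [smul_mul_assoc, one_mul, transpose_smul, transpose_one, mul_smul_comm, mul_one,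
      smul_smul]
    norm_num
  · intro X hX
    rw [Dd_Ll]; congr 1
    refine Ll_congr ?_ _ _
    simp only [smul_mul_assoc, one_mul, transpose_smul, transpose_one, mul_smul_comm, mul_one,
      smul_smul]
  · intro E F h
    rw [Dd_mul, Dd_mul]
    exact Dd_congr (by simp) _ _

lemma psi_ldu (v : R) (hv : 2 * v = 1) (Y Z E F : Matrix ι ι R) (hY : Y.IsSymm) (hZ : Z.IsSymm)
    (hF : E * F = 1) (h : ψ (Ll Y hY * Dd E F hF * Uu Z hZ) = 1) :
    ψ (Uu ((45 : R) • Z) (smul_symm _ hZ)) = 1 ∧ ψ (Uu ((45 : R) • Y) (smul_symm _ hY)) = 1 := by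
  obtain ⟨t, tU, tL, tD⟩ := exists_t (ι := ι) v hv
  have hv4 : 4 * (v * v) = 1 := by linear_combination (1 + 2 * v) * hv
  -- step 1
  have e1 : ψ (Ll ((v * v) • Y) (smul_symm _ hY) * Dd E F hF *
      Uu ((4 : R) • Z) (smul_symm _ hZ)) = 1 := by
    have : t * (Ll Y hY * Dd E F hF * Uu Z hZ) = (Ll ((v * v) • Y) (smul_symm _ hY) * Dd E F hF *
      Uu ((4 : R) • Z) (smul_symm _ hZ)) * t := by
      rw [← mul_assoc, ← mul_assoc, tL Y hY, mul_assoc _ t, tD E F hF, ← mul_assoc, mul_assoc _ t,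
        tU Z hZ, ← mul_assoc]
    have h2 := congrArg ψ this
    rw [map_mul, h, map_mul, mul_one, right_eq_mul] at h2
    exact h2
  have e2 : ψ (Ll ((v * v - 1) • Y) (smul_symm _ hY)) = ψ (Uu ((-3 : R) • Z) (smul_symm _ hZ)) := by
    have a1 : Ll ((v * v) • Y) (smul_symm _ hY) =
        Ll ((v * v - 1) • Y) (smul_symm _ hY) * Ll Y hY := by
      rw [Ll_mul]; exact Ll_congr (by module) _ _
    have a2 : Uu Z hZ = Uu ((4 : R) • Z) (smul_symm _ hZ) * Uu ((-3 : R) • Z) (smul_symm _ hZ) := by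
      rw [Uu_mul]; exact Uu_congr (by module) _ _
    rw [a1, mul_assoc, mul_assoc, map_mul] at e1
    rw [a2, ← mul_assoc, map_mul, mul_assoc] at h
    rw [eq_comm, ← inv_eq_of_mul_eq_one_right h, inv_eq_of_mul_eq_one_left e1]
  obtain ⟨Y1, hY1⟩ : ∃ Y1, (v * v - 1) • Y = Y1 := ⟨_, rfl⟩
  obtain ⟨Z1, hZ1⟩ : ∃ Z1, (-3 : R) • Z = Z1 := ⟨_, rfl⟩
  have sY1 : Y1.IsSymm := hY1 ▸ smul_symm _ hY
  have sZ1 : Z1.IsSymm := hZ1 ▸ smul_symm _ hZ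
  rw [Ll_congr hY1 _ sY1, Uu_congr hZ1 _ sZ1] at e2
  have e3 : ψ (Ll ((v * v) • Y1) (smul_symm _ sY1)) = ψ (Uu ((4 : R) • Z1) (smul_symm _ sZ1)) := by
    have b1 := congrArg ψ (tL Y1 sY1)
    have b2 := congrArg ψ (tU Z1 sZ1)
    rw [map_mul, map_mul] at b1 b2
    rw [← mul_left_inj (ψ t), ← b1, ← b2, e2]
  have p1 := congrArg (· ^ 4) e3
  simp only [← map_pow, Ll_pow, Uu_pow] at p1
  have p2 := congrArg (· ^ 4) e2
  simp only [← map_pow, Ll_pow, Uu_pow] at p2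
  have f1 : ψ (Uu ((15 : R) • Z1) (smul_symm _ sZ1)) = 1 := by
    have a1 : Ll (((4 : ℕ) : R) • (v * v) • Y1) (smul_symm _ (smul_symm _ sY1)) = Ll Y1 sY1 :=
      Ll_congr (by rw [smul_smul]; push_cast; rw [hv4, one_smul]) _ _
    rw [a1, e2] at p1
    have a2 : Uu (((4 : ℕ) : R) • (4 : R) • Z1) (smul_symm _ (smul_symm _ sZ1)) =
        Uu Z1 sZ1 * Uu ((15 : R) • Z1) (smul_symm _ sZ1) := by
      rw [Uu_mul]; refine Uu_congr ?_ _ _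
      push_cast; module
    rw [a2, map_mul, left_eq_mul] at p1
    exact p1
  have f2 : ψ (Ll ((4 - v * v) • Y1) (smul_symm _ sY1)) = 1 := by
    have a0 : Uu (((4 : ℕ) : R) • Z1) (smul_symm _ sZ1) = Uu ((4 : R) • Z1) (smul_symm _ sZ1) :=
      Uu_congr (by push_cast; rfl) _ _
    rw [a0, ← e3] at p2
    have a1 : Ll (((4 : ℕ) : R) • Y1) (smul_symm _ sY1) =
      Ll ((4 - v * v) • Y1) (smul_symm _ sY1) * Ll ((v * v) • Y1) (smul_symm _ sY1) := by
      rw [Ll_mul]; refine Ll_congr ?_ _ _; push_cast; module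
    rw [a1, map_mul, mul_eq_right] at p2
    exact p2
  constructor
  · have : Uu ((45 : R) • Z) (smul_symm _ hZ) = (Uu ((15 : R) • Z1) (smul_symm _ sZ1))⁻¹ := by
      rw [← Uu_neg _ _ (smul_symm _ sZ1).neg]
      refine Uu_congr ?_ _ _
      rw [← hZ1]; module
    rw [this, map_inv, f1, inv_one]
  · apply psi_Uu_of
    have : Ll ((45 : R) • Y) (smul_symm _ hY) = ((Ll ((4 - v * v) • Y1) (smul_symm _ sY1)) ^ 16)⁻¹ := by
      rw [Ll_pow, ← Ll_neg _ _ (smul_symm _ (smul_symm _ sY1)).neg]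
      refine Ll_congr ?_ _ _
      rw [← hY1, smul_smul, smul_smul, ← neg_smul]
      congr 1
      push_cast
      linear_combination (20 - 4 * (v * v) - 1) * hv4
    rw [this, map_inv, map_pow, f2, one_pow, inv_one]

/-- A non-scalar element in the kernel gives a nontrivial unipotent one. -/
lemma exists_Uu_of_nonscalar [IsLocalRing R] [IsDomain R] [CharZero R] [Nonempty ι]
    (v : R) (hv : 2 * v = 1)
    (g : symplecticGroup ι R) (hg : ψ g = 1) (hns : ¬ ∃ a : R, g.1 = Matrix.scalar (ι ⊕ ι) a) :
    ∃ (X : Matrix ι ι R) (hX : X.IsSymm), X ≠ 0 ∧ ψ (Uu X hX) = 1 := by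
  by_contra hcon
  push Not at hcon
  have hcon' : ∀ (X : Matrix ι ι R) (hX : X.IsSymm), ψ (Uu X hX) = 1 → X = 0 := by
    intro X hX h; by_contra h0; exact hcon X hX h0 h
  apply hns
  obtain ⟨X, hX, A, B, C, D, F, hF, h⟩ := exists_ldu g
  obtain ⟨h1, h2, h3⟩ := ldu _ A B C D F h hF
  have h4 : ψ (Ll (C * F) h1 * Dd A F hF * Uu (F * B + -X) (h2.add hX.neg)) = 1 := by
    rw [← Uu_mul _ _ h2 hX.neg, ← mul_assoc, ← h3, Uu_neg X hX, map_mul, map_mul, map_inv, hg,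
      mul_one, mul_inv_cancel]
  have h5 := psi_ldu ψ v hv _ _ _ _ h1 _ hF h4
  have h45 : (45 : R) ≠ 0 := by exact_mod_cast (by norm_num : (45 : ℕ) ≠ 0)
  have hZ := (smul_eq_zero_iff_right h45).1 (hcon' _ _ h5.1)
  have hY := (smul_eq_zero_iff_right h45).1 (hcon' _ _ h5.2)
  have h6 : ψ (Dd A F hF) = 1 := by
    rw [Ll_congr hY _ (by simp), Uu_congr hZ _ (by simp), Ll_zero, Uu_zero, one_mul, mul_one] at h4
    exact h4
  have h7 : ∀ S : Matrix ι ι R, S.IsSymm → A * S * Aᵀ = S := by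
    intro S hS
    have a1 := congrArg ψ (Dd_Uu A F hF S hS)
    rw [map_mul, map_mul, h6, one_mul, mul_one] at a1
    have a2 : ψ (Uu (A * S * Aᵀ + -S) ((conj_symm A hS).add hS.neg)) = 1 := by
      rw [← Uu_mul _ _ (conj_symm A hS) hS.neg, Uu_neg S hS, map_mul, map_inv, ← a1, mul_inv_cancel]
    have := hcon' _ _ a2
    rwa [← sub_eq_add_neg, sub_eq_zero] at this
  have hgeq : Uu X hX * g = Dd A F hF * Uu X hX := by
    rw [h3, Ll_congr hY _ (by simp), Ll_zero, one_mul]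
    congr 1
    exact Uu_congr (by rwa [← sub_eq_add_neg, sub_eq_zero] at hZ) _ _
  -- `A` is scalar
  have hdiag : ∀ i k, i ≠ k → A i k = 0 := by
    intro i k hik
    have := congrFun (congrFun (h7 (Matrix.single k k 1) (by simp [Matrix.IsSymm])) i) i
    have e : ∀ x, (A * Matrix.single k k (1 : R)) i x = if x = k then A i k else 0 := by
      intro x
      by_cases hx : x = k
      · subst hx; simp
      · simp [hx, Matrix.mul_apply, Ne.symm hx]
    rw [Matrix.mul_apply] at this
    simpa [e, Matrix.single_apply, Ne.symm hik] using this
  have hA : A = diagonal fun i => A i i := by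
    ext i j
    by_cases h : i = j
    · subst h; simp
    · rw [hdiag i j h, diagonal_apply_ne _ h]
  have hsq : ∀ i, A i i * A i i = 1 := by
    intro i
    have := congrFun (congrFun (h7 (Matrix.single i i 1) (by simp [Matrix.IsSymm])) i) i
    rw [hA] at this
    simpa using this
  have hprod : ∀ i j, A i i * A j j = 1 := by
    intro i j
    by_cases hij : i = j
    · subst hij; exact hsq i
    have := congrFun (congrFun (h7 (Matrix.single i j 1 + Matrix.single j i 1)
      (by simp [Matrix.IsSymm, add_comm])) i) j
    rw [hA] at this
    simpa [Matrix.single_apply, hij, Ne.symm hij] using this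
  obtain ⟨i0⟩ := ‹Nonempty ι›
  have hAs : A = (A i0 i0) • (1 : Matrix ι ι R) := by
    nth_rewrite 1 [hA]
    rw [smul_one_eq_diagonal]
    congr 1; funext i
    calc A i i = A i i * (A i0 i0 * A i0 i0) := by rw [hsq, mul_one]
      _ = A i0 i0 := by rw [← mul_assoc, hprod, one_mul]
  have haa := hsq i0
  generalize A i0 i0 = a at hAs haa
  have hFs : F = a • (1 : Matrix ι ι R) := by
    calc F = (a * a) • F := by rw [haa, one_smul]
      _ = a • (A * F) := by rw [hAs, smul_mul_assoc, one_mul, smul_smul]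
      _ = a • 1 := by rw [hF]
  refine ⟨a, ?_⟩
  have hD : (Dd A F hF).1 = Matrix.scalar (ι ⊕ ι) a := by
    rw [scalar_apply, ← smul_one_eq_diagonal, ← fromBlocks_one, fromBlocks_smul]
    simp [Dd, hFs, hAs]
  have hcomm : Uu X hX * g = Uu X hX * Dd A F hF := by
    rw [hgeq]
    apply Subtype.ext
    rw [Submonoid.coe_mul, Submonoid.coe_mul, hD]
    exact (Matrix.scalar_commute a (Commute.all _) _)
  rw [mul_left_cancel hcomm, hD]

/-- The additive group of symmetric `X` killed by `ψ`. -/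
def symKer : AddSubgroup (Matrix ι ι R) where
  carrier := {X | ∃ hX : X.IsSymm, ψ (Uu X hX) = 1}
  zero_mem' := ⟨by simp, by rw [Uu_zero, map_one]⟩
  add_mem' := by
    rintro X Y ⟨hX, h1⟩ ⟨hY, h2⟩
    exact ⟨hX.add hY, by rw [← Uu_mul _ _ hX hY, map_mul, h1, h2, one_mul]⟩
  neg_mem' := by
    rintro X ⟨hX, h1⟩
    exact ⟨hX.neg, by rw [Uu_neg X hX, map_inv, h1, inv_one]⟩

lemma symKer_conj {X : Matrix ι ι R} (h : X ∈ symKer ψ) (E F : Matrix ι ι R) (hF : E * F = 1) :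
    E * X * Eᵀ ∈ symKer ψ := by
  obtain ⟨hX, h1⟩ := h
  refine ⟨conj_symm E hX, ?_⟩
  have a1 := congrArg ψ (Dd_Uu E F hF X hX)
  rw [map_mul, map_mul, h1, mul_one, right_eq_mul] at a1
  exact a1

lemma symKer_transv {X : Matrix ι ι R} (h : X ∈ symKer ψ) (i j : ι) (hij : i ≠ j) (c : R) :
    transvection i j c * X * (transvection i j c)ᵀ ∈ symKer ψ :=
  symKer_conj ψ h _ (transvection i j (-c)) (by
    rw [transvection_mul_transvection_same _ _ hij]; simp)

lemma symKer_sq {X : Matrix ι ι R} (h : X ∈ symKer ψ) (i j : ι) (hij : i ≠ j) (c : R) :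
    Matrix.single i i (2 * c ^ 2 * X j j) ∈ symKer ψ := by
  have h1 := symKer_transv ψ h i j hij c
  have h2 := symKer_transv ψ h i j hij (-c)
  have h3 := sub_mem (sub_mem (add_mem h1 h2) h) h
  convert h3 using 1
  simp only [transvection, transpose_add, transpose_one, transpose_single]
  have e1 : Matrix.single i j (-c) = - Matrix.single i j c := by ext; simp [Matrix.single_apply]; split_ifs <;> simp
  have e2 : Matrix.single j i (-c) = - Matrix.single j i c := by ext; simp [Matrix.single_apply]; split_ifs <;> simp
  have e3 : Matrix.single i i (2 * c ^ 2 * X j j) =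
      2 • (Matrix.single i j c * X * Matrix.single j i c) := by
    rw [single_mul_mul_single, smul_single]
    congr 1
    simp; ring
  rw [e1, e2, e3]
  noncomm_ring

lemma symKer_lin {X : Matrix ι ι R} (h : X ∈ symKer ψ) (i j : ι) (hij : i ≠ j) (c : R) :
    Matrix.single i i (8 * X j j * c) ∈ symKer ψ := by
  have h1 := sub_mem (symKer_sq ψ h i j hij (c + 1)) (symKer_sq ψ h i j hij (c - 1))
  convert h1 using 1
  have : 8 * X j j * c = 2 * (c + 1) ^ 2 * X j j + -(2 * (c - 1) ^ 2 * X j j) := by ring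
  rw [this, single_add, sub_eq_add_neg (Matrix.single _ _ _)]
  refine congrArg _ ?_
  ext; simp only [Matrix.single_apply, Matrix.neg_apply]; split_ifs <;> simp

lemma symKer_all [IsDomain R] [CharZero R] [Nontrivial ι] (X : Matrix ι ι R) (h : X ∈ symKer ψ)
    (h0 : X ≠ 0) : ∃ r : R, r ≠ 0 ∧ ∀ (Y : Matrix ι ι R) (hY : Y.IsSymm),
      ψ (Uu (r • Y) (smul_symm _ hY)) = 1 := by
  -- first find a nonzero diagonal entry
  obtain ⟨X, h, j, hj⟩ : ∃ X ∈ symKer ψ, ∃ j, X j j ≠ 0 := by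
    by_contra hcon
    push Not at hcon
    apply h0
    have hXs : X.IsSymm := h.1
    ext i j
    by_cases hij : i = j
    · subst hij; exact hcon X h i
    have h1 := hcon _ (symKer_transv ψ h i j hij 1) i
    have e : (transvection i j (1 : R) * X * (transvection i j (1 : R))ᵀ : Matrix ι ι R) i i =
        X i i + X i j + X j i + X j j := by
      simp only [transvection, transpose_add, transpose_one, transpose_single, add_mul, mul_add,
        Matrix.add_apply, one_mul, mul_one]
      simp [single_mul_mul_single]
      ring
    rw [e, hcon X h i, hcon X h j, hXs.apply i j] at h1
    have : 2 * X i j = 0 := by linear_combination h1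
    simpa using this
  obtain ⟨i, hi⟩ := exists_ne j
  set z := 16 * X j j with hz
  have hd : ∀ k c, Matrix.single k k (z * c) ∈ symKer ψ := by
    intro k c
    by_cases hk : k = i
    · subst hk
      convert symKer_lin ψ h k j hi (2 * c) using 2
      rw [hz]; ring
    · have h1 := symKer_sq ψ (symKer_lin ψ h i j hi c) k i hk 1
      convert h1 using 2
      simp [hz]; ring
  have ho : ∀ k m c, Matrix.single k m (z * c) + Matrix.single m k (z * c) ∈ symKer ψ := by
    intro k m c
    by_cases hkm : k = m
    · subst hkm; exact add_mem (hd _ _) (hd _ _)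
    have h1 := sub_mem (sub_mem (symKer_transv ψ (hd m c) k m hkm 1) (hd k c)) (hd m c)
    convert h1 using 1
    simp only [transvection, transpose_add, transpose_one, transpose_single, add_mul, mul_add,
      one_mul, mul_one, single_mul_single_same]
    abel
  refine ⟨2 * z, ?_, ?_⟩
  · have : (2 : R) ≠ 0 := two_ne_zero
    have h16 : (16 : R) ≠ 0 := by exact_mod_cast (by norm_num : (16 : ℕ) ≠ 0)
    simp [hz, hj, h16]
  · intro Y hY
    have hmem : (2 * z) • Y ∈ symKer ψ := by
      have : (2 * z) • Y = ∑ k, ∑ m,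
          (Matrix.single k m (z * Y k m) + Matrix.single m k (z * Y k m)) := by
        simp only [Finset.sum_add_distrib]
        have e1 : ∑ k, ∑ m, Matrix.single k m (z * Y k m) = z • Y := by
          conv_rhs => rw [matrix_eq_sum_single (z • Y)]
          simp
        have e2 : ∑ k, ∑ m, Matrix.single m k (z * Y k m) = z • Y := by
          rw [Finset.sum_comm, ← e1]
          refine Finset.sum_congr rfl fun k _ => Finset.sum_congr rfl fun m _ => ?_
          rw [hY.apply]
        rw [e1, e2]; module
      rw [this]
      exact sum_mem fun k _ => sum_mem fun m _ => ho _ _ _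
    exact hmem.2

end Elem


section Final
open Polynomial

lemma lemD {L : Type*} [Field L] [IsAlgClosed L] [CharZero L] {N : ℕ} (l : ℕ) (hl : l.Prime)
    (hlN : 2 * N + 1 < l) (M : Matrix (Fin N) (Fin N) L) (h1 : M ^ l = 1)
    (h2 : ∀ a : ℕ, 0 < a → a < l → ∃ C : (Matrix (Fin N) (Fin N) L)ˣ, C.1 * M = M ^ (a * a) * C.1) :
    M = 1 := by
  classical
  rcases Nat.eq_zero_or_pos N with rfl | hN
  · exact Subsingleton.elim _ _
  have : Nonempty (Fin N) := ⟨⟨0, hN⟩⟩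
  have hspec : ∀ ζ ∈ spectrum L M, ζ = 1 := by
    intro ζ hζ
    by_contra hne
    have hζl : ζ ^ l = 1 := by
      have := spectrum.pow_mem_pow M l hζ
      rw [h1, spectrum.one_eq] at this
      exact this
    have hprim : IsPrimitiveRoot ζ l := by
      have := orderOf_eq_prime (p := l) (hp := ⟨hl⟩) hζl hne
      exact this ▸ IsPrimitiveRoot.orderOf ζ
    have hmem : ∀ a : ℕ, 0 < a → a < l → ζ ^ (a * a) ∈ spectrum L M := by
      intro a ha hal
      obtain ⟨C, hC⟩ := h2 a ha hal
      have e : M ^ (a * a) = C.1 * M * C⁻¹.1 := by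
        rw [hC, mul_assoc, Units.mul_inv, mul_one]
      have := spectrum.pow_mem_pow M (a * a) hζ
      rw [e] at this
      rwa [spectrum.units_conjugate] at this
    have hinj : Set.InjOn (fun a : ℕ => ζ ^ (a * a)) (Finset.Icc 1 (N + 1)) := by
      intro a ha b hb hab
      simp only [Finset.coe_Icc, Set.mem_Icc] at ha hb
      have := (hprim.isOfFinOrder hl.ne_zero).pow_eq_pow_iff_modEq.mp hab
      rw [← hprim.eq_orderOf] at this
      have h3 : (l : ℤ) ∣ (b + a) * (b - a) := by
        have := this.dvd
        push_cast at this
        convert this using 1; ring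
      rcases (Nat.prime_iff_prime_int.mp hl).dvd_or_dvd h3 with h | h
      · have := Int.le_of_dvd (by omega) h
        have : l ≤ b + a := by exact_mod_cast this
        by_contra hh
        omega
      · have := Int.eq_zero_of_abs_lt_dvd h (by rw [abs_lt]; constructor <;> omega)
        omega
    have hsub : (Finset.Icc 1 (N + 1)).image (fun a : ℕ => ζ ^ (a * a)) ⊆ M.charpoly.roots.toFinset := by
      intro x hx
      obtain ⟨a, ha, rfl⟩ := Finset.mem_image.mp hx
      rw [Finset.mem_Icc] at ha
      rw [Multiset.mem_toFinset, Polynomial.mem_roots (M.charpoly_monic.ne_zero)]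
      exact Matrix.mem_spectrum_iff_isRoot_charpoly.mp (hmem a (by omega) (by omega))
    have h5 := Finset.card_le_card hsub
    rw [Finset.card_image_of_injOn hinj, Nat.card_Icc] at h5
    have h6 := Multiset.toFinset_card_le M.charpoly.roots
    have h7 := Polynomial.card_roots' M.charpoly
    rw [Matrix.charpoly_natDegree_eq_dim, Fintype.card_fin] at h7
    omega
  set Φ : L[X] := ∑ i ∈ Finset.range l, X ^ i with hΦ
  have hu : IsUnit (aeval M Φ) := by
    rw [← spectrum.zero_notMem_iff L]
    intro h0
    rw [spectrum.map_polynomial_aeval_of_nonempty _ _ (spectrum.nonempty_of_isAlgClosed_of_finiteDimensional L M)] at h0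
    obtain ⟨k, hk, hk0⟩ := h0
    rw [hspec k hk] at hk0
    simp [hΦ, Polynomial.eval_finsetSum] at hk0
    exact hl.ne_zero hk0
  have : aeval M Φ * (M - 1) = 0 := by
    have := geom_sum_mul M l
    rw [h1, sub_self] at this
    rw [← this, hΦ]
    simp
  exact sub_eq_zero.mp (hu.mul_right_eq_zero.mp this)

/-- Group-theoretic version over a characteristic-zero domain. -/
lemma gl_eq_one {O : Type*} [CommRing O] [IsDomain O] [CharZero O] {N : ℕ} (l : ℕ) (hl : l.Prime)
    (hlN : 2 * N + 1 < l) (M : GL (Fin N) O) (h1 : M ^ l = 1)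
    (h2 : ∀ a : ℕ, 0 < a → a < l → ∃ C : GL (Fin N) O, C * M = M ^ (a * a) * C) : M = 1 := by
  let L := AlgebraicClosure (FractionRing O)
  have hcz : CharZero L := by
    have : CharZero (FractionRing O) := inferInstance
    exact charZero_of_injective_algebraMap (algebraMap (FractionRing O) L).injective
  let f : O →+* L := (algebraMap (FractionRing O) L).comp (algebraMap O (FractionRing O))
  have hf : Function.Injective f :=
    (algebraMap (FractionRing O) L).injective.comp (IsFractionRing.injective O (FractionRing O))
  let Φ : GL (Fin N) O →* GL (Fin N) L := Matrix.GeneralLinearGroup.map f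
  have h3 : (Φ M).1 = 1 := by
    refine lemD l hl hlN _ ?_ ?_
    · rw [← Units.val_pow_eq_pow_val, ← map_pow, h1, map_one, Units.val_one]
    · intro a ha hal
      obtain ⟨C, hC⟩ := h2 a ha hal
      refine ⟨Φ C, ?_⟩
      rw [← Units.val_pow_eq_pow_val, ← Units.val_mul, ← Units.val_mul, ← map_pow, ← map_mul, hC,
        map_mul]
  apply Units.ext
  ext i j
  apply hf
  have h4 := congrFun (congrFun h3 i) j
  rw [Units.val_one, Matrix.one_apply]
  rw [Matrix.one_apply] at h4
  rw [apply_ite f, map_one, map_zero, ← h4]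
  rfl

instance hasFiniteQuotients_padicInt (l : ℕ) [Fact l.Prime] : Ring.HasFiniteQuotients ℤ_[l] where
  finiteQuotient {I} hI := by
    obtain ⟨z, hz, hz0⟩ := Submodule.exists_mem_ne_zero_of_ne_bot hI
    have hle : RingHom.ker (PadicInt.toZModPow z.valuation : ℤ_[l] →+* _) ≤ I := by
      rw [PadicInt.ker_toZModPow, Ideal.span_singleton_le_iff_mem]
      have := PadicInt.unitCoeff_spec hz0
      have h2 : (l : ℤ_[l]) ^ z.valuation = (PadicInt.unitCoeff hz0)⁻¹.1 * z := by
        rw [Units.eq_inv_mul_iff_mul_eq]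
        exact this.symm
      rw [h2]
      exact I.mul_mem_left _ hz
    have : NeZero (l ^ z.valuation) := ⟨pow_ne_zero _ (Fact.out : l.Prime).ne_zero⟩
    have hfin : Finite (ℤ_[l] ⧸ RingHom.ker (PadicInt.toZModPow z.valuation : ℤ_[l] →+* _)) :=
      Finite.of_injective _ (RingHom.kerLift_injective (PadicInt.toZModPow z.valuation : ℤ_[l] →+* _))
    exact Finite.of_surjective _ (Ideal.Quotient.factor_surjective hle)

variable (l : ℕ) [hl : Fact l.Prime] {O : Type*} [CommRing O] [IsDomain O] [CharZero O]
  [Algebra ℤ_[l] O] [FaithfulSMul ℤ_[l] O] [Module.Finite ℤ_[l] O]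

lemma isUnit_nat (a : ℕ) (h : ¬ l ∣ a) : IsUnit (a : O) := by
  have h1 : IsUnit (a : ℤ_[l]) := by
    rw [PadicInt.isUnit_iff]
    have := PadicInt.norm_int_lt_one_iff_dvd (p := l) (a : ℤ)
    have h2 := PadicInt.norm_le_one (a : ℤ_[l])
    by_contra h3
    apply h
    have := this.mp (by push_cast; exact lt_of_le_of_ne h2 h3)
    exact_mod_cast this
  simpa using h1.map (algebraMap ℤ_[l] O)

lemma prime_mem [IsLocalRing O] : (l : O) ∈ IsLocalRing.maximalIdeal O := by
  rw [IsLocalRing.mem_maximalIdeal, mem_nonunits_iff]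
  intro h
  have h2 : IsUnit (algebraMap ℤ_[l] O (l : ℤ_[l])) := by simpa using h
  have h3 := isUnit_of_map_unit (algebraMap ℤ_[l] O) _ h2
  exact PadicInt.prime_p.not_isUnit h3

lemma dvd_pow_l (r : O) (hr : r ≠ 0) : ∃ k : ℕ, r ∣ (l : O) ^ k := by
  have h := Ideal.comap_ne_bot_of_integral_mem (R := ℤ_[l]) (I := Ideal.span {r}) hr
    (Ideal.mem_span_singleton_self r) (Algebra.IsIntegral.isIntegral r)
  obtain ⟨z, hz, hz0⟩ := Submodule.exists_mem_ne_zero_of_ne_bot h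
  refine ⟨z.valuation, ?_⟩
  rw [Ideal.mem_comap, Ideal.mem_span_singleton] at hz
  rw [PadicInt.unitCoeff_spec hz0, map_mul, map_pow, map_natCast] at hz
  exact (IsUnit.dvd_mul_left ((PadicInt.unitCoeff hz0).isUnit.map (algebraMap ℤ_[l] O))).mp hz

lemma finite_quot (l : ℕ) [Fact l.Prime] {O : Type*} [CommRing O] [IsDomain O]
    [Algebra ℤ_[l] O] [FaithfulSMul ℤ_[l] O] [Module.Finite ℤ_[l] O] (I : Ideal O) (hI : I ≠ ⊥) : Finite (O ⧸ I) := by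
  have : Ring.HasFiniteQuotients O := .of_module_finite ℤ_[l] O
  exact Ring.HasFiniteQuotients.finiteQuotient hI

variable {O' : Type*} [CommRing O'] [IsDomain O'] [CharZero O'] [IsLocalRing O']
  [Algebra ℤ_[l] O'] [FaithfulSMul ℤ_[l] O'] [Module.Finite ℤ_[l] O']
  {ι : Type*} [Fintype ι] [DecidableEq ι] [Nontrivial ι] {N : ℕ}

lemma kernel_part (hlN : 2 * N + 1 < l) (hN : 1 ≤ N) (φ : symplecticGroup ι O' →* GL (Fin N) O)
    (hφ : φ ≠ 1) (g : symplecticGroup ι O') (hg : φ g = 1) :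
    ∃ a : O', g.1 = Matrix.scalar (ι ⊕ ι) a := by
  by_contra hns
  have hl2 : ¬ l ∣ 2 := fun h => by have := Nat.le_of_dvd (by norm_num) h; omega
  obtain ⟨v, hv⟩ := (isUnit_nat l (O := O') 2 hl2).exists_right_inv
  obtain ⟨X, hX, hX0, hφX⟩ := exists_Uu_of_nonscalar φ v (by exact_mod_cast hv) g hg hns
  obtain ⟨r, hr, hall⟩ := symKer_all φ X ⟨hX, hφX⟩ hX0
  obtain ⟨k, s, hs⟩ := dvd_pow_l l r hr
  have hk : ∀ (Y : Matrix ι ι O') (hY : Y.IsSymm),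
      φ (Uu (((l : O') ^ k) • Y) (smul_symm _ hY)) = 1 := by
    intro Y hY
    rw [← hall (s • Y) (smul_symm _ hY)]
    congr 1
    exact Uu_congr (by rw [hs, mul_smul]) _ _
  clear hs
  induction k with
  | zero =>
    apply hφ
    apply psi_gen
    intro X hX
    rw [← hk X hX]
    congr 1
    exact Uu_congr (by rw [pow_zero, one_smul]) _ _
  | succ k ih =>
    apply ih
    intro Y hY
    apply gl_eq_one l hl.out hlN
    · rw [← map_pow, Uu_pow, ← hk Y hY]
      congr 1
      exact Uu_congr (by rw [smul_smul, pow_succ']) _ _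
    · intro a ha hal
      obtain ⟨b, hb⟩ := (isUnit_nat l (O := O') a
        (fun h => absurd (Nat.le_of_dvd ha h) (by omega))).exists_right_inv
      have hE : ((a : O') • (1 : Matrix ι ι O')) * (b • (1 : Matrix ι ι O')) = 1 := by
        rw [smul_mul_smul_comm, hb, one_smul, one_mul]
      refine ⟨φ (Dd _ _ hE), ?_⟩
      rw [← map_pow, ← map_mul, ← map_mul, Dd_Uu, Uu_pow]
      congr 2
      refine Uu_congr ?_ _ _
      simp only [smul_mul_assoc, one_mul, transpose_smul, transpose_one, mul_smul_comm, mul_one,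
        smul_smul]
      push_cast
      congr 1
      ring

lemma cont_part (l : ℕ) [hl : Fact l.Prime] {O : Type*} [CommRing O] [IsDomain O] [CharZero O]
    [Algebra ℤ_[l] O] [FaithfulSMul ℤ_[l] O] [Module.Finite ℤ_[l] O]
    {O' : Type*} [CommRing O'] [IsDomain O'] [CharZero O'] [IsLocalRing O']
    [Algebra ℤ_[l] O'] [FaithfulSMul ℤ_[l] O'] [Module.Finite ℤ_[l] O']
    {ι : Type*} [Fintype ι] [DecidableEq ι] {N : ℕ}
    [IsLocalRing O] (φ : symplecticGroup ι O' →* GL (Fin N) O) (i : ℕ) :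
    ∃ j : ℕ, ∀ g : symplecticGroup ι O',
      (∀ a b, (g.1 - 1) a b ∈ IsLocalRing.maximalIdeal O' ^ j) →
      Matrix.GeneralLinearGroup.map (Ideal.Quotient.mk (IsLocalRing.maximalIdeal O ^ i)) (φ g)
        = 1 := by
  have hl0 : (l : O) ≠ 0 := Nat.cast_ne_zero.mpr hl.out.ne_zero
  have hl0' : (l : O') ≠ 0 := Nat.cast_ne_zero.mpr hl.out.ne_zero
  have hne : IsLocalRing.maximalIdeal O ^ i ≠ ⊥ := by
    intro h
    have := Ideal.pow_mem_pow (prime_mem l (O := O)) i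
    rw [h, Ideal.mem_bot] at this
    exact pow_ne_zero i hl0 this
  have hfin := finite_quot l _ hne
  have : Finite (GL (Fin N) (O ⧸ IsLocalRing.maximalIdeal O ^ i)) := inferInstance
  set ψ := (Matrix.GeneralLinearGroup.map (n := Fin N)
    (Ideal.Quotient.mk (IsLocalRing.maximalIdeal O ^ i))).comp φ with hψ
  set m := Nat.card (GL (Fin N) (O ⧸ IsLocalRing.maximalIdeal O ^ i)) with hm
  have hm0 : (m : O') ≠ 0 := Nat.cast_ne_zero.mpr Nat.card_pos.ne'
  have hU : ∀ X (hX : X.IsSymm), (∀ a b, X a b ∈ Ideal.span {(m : O')}) → ψ (Uu X hX) = 1 := by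
    intro X hX h
    simp only [Ideal.mem_span_singleton'] at h
    choose Y hY using h
    have hXY : X = (m : O') • Matrix.of Y := by
      ext a b; rw [Matrix.smul_apply, Matrix.of_apply, smul_eq_mul, mul_comm, hY]
    have hYs : (Matrix.of Y).IsSymm := by
      ext a b
      apply mul_right_cancel₀ hm0
      rw [Matrix.transpose_apply, Matrix.of_apply, Matrix.of_apply, hY, hY, hX.apply]
    rw [Uu_congr hXY hX (smul_symm _ hYs), ← Uu_pow _ hYs, map_pow, hm, pow_card_eq_one']
  have hne' : Ideal.span {(l * m : O')} ≠ ⊥ := by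
    rw [Ne, Ideal.span_singleton_eq_bot]
    exact mul_ne_zero hl0' hm0
  have hfin' := finite_quot l _ hne'
  obtain ⟨j, hj⟩ := IsLocalRing.exists_maximalIdeal_pow_le_of_isArtinianRing_quotient
    (Ideal.span {(l * m : O')})
  refine ⟨j, fun g hg => ?_⟩
  refine psi_cong ψ _ hU (Ideal.span {(l * m : O')}) ?_ ?_ g (fun a b => hj (hg a b))
  · rw [Ideal.span_singleton_le_span_singleton]; exact dvd_mul_left _ _
  · rw [Ideal.span_singleton_le_iff_mem]
    exact Ideal.mul_mem_right _ _ (prime_mem l)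

end Final

end SpAux

/-- **Wong, Theorem 4(a) for `Sp_{2n}`.**  For integers `n, N > 1` there is a constant
`c(n,N) > 0` such that for every prime `l > c(n,N)` and any rings of integers `𝒪, 𝒪'` of
finite extensions `K, K'` of `ℚ_l` (realized as the integral closure of `ℤ_l` in the
extension, which is a local ring), every abstract (not assumed continuous) group
homomorphism `φ : Sp_{2n}(𝒪') → GL_N(𝒪)` is continuous for the `l`-adic topologies — the
topologies in which the principal congruence subgroups form bases of neighbourhoods of the
identity, so that continuity of the group homomorphism `φ` means exactly that for every `i`
there is a `j` with `φ(G'_j) ⊆ G_i` — and moreover if `φ` is nontrivial then `ker φ` is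
contained in the subgroup of scalar matrices. -/
theorem abstract_hom_Sp_continuous (n N : ℕ) (hn : 1 < n) (hN : 1 < N) :
    ∃ c : ℕ, 0 < c ∧
      ∀ (l : ℕ) [Fact (Nat.Prime l)], c < l →
      ∀ (K K' : Type) [Field K] [Field K']
        [Algebra ℚ_[l] K] [Algebra ℚ_[l] K']
        [FiniteDimensional ℚ_[l] K] [FiniteDimensional ℚ_[l] K']
        [Algebra ℤ_[l] K] [Algebra ℤ_[l] K']
        [IsScalarTower ℤ_[l] ℚ_[l] K] [IsScalarTower ℤ_[l] ℚ_[l] K']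
        [IsLocalRing ↥(integralClosure ℤ_[l] K)] [IsLocalRing ↥(integralClosure ℤ_[l] K')],
      ∀ φ : Matrix.symplecticGroup (Fin n) ↥(integralClosure ℤ_[l] K') →*
              GL (Fin N) ↥(integralClosure ℤ_[l] K),
        -- `φ` is continuous:
        (∀ i : ℕ, ∃ j : ℕ,
          ∀ g, g ∈ spCongruence n (IsLocalRing.maximalIdeal ↥(integralClosure ℤ_[l] K')) j →
            φ g ∈ glCongruence N (IsLocalRing.maximalIdeal ↥(integralClosure ℤ_[l] K)) i) ∧
        -- if `φ` is nontrivial, `ker φ` consists of scalar matrices: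
        (φ ≠ 1 → ∀ g ∈ φ.ker,
          ∃ a : ↥(integralClosure ℤ_[l] K'),
            (g : Matrix (Fin n ⊕ Fin n) (Fin n ⊕ Fin n) ↥(integralClosure ℤ_[l] K')) =
              Matrix.scalar (Fin n ⊕ Fin n) a) := by
  refine ⟨2 * N + 1, by omega, ?_⟩
  intro l hl hlN K K' _ _ _ _ _ _ _ _ _ _ _ _ φ
  have hcK : CharZero K := charZero_of_injective_algebraMap (algebraMap ℚ_[l] K).injective
  have hcK' : CharZero K' := charZero_of_injective_algebraMap (algebraMap ℚ_[l] K').injective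
  have hf : Module.Finite ℤ_[l] (integralClosure ℤ_[l] K) :=
    IsIntegralClosure.finite ℤ_[l] ℚ_[l] K _
  have hf' : Module.Finite ℤ_[l] (integralClosure ℤ_[l] K') :=
    IsIntegralClosure.finite ℤ_[l] ℚ_[l] K' _
  have hc : CharZero (integralClosure ℤ_[l] K) := inferInstance
  have hc' : CharZero (integralClosure ℤ_[l] K') := inferInstance
  have hs : FaithfulSMul ℤ_[l] (integralClosure ℤ_[l] K) := by
    rw [faithfulSMul_iff_algebraMap_injective]
    have h : Function.Injective (algebraMap ℤ_[l] K) := by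
      rw [IsScalarTower.algebraMap_eq ℤ_[l] ℚ_[l] K]
      exact (algebraMap ℚ_[l] K).injective.comp (IsFractionRing.injective ℤ_[l] ℚ_[l])
    intro x y hxy
    exact h (congrArg Subtype.val hxy)
  have hs' : FaithfulSMul ℤ_[l] (integralClosure ℤ_[l] K') := by
    rw [faithfulSMul_iff_algebraMap_injective]
    have h : Function.Injective (algebraMap ℤ_[l] K') := by
      rw [IsScalarTower.algebraMap_eq ℤ_[l] ℚ_[l] K']
      exact (algebraMap ℚ_[l] K').injective.comp (IsFractionRing.injective ℤ_[l] ℚ_[l])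
    intro x y hxy
    exact h (congrArg Subtype.val hxy)
  have hnt : Nontrivial (Fin n) := Fin.nontrivial_iff_two_le.mpr hn
  constructor
  · intro i
    obtain ⟨j, hj⟩ := SpAux.cont_part l φ i
    refine ⟨j, fun g hg => ?_⟩
    refine MonoidHom.mem_ker.mpr (hj g fun a b => ?_)
    have h1 : (g.1.map (Ideal.Quotient.mk _)) = 1 := hg
    have h2 := congrFun (congrFun h1 a) b
    rw [← Ideal.Quotient.eq_zero_iff_mem, Matrix.sub_apply, map_sub, sub_eq_zero]
    rw [Matrix.map_apply] at h2
    rw [h2, Matrix.one_apply, Matrix.one_apply]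
    split_ifs <;> simp
  · intro hφ g hg
    exact SpAux.kernel_part l hlN (by omega) φ hφ g hg
end
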